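/- As g → ∞, C(2^{3g−3}) = (1/π)·(1 − 2/(9g) − 238/(2025g²) − 198149/(2733750g³)) + O(g^{−4}), where 2^{3g−3} denotes the tuple of 3g−3 entries all equal to 2 (so g(2^{3g−3}) = g). -/

import Mathlib

open scoped BigOperators

noncomputable section

namespace WittenAsym

/-- `g(d)` as a rational number: `g(d) = 1 + (∑ⱼ dⱼ − n)/3`. -/
def gQ (l : List ℕ) : ℚ := 1 + ((l.sum : ℚ) - (l.length : ℚ)) / 3

/-- `X(d)` as a rational number: `X(d) = (∑ⱼ (2dⱼ+1))/3 = 2g(d) − 2 + n`. -/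
def XQ (l : List ℕ) : ℚ := (2 * (l.sum : ℚ) + (l.length : ℚ)) / 3

/-- `X(d)` as a natural number (the correct value whenever `X(d)` is an integer). -/
def XN (l : List ℕ) : ℕ := (2 * l.sum + l.length) / 3

/-- `g(d)` is a nonnegative integer. -/
def IntegralG (l : List ℕ) : Prop := ∃ g : ℕ, (g : ℚ) = gQ l

/-- The subtuple of `r` indexed by the finite index set `I`. -/
def select (r : List ℕ) (I : Finset (Fin r.length)) : List ℕ :=
  ((List.finRange r.length).filter (fun i => i ∈ I)).map r.get

/-- The characterization of the normalized Witten intersection numbers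
`C(d) = 2^{2g(d)} ∏ⱼ (2dⱼ+1)!! / (3^{2g(d)-2+n} (2g(d)-3+n)!) ∫ ψ₁^{d₁}⋯ψₙ^{dₙ}`:
they form the unique family of rationals, symmetric in the entries of `d`, vanishing
when `g(d)` is not a nonnegative integer, with `C(0,0,0) = 1/3`, `C(1) = 1/6`,
and satisfying the DVV recursion whenever `X(d) = 2g(d) - 2 + n ≥ 2`. -/
structure IsNormalizedWitten (C : List ℕ → ℚ) : Prop where
  symm : ∀ {l l' : List ℕ}, l.Perm l' → C l = C l'
  init3 : C [0, 0, 0] = 1/3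
  init1 : C [1] = 1/6
  vanish : ∀ l : List ℕ, ¬ IntegralG l → C l = 0
  dvv : ∀ (d₁ : ℕ) (r : List ℕ), IntegralG (d₁ :: r) → 2 ≤ XQ (d₁ :: r) →
    C (d₁ :: r) =
      (∑ j : Fin r.length,
        if 1 ≤ d₁ + r.get j then
          (2 * (r.get j : ℚ) + 1) / (3 * (XQ (d₁ :: r) - 1)) *
            C (r.set j.val (d₁ + r.get j - 1))
        else 0)
      + ∑ a ∈ Finset.range (d₁ - 1),
          (2 / (3 * (XQ (d₁ :: r) - 1)) * C (a :: (d₁ - 2 - a) :: r)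
          + ∑ I : Finset (Fin r.length),
              if 3 ∣ (2 * (a + (select r I).sum) + (1 + (select r I).length)) then
                ((XN (a :: select r I) - 1).factorial : ℚ) *
                  ((XN ((d₁ - 2 - a) :: select r Iᶜ) - 1).factorial : ℚ) /
                  (6 * ((XN (d₁ :: r) - 1).factorial : ℚ)) *
                  C (a :: select r I) * C ((d₁ - 2 - a) :: select r Iᶜ)
              else 0)


section Part1

open scoped Classical in
/-- Multiset version of `C`, real valued, with the convention `1/6` for the empty multiset. -/
def cm (C : List ℕ → ℚ) (m : Multiset ℕ) : ℝ := if m = 0 then 1/6 else (C m.toList : ℝ)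

/-- genus relation -/
def HasG (g : ℕ) (m : Multiset ℕ) : Prop := m.sum + 3 = 3 * g + Multiset.card m

/-- level -/
def lv (m : Multiset ℕ) : ℕ := (2 * m.sum + Multiset.card m) / 3

variable {C : List ℕ → ℚ}

lemma cm_coe (hC : IsNormalizedWitten C) (l : List ℕ) (hl : l ≠ []) : cm C (l : Multiset ℕ) = (C l : ℝ) := by
  unfold cm
  rw [if_neg (by simpa using hl)]
  have : (l : Multiset ℕ).toList.Perm l := by
    rw [← Multiset.coe_eq_coe]; simp
  rw [hC.symm this]

lemma integralG_iff (l : List ℕ) : IntegralG l ↔ ∃ g, HasG g (l : Multiset ℕ) := by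
  unfold IntegralG gQ HasG
  constructor
  · rintro ⟨g, h⟩
    refine ⟨g, ?_⟩
    have : (l.sum : ℚ) + 3 = 3 * g + l.length := by rw [h]; ring
    simp only [Multiset.sum_coe, Multiset.coe_card]
    exact_mod_cast this
  · rintro ⟨g, h⟩
    refine ⟨g, ?_⟩
    simp only [Multiset.sum_coe, Multiset.coe_card] at h
    have : (l.sum : ℚ) + 3 = 3 * g + l.length := by exact_mod_cast h
    linarith

lemma cm_vanish (hC : IsNormalizedWitten C) (m : Multiset ℕ) (h : ¬ ∃ g, HasG g m) : cm C m = 0 := by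
  unfold cm
  have h0 : m ≠ 0 := by rintro rfl; exact h ⟨1, by simp [HasG]⟩
  rw [if_neg h0]
  rw [hC.vanish]; simp
  rw [integralG_iff]; simpa using h

lemma select_coe (r : List ℕ) (I : Finset (Fin r.length)) :
    ((select r I : List ℕ) : Multiset ℕ) = I.val.map r.get := by
  unfold select
  rw [← Multiset.map_coe]
  congr 1
  have : I = (Finset.univ.filter (fun i => i ∈ I)) := by simp
  conv_rhs => rw [this]
  rw [Finset.filter_val]
  rw [← Multiset.filter_coe]
  rfl

lemma sum_powerset_antidiag {α : Type*} [DecidableEq α] (f : α → ℕ) (F : Multiset ℕ → Multiset ℕ → ℝ)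
    (U : Finset α) :
    ∑ I ∈ U.powerset, F (I.val.map f) ((U \ I).val.map f) =
      ((U.val.map f).antidiagonal.map (fun p => F p.1 p.2)).sum := by
  induction U using Finset.induction_on generalizing F with
  | empty => simp
  | insert a s ha ih =>
    rw [Finset.sum_powerset_insert ha, Finset.insert_val_of_notMem ha, Multiset.map_cons,
      Multiset.antidiagonal_cons, Multiset.map_add, Multiset.sum_add, Multiset.map_map, Multiset.map_map]
    congr 1
    · have := ih (fun p q => F p (f a ::ₘ q))
      simp only [Function.comp, Prod.map] 
      simp only [id]
      rw [← this]
      refine Finset.sum_congr rfl fun I hI => ?_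
      rw [Finset.mem_powerset] at hI
      have : insert a s \ I = insert a (s \ I) := by
        rw [Finset.insert_sdiff_of_notMem]; exact fun h => ha (hI h)
      rw [this, Finset.insert_val_of_notMem, Multiset.map_cons]
      simp [ha]
    · have := ih (fun p q => F (f a ::ₘ p) q)
      simp only [Function.comp, Prod.map, id]
      rw [← this]
      refine Finset.sum_congr rfl fun I hI => ?_
      rw [Finset.mem_powerset] at hI
      have h1 : insert a s \ insert a I = s \ I := by
        ext x; simp; grind
      rw [h1, Finset.insert_val_of_notMem (fun h => ha (hI h)), Multiset.map_cons]

lemma sum_select (r : List ℕ) (F : Multiset ℕ → Multiset ℕ → ℝ) :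
    ∑ I : Finset (Fin r.length), F (select r I : List ℕ) (select r Iᶜ : List ℕ) =
      ((r : Multiset ℕ).antidiagonal.map (fun p => F p.1 p.2)).sum := by
  have := sum_powerset_antidiag r.get F (Finset.univ)
  have h2 : (Finset.univ : Finset (Fin r.length)).val.map r.get = (r : Multiset ℕ) := by
    have : (Finset.univ : Finset (Fin r.length)).val = (List.finRange r.length : Multiset _) := rfl
    rw [this, Multiset.map_coe]; simp
  rw [h2, Finset.powerset_univ] at this
  rw [← this]
  refine Finset.sum_congr rfl fun I _ => ?_
  rw [select_coe, select_coe, Finset.compl_eq_univ_sdiff]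

lemma sum_fin_get (l : List ℕ) (F : ℕ → ℝ) :
    ∑ j : Fin l.length, F (l.get j) = ((l : Multiset ℕ).map F).sum := by
  simp only [Multiset.map_coe, Multiset.sum_coe, List.get_eq_getElem]
  exact Fin.sum_univ_fun_getElem l F

lemma lv_of_HasG {g : ℕ} {m : Multiset ℕ} (h : HasG g m) : lv m + 2 = 2 * g + Multiset.card m ∨ (g = 0 ∧ Multiset.card m ≤ 2) := by
  unfold lv HasG at *; omega

/-- DVV recursion for multisets. -/
theorem dvv_m (hC : IsNormalizedWitten C) (d : ℕ) (r : Multiset ℕ) (hg : ∃ g, HasG g (d ::ₘ r))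
    (hX : 2 ≤ lv (d ::ₘ r)) :
    cm C (d ::ₘ r) =
      1 / (3 * ((lv (d ::ₘ r) : ℝ) - 1)) *
        (r.map fun v => if 1 ≤ d + v then (2 * (v : ℝ) + 1) * cm C ((d + v - 1) ::ₘ r.erase v) else 0).sum
      + ∑ a ∈ Finset.range (d - 1),
        (2 / (3 * ((lv (d ::ₘ r) : ℝ) - 1)) * cm C (a ::ₘ (d - 2 - a) ::ₘ r)
          + (r.antidiagonal.map fun p =>
              ((lv (a ::ₘ p.1) - 1).factorial : ℝ) * ((lv ((d - 2 - a) ::ₘ p.2) - 1).factorial : ℝ) /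
                (6 * ((lv (d ::ₘ r) - 1).factorial : ℝ)) * cm C (a ::ₘ p.1) * cm C ((d - 2 - a) ::ₘ p.2)).sum) := by
  obtain ⟨l, rfl⟩ : ∃ l : List ℕ, r = (l : Multiset ℕ) := ⟨r.toList, by simp⟩
  have hXN : ∀ l : List ℕ, XN l = lv (l : Multiset ℕ) := by intro l; simp [XN, lv]
  have hXQ : XQ (d :: l) = (lv (d ::ₘ (l : Multiset ℕ)) : ℚ) := by
    obtain ⟨g, hg⟩ := hg
    have : 3 * lv (d ::ₘ (l : Multiset ℕ)) = 2 * (d :: l).sum + (d :: l).length := by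
      simp [HasG, lv] at hg ⊢; omega
    unfold XQ
    have h2 : (3 : ℚ) * lv (d ::ₘ (l : Multiset ℕ)) = 2 * (d :: l).sum + (d :: l).length := by exact_mod_cast this
    rw [← h2]; ring
  have key := hC.dvv d l ((integralG_iff _).2 (by simpa using hg)) (by rw [hXQ]; exact_mod_cast hX)
  rw [show cm C (d ::ₘ (l : Multiset ℕ)) = (C (d :: l) : ℝ) from cm_coe hC (d :: l) (by simp), key]
  push_cast
  congr 1
  · rw [← Multiset.sum_map_mul_left, ← sum_fin_get l]
    refine Finset.sum_congr rfl fun j _ => ?_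
    simp only [List.get_eq_getElem]
    split_ifs with h
    · have : ((d + l[(j:ℕ)] - 1) ::ₘ (l : Multiset ℕ).erase l[(j:ℕ)]) = ((l.set j (d + l[(j:ℕ)] - 1) : List ℕ) : Multiset ℕ) := by
        rw [Multiset.coe_erase, Multiset.cons_coe, Multiset.coe_eq_coe]
        refine List.Perm.trans (List.Perm.cons _ ?_) (List.set_perm_cons_eraseIdx j.2 _).symm
        rw [← List.perm_cons l[(j:ℕ)]]
        exact (List.perm_cons_erase (List.getElem_mem _)).symm.trans (List.getElem_cons_eraseIdx_perm j.2).symm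
      rw [this, cm_coe hC _ (by have := j.2; intro h0; simp at h0; simp [h0] at this)]
      push_cast [hXQ]
      ring
    · simp
  · refine Finset.sum_congr rfl fun a _ => ?_
    congr 1
    · rw [← cm_coe hC _ (by simp), hXQ]; simp
    · rw [← sum_select l (fun p q => ((lv (a ::ₘ p) - 1).factorial : ℝ) * ((lv ((d - 2 - a) ::ₘ q) - 1).factorial : ℝ) /
                (6 * ((lv (d ::ₘ (l : Multiset ℕ)) - 1).factorial : ℝ)) * cm C (a ::ₘ p) * cm C ((d - 2 - a) ::ₘ q))]
      refine Finset.sum_congr rfl fun I _ => ?_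
      split_ifs with h
      · rw [hXN, hXN, hXN]
        simp only [Multiset.cons_coe]
        rw [cm_coe hC _ (by simp), cm_coe hC _ (by simp)]
        push_cast
        rfl
      · rw [cm_vanish hC (a ::ₘ (select l I : Multiset ℕ))]
        · simp
        · rintro ⟨g, hg⟩
          simp [HasG] at hg
          omega

lemma cm_zero : cm C 0 = 1/6 := by simp [cm]
lemma cm_three (hC : IsNormalizedWitten C) : cm C {0,0,0} = 1/3 := by
  have := cm_coe hC [0,0,0] (by simp); rw [hC.init3] at this; push_cast at this; exact this
lemma cm_one (hC : IsNormalizedWitten C) : cm C {1} = 1/6 := by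
  have := cm_coe hC [1] (by simp); rw [hC.init1] at this; push_cast at this; exact this

end Part1

section Part2

variable {C : List ℕ → ℚ}

/-- all entries at least two -/
def Red (m : Multiset ℕ) : Prop := ∀ v ∈ m, 2 ≤ v

/-- keep the entries at least two -/
def big (m : Multiset ℕ) : Multiset ℕ := m.filter (2 ≤ ·)

lemma big_red (m : Multiset ℕ) : Red (big m) := fun _ hv => (Multiset.mem_filter.1 hv).2
lemma big_of_red {m : Multiset ℕ} (h : Red m) : big m = m := Multiset.filter_eq_self.2 h
lemma big_cons (v : ℕ) (m : Multiset ℕ) : big (v ::ₘ m) = if 2 ≤ v then v ::ₘ big m else big m := by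
  unfold big; split_ifs with h
  · rw [Multiset.filter_cons_of_pos _ h]
  · rw [Multiset.filter_cons_of_neg _ h]
lemma red_cons {v : ℕ} {m : Multiset ℕ} : Red (v ::ₘ m) ↔ 2 ≤ v ∧ Red m := by
  simp [Red]
lemma Red.erase {m : Multiset ℕ} (h : Red m) (v : ℕ) : Red (m.erase v) :=
  fun w hw => h w (Multiset.mem_of_mem_erase hw)

lemma sum_erase' {m : Multiset ℕ} {v : ℕ} (h : v ∈ m) : v + (m.erase v).sum = m.sum :=
  Multiset.sum_erase h
lemma card_erase' {m : Multiset ℕ} {v : ℕ} (h : v ∈ m) : Multiset.card (m.erase v) + 1 = Multiset.card m :=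
  Multiset.card_erase_add_one h

lemma Red.two_mul_card_le {m : Multiset ℕ} (h : Red m) : 2 * Multiset.card m ≤ m.sum := by
  have := Multiset.card_nsmul_le_sum h
  simpa [mul_comm] using this

lemma sum_weights (m : Multiset ℕ) :
    (m.map fun v : ℕ => (2 * (v : ℝ) + 1)).sum = 2 * (m.sum : ℝ) + (Multiset.card m : ℝ) := by
  induction m using Multiset.induction_on with
  | empty => simp
  | cons a s ih =>
    rw [Multiset.map_cons, Multiset.sum_cons, ih, Multiset.sum_cons, Multiset.card_cons]; push_cast; ring

lemma msum_congr {m : Multiset ℕ} {f g : ℕ → ℝ} (h : ∀ v ∈ m, f v = g v) : (m.map f).sum = (m.map g).sum := by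
  rw [Multiset.map_congr rfl h]

lemma three_lv {g : ℕ} {m : Multiset ℕ} (h : HasG g m) : 3 * lv m = 2 * m.sum + Multiset.card m := by
  unfold HasG lv at *; omega

lemma hasG_one_cons {g : ℕ} {m : Multiset ℕ} : HasG g (1 ::ₘ m) ↔ HasG g m := by
  simp [HasG]; omega

lemma cm_dil (hC : IsNormalizedWitten C) (r : Multiset ℕ) (h : 1 ≤ lv r ∨ r = 0) :
    cm C (1 ::ₘ r) = cm C r := by
  rcases h with h | rfl
  swap
  · rw [cm_zero]; exact cm_one hC
  by_cases hg : ∃ g, HasG g r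
  · obtain ⟨g, hg⟩ := hg
    have hg' : HasG g (1 ::ₘ r) := hasG_one_cons.2 hg
    have h3 := three_lv hg
    have h3' : lv (1 ::ₘ r) = lv r + 1 := by
      have := three_lv hg'; simp at this; omega
    rw [dvv_m hC 1 r ⟨g, hg'⟩ (by omega)]
    rw [msum_congr (g := fun v : ℕ => (2 * (v : ℝ) + 1) * cm C r)]
    · rw [Multiset.sum_map_mul_right, sum_weights, h3']
      have : (2 * (r.sum : ℝ) + Multiset.card r) = 3 * lv r := by exact_mod_cast h3.symm
      have h0 : (lv r : ℝ) ≠ 0 := by positivity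
      rw [this]; push_cast; simp; field_simp
    · intro v hv
      simp [Multiset.cons_erase hv]
  · rw [cm_vanish hC r hg, cm_vanish hC]
    rintro ⟨g, h'⟩
    exact hg ⟨g, hasG_one_cons.1 h'⟩

/-- string operator -/
def str (F : Multiset ℕ → ℝ) (X : ℕ) (r : Multiset ℕ) : ℝ :=
  1 / (3 * ((X : ℝ) - 1)) * (r.map fun v : ℕ => if 1 ≤ v then (2 * (v : ℝ) + 1) * F ((v - 1) ::ₘ r.erase v) else 0).sum

lemma cm_str (hC : IsNormalizedWitten C) (r : Multiset ℕ) (hg : ∃ g, HasG g (0 ::ₘ r)) (h : 2 ≤ lv (0 ::ₘ r)) :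
    cm C (0 ::ₘ r) = str (cm C) (lv (0 ::ₘ r)) r := by
  rw [dvv_m hC 0 r hg h]
  simp [str]

def H0 (F : Multiset ℕ → ℝ) (m : Multiset ℕ) : ℝ := F (big m)
def H1 (F : Multiset ℕ → ℝ) (m : Multiset ℕ) : ℝ := str (H0 F) (lv (0 ::ₘ big m)) (big m)
def H2 (F : Multiset ℕ → ℝ) (m : Multiset ℕ) : ℝ := str (H1 F) (lv (0 ::ₘ 0 ::ₘ m)) m

def Spl (F : Multiset ℕ → ℝ) (d : ℕ) (r : Multiset ℕ) : ℝ :=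
  if d = 2 then H2 F r else
    2 * H1 F ((d - 2) ::ₘ r) + ∑ a ∈ Finset.Ico 1 (d - 2), H0 F (a ::ₘ (d - 2 - a) ::ₘ r)

def T (F : Multiset ℕ → ℝ) (d : ℕ) (r : Multiset ℕ) : ℝ :=
  1 / (3 * ((lv (d ::ₘ r) : ℝ) - 1)) * (r.map fun v : ℕ => (2 * (v : ℝ) + 1) * F ((d + v - 1) ::ₘ r.erase v)).sum
    + 2 / (3 * ((lv (d ::ₘ r) : ℝ) - 1)) * Spl F d r

def Prd (C : List ℕ → ℚ) (d : ℕ) (r : Multiset ℕ) : ℝ :=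
  ∑ a ∈ Finset.range (d - 1), (r.antidiagonal.map fun p =>
              ((lv (a ::ₘ p.1) - 1).factorial : ℝ) * ((lv ((d - 2 - a) ::ₘ p.2) - 1).factorial : ℝ) /
                (6 * ((lv (d ::ₘ r) - 1).factorial : ℝ)) * cm C (a ::ₘ p.1) * cm C ((d - 2 - a) ::ₘ p.2)).sum

lemma ones_add {m : Multiset ℕ} (h : ∀ v ∈ m, 1 ≤ v) : ∃ k, m = Multiset.replicate k 1 + big m := by
  refine ⟨Multiset.card (m.filter (fun v => ¬ 2 ≤ v)), ?_⟩
  have h1 : m.filter (fun v => ¬ 2 ≤ v) = Multiset.replicate (Multiset.card (m.filter (fun v => ¬ 2 ≤ v))) 1 := by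
    rw [Multiset.eq_replicate]
    refine ⟨rfl, fun b hb => ?_⟩
    rw [Multiset.mem_filter] at hb
    have := h b hb.1; omega
  rw [← h1, add_comm]; exact (Multiset.filter_add_not _ _).symm

lemma cm_ones (hC : IsNormalizedWitten C) (k : ℕ) (t : Multiset ℕ) (h : 1 ≤ lv t ∨ t = 0) :
    cm C (Multiset.replicate k 1 + t) = cm C t := by
  induction k with
  | zero => simp
  | succ k ih =>
    rw [Multiset.replicate_succ, Multiset.cons_add, cm_dil hC, ih]
    rcases h with h | rfl
    · left; simp [lv] at h ⊢; omega
    · rcases k with _ | k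
      · right; simp
      · left; simp [lv]; omega

lemma hasG_ones {g k : ℕ} {t : Multiset ℕ} : HasG g (Multiset.replicate k 1 + t) ↔ HasG g t := by
  simp [HasG]; omega

lemma HasG_big {g : ℕ} {m : Multiset ℕ} (h : ∀ v ∈ m, 1 ≤ v) : HasG g (big m) ↔ HasG g m := by
  obtain ⟨k, hk⟩ := ones_add h
  conv_rhs => rw [hk]
  rw [hasG_ones]

lemma Red.lv_pos {m : Multiset ℕ} (h : Red m) : 1 ≤ lv m ∨ m = 0 := by
  by_cases h0 : m = 0
  · right; exact h0
  · left
    have := Multiset.card_pos.2 h0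
    have := h.two_mul_card_le
    unfold lv; omega

/-- no zero: remove ones -/
lemma cm_H0 (hC : IsNormalizedWitten C) (m : Multiset ℕ) (h : ∀ v ∈ m, 1 ≤ v) :
    cm C m = H0 (cm C) m := by
  obtain ⟨k, hk⟩ := ones_add h
  unfold H0
  conv_lhs => rw [hk]
  exact cm_ones hC k _ (big_red m).lv_pos

lemma cm_H1 (hC : IsNormalizedWitten C) (r : Multiset ℕ) (hg : ∃ g, HasG g (0 ::ₘ r)) (hb : big r ≠ 0)
    (h : ∀ v ∈ r, 1 ≤ v) :
    cm C (0 ::ₘ r) = H1 (cm C) r := by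
  have hl : 2 ≤ lv (0 ::ₘ big r) := by
    have := (big_red r).two_mul_card_le
    have := Multiset.card_pos.2 hb
    simp [lv]; omega
  obtain ⟨k, hk⟩ := ones_add h
  have e1 : cm C (0 ::ₘ r) = cm C (0 ::ₘ big r) := by
    conv_lhs => rw [hk]
    rw [← Multiset.add_cons, cm_ones hC]
    left; omega
  have hg' : ∃ g, HasG g (0 ::ₘ big r) := by
    obtain ⟨g, hg⟩ := hg
    refine ⟨g, ?_⟩
    rw [hk, ← Multiset.add_cons, hasG_ones] at hg
    exact hg
  rw [e1, cm_str hC _ hg' hl]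
  unfold H1 str
  congr 1
  apply msum_congr
  intro v hv
  have hv2 := big_red r v hv
  rw [if_pos (by omega), if_pos (by omega), cm_H0 hC]
  intro w hw
  rcases Multiset.mem_cons.1 hw with h' | h'
  · omega
  · have := (big_red r).erase v w h'; omega

lemma cm_H2 (hC : IsNormalizedWitten C) (r : Multiset ℕ) (hg : ∃ g, HasG g (0 ::ₘ 0 ::ₘ r)) (hb : r ≠ 0)
    (h : Red r) :
    cm C (0 ::ₘ 0 ::ₘ r) = H2 (cm C) r := by
  have hl : 2 ≤ lv (0 ::ₘ 0 ::ₘ r) := by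
    have := h.two_mul_card_le
    have := Multiset.card_pos.2 hb
    simp [lv]; omega
  rw [cm_str hC _ hg hl]
  unfold H2 str
  congr 1
  rw [Multiset.map_cons, Multiset.sum_cons]
  simp only [show ¬ (1 ≤ 0) by omega, if_false, zero_add]
  apply msum_congr
  intro v hv
  have hv2 := h v hv
  rw [if_pos (by omega), if_pos (by omega)]
  have : (v - 1) ::ₘ (0 ::ₘ r).erase v = 0 ::ₘ (v - 1) ::ₘ r.erase v := by
    rw [Multiset.erase_cons_tail _ (by omega), Multiset.cons_swap]
  have s1 := sum_erase' hv
  have s2 := card_erase' hv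
  obtain ⟨g, hg⟩ := hg
  rw [this, cm_H1 hC]
  · exact ⟨g, by simp [HasG] at hg ⊢; omega⟩
  · intro h0
    rw [big_cons, big_of_red (h.erase v)] at h0
    split_ifs at h0 with h3
    · simp at h0
    · simp [h0] at s1 s2
      simp [HasG] at hg
      omega
  · intro w hw
    rcases Multiset.mem_cons.1 hw with h' | h'
    · omega
    · have := h.erase v w h'; omega

/-- exact recursion for reduced multisets -/
theorem cm_T (hC : IsNormalizedWitten C) (d : ℕ) (r : Multiset ℕ) (hg : ∃ g, HasG g (d ::ₘ r))
    (h : Red (d ::ₘ r)) : cm C (d ::ₘ r) = T (cm C) d r + Prd C d r := by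
  obtain ⟨hd, hr⟩ := red_cons.1 h
  have hX : 2 ≤ lv (d ::ₘ r) := by
    obtain ⟨g, hg⟩ := hg
    have := h.two_mul_card_le
    simp [lv, HasG] at *; omega
  rw [dvv_m hC d r hg hX, Finset.sum_add_distrib, ← add_assoc, ← Finset.mul_sum]
  unfold T Prd
  congr 3
  · apply msum_congr
    intro v hv
    rw [if_pos (by omega)]
  · obtain ⟨g, hg⟩ := hg
    unfold Spl
    have hg2 : ∀ a ∈ Finset.range (d - 1), ∃ g', HasG g' (a ::ₘ (d - 2 - a) ::ₘ r) := by
      intro a ha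
      rw [Finset.mem_range] at ha
      refine ⟨g - 1, ?_⟩
      have := h.two_mul_card_le
      simp [HasG] at *; omega
    split_ifs with h2
    · subst h2
      simp
      rw [cm_H2 hC r]
      · simpa using hg2 0 (by simp)
      · rintro rfl; simp [HasG] at hg; omega
      · exact hr
    · obtain ⟨e, rfl⟩ : ∃ e, d = e + 3 := ⟨d - 3, by omega⟩
      have hH1 : cm C (0 ::ₘ (e + 1) ::ₘ r) = H1 (cm C) ((e + 1) ::ₘ r) := by
        rw [cm_H1 hC]
        · simpa using hg2 0 (by simp)
        · rw [big_cons, big_of_red hr]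
          split_ifs with h'
          · simp
          · rintro rfl; simp [HasG] at hg; omega
        · intro w hw
          rcases Multiset.mem_cons.1 hw with h' | h'
          · omega
          · have := hr w h'; omega
      rw [show e + 3 - 1 = e + 1 + 1 by omega, Finset.sum_range_succ, Finset.range_eq_Ico,
        Finset.sum_eq_sum_Ico_succ_bot (by omega)]
      simp only [show e + 3 - 2 = e + 1 by omega, Nat.sub_zero, Nat.sub_self]
      rw [Multiset.cons_swap (e+1) 0, hH1, two_mul]
      rw [Finset.sum_congr rfl (g := fun a => H0 (cm C) (a ::ₘ (e + 1 - a) ::ₘ r))]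
      · simp only [zero_add]; ring
      · intro a ha
        rw [Finset.mem_Ico] at ha
        rw [cm_H0 hC]
        intro w hw
        simp at hw
        rcases hw with h' | h' | h'
        · omega
        · omega
        · have := hr w h'; omega

end Part2

section Part3

variable {C : List ℕ → ℚ}

lemma wsum_bound (r : Multiset ℕ) (f : ℕ → ℝ) (c B : ℝ) (h : ∀ v ∈ r, |f v - c| ≤ B) :
    |(r.map fun v : ℕ => (2 * (v : ℝ) + 1) * f v).sum - (2 * (r.sum : ℝ) + Multiset.card r) * c| ≤
      (2 * (r.sum : ℝ) + Multiset.card r) * B := by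
  induction r using Multiset.induction_on with
  | empty => simp
  | cons a s ih =>
    have ih := ih (fun v hv => h v (Multiset.mem_cons_of_mem hv))
    have ha := h a (Multiset.mem_cons_self a s)
    rw [Multiset.map_cons, Multiset.sum_cons, Multiset.sum_cons, Multiset.card_cons]
    rw [Nat.cast_add, Nat.cast_add, Nat.cast_one]
    have h1 : |(2 * (a : ℝ) + 1) * f a - (2 * (a : ℝ) + 1) * c| ≤ (2 * (a : ℝ) + 1) * B := by
      rw [← mul_sub, abs_mul, abs_of_nonneg (by positivity)]
      exact mul_le_mul_of_nonneg_left ha (by positivity)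
    rw [abs_le] at *
    constructor <;> nlinarith

lemma str_bound (F : Multiset ℕ → ℝ) (X : ℕ) (r : Multiset ℕ) (c B w : ℝ) (hX : 2 ≤ X)
    (hw : 2 * (r.sum : ℝ) + Multiset.card r = w * (3 * ((X : ℝ) - 1)))
    (h1 : ∀ v ∈ r, 1 ≤ v)
    (h : ∀ v ∈ r, |F ((v - 1) ::ₘ r.erase v) - c| ≤ B) :
    |str F X r - w * c| ≤ w * B := by
  unfold str
  rw [msum_congr (g := fun v : ℕ => (2 * (v : ℝ) + 1) * F ((v - 1) ::ₘ r.erase v))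
    (fun v hv => by rw [if_pos (h1 v hv)])]
  have hX' : (2 : ℝ) ≤ X := by exact_mod_cast hX
  have hpos : 0 < 3 * ((X : ℝ) - 1) := by linarith
  have := wsum_bound r (fun v => F ((v - 1) ::ₘ r.erase v)) c B h
  rw [hw] at this
  rw [show ∀ S : ℝ, 1 / (3 * ((X : ℝ) - 1)) * S - w * c = (S - w * (3 * ((X : ℝ) - 1)) * c) / (3 * ((X : ℝ) - 1)) by
    intro S; have : (X : ℝ) - 1 ≠ 0 := by linarith
    field_simp]
  rw [abs_div, abs_of_pos hpos, div_le_iff₀ hpos]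
  linarith

lemma card_big_le (m : Multiset ℕ) : Multiset.card (big m) ≤ Multiset.card m :=
  Multiset.card_le_card (Multiset.filter_le _ _)

lemma one_le_pred {r : Multiset ℕ} (h : Red r) {v : ℕ} (hv : v ∈ r) :
    ∀ w ∈ (v - 1) ::ₘ r.erase v, 1 ≤ w := by
  intro w hw
  rcases Multiset.mem_cons.1 hw with h' | h'
  · have := h v hv; omega
  · have := h.erase v w h'; omega

lemma H1_bound (F : Multiset ℕ → ℝ) (g N : ℕ) (m : Multiset ℕ) (c B D : ℝ) 
    (hb : big m ≠ 0) (hm : ∀ v ∈ m, 1 ≤ v) (hg : HasG g (0 ::ₘ m)) (hN : Multiset.card (big m) ≤ N)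
    (hB : ∀ m, Red m → HasG g m → Multiset.card m ≤ N → |F m - c| ≤ B)
    (hD : 2 / (3 * ((lv (0 ::ₘ big m) : ℝ) - 1)) ≤ D) :
    |H1 F m - c| ≤ B + D * (|c| + B) := by
  have hr := big_red m
  have hX : 2 ≤ lv (0 ::ₘ big m) := by
    have := (big_red m).two_mul_card_le
    have := Multiset.card_pos.2 hb
    simp [lv]; omega
  have hg' : HasG g (0 ::ₘ big m) := by
    obtain ⟨k, hk⟩ := ones_add hm
    rw [hk, ← Multiset.add_cons, hasG_ones] at hg
    exact hg
  have h3 := three_lv hg'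
  set X := lv (0 ::ₘ big m) with hXdef
  have hX' : (2 : ℝ) ≤ X := by exact_mod_cast hX
  have hw : 2 * ((big m).sum : ℝ) + Multiset.card (big m) = (1 + 2 / (3 * ((X : ℝ) - 1))) * (3 * ((X : ℝ) - 1)) := by
    have : (3 * (X : ℝ)) = 2 * ((big m).sum : ℝ) + (Multiset.card (big m) + 1) := by
      simp at h3; exact_mod_cast h3
    have h0 : (X : ℝ) - 1 ≠ 0 := by linarith
    field_simp; linarith
  have hF : ∀ v ∈ big m, |H0 F ((v - 1) ::ₘ (big m).erase v) - c| ≤ B := by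
    intro v hv
    have s1 := sum_erase' hv
    have s2 := card_erase' hv
    have s3 := hr v hv
    apply hB _ (big_red _)
    · rw [HasG_big (one_le_pred hr hv)]
      simp [HasG] at hg' ⊢; omega
    · refine (card_big_le _).trans ?_
      simp; omega
  obtain ⟨v0, hv0⟩ := Multiset.exists_mem_of_ne_zero hb
  have hB0 : 0 ≤ B := (abs_nonneg _).trans (hF v0 hv0)
  have := str_bound (H0 F) X (big m) c B _ hX hw (fun v hv => by have := hr v hv; omega) hF
  have hd : 0 ≤ 2 / (3 * ((X : ℝ) - 1)) := div_nonneg (by norm_num) (by linarith)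
  set δ := 2 / (3 * ((X : ℝ) - 1))
  change |str (H0 F) X (big m) - c| ≤ _
  have e : str (H0 F) X (big m) - c = (str (H0 F) X (big m) - (1 + δ) * c) + δ * c := by ring
  rw [e]
  have h4 := abs_add_le (str (H0 F) X (big m) - (1 + δ) * c) (δ * c)
  rw [abs_mul, abs_of_nonneg hd] at h4
  have : δ * (|c| + B) ≤ D * (|c| + B) := mul_le_mul_of_nonneg_right hD (by positivity)
  linarith

lemma lv_lower {g : ℕ} {m : Multiset ℕ} (h : HasG g m) : lv m + 2 = 2 * g + Multiset.card m := by
  unfold lv HasG at *; omega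

lemma H2_bound (F : Multiset ℕ → ℝ) (g N : ℕ) (m : Multiset ℕ) (c B : ℝ) 
    (hb : m ≠ 0) (hm : Red m) (hg : HasG g (0 ::ₘ 0 ::ₘ m)) (hN : Multiset.card m ≤ N)
    (hB : ∀ m, Red m → HasG g m → Multiset.card m ≤ N → |F m - c| ≤ B)
    (hX : 4 ≤ lv (0 ::ₘ 0 ::ₘ m)) :
    |H2 F m - c| ≤ B + (2 / (3 * ((lv (0 ::ₘ 0 ::ₘ m) : ℝ) - 3)) + 1 / (3 * ((lv (0 ::ₘ 0 ::ₘ m) : ℝ) - 1)) * (1 + 2 / (3 * ((lv (0 ::ₘ 0 ::ₘ m) : ℝ) - 3)))) * (|c| + B) := by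
  have h3 := three_lv hg
  set X := lv (0 ::ₘ 0 ::ₘ m) with hXdef
  have hX' : (4 : ℝ) ≤ X := by exact_mod_cast hX
  have hw : 2 * (m.sum : ℝ) + Multiset.card m = (1 + 1 / (3 * ((X : ℝ) - 1))) * (3 * ((X : ℝ) - 1)) := by
    have : (3 * (X : ℝ)) = 2 * (m.sum : ℝ) + (Multiset.card m + 2) := by
      simp at h3; exact_mod_cast (by omega : 3 * X = 2 * m.sum + (Multiset.card m + 2))
    have h0 : (X : ℝ) - 1 ≠ 0 := by linarith
    field_simp; linarith
  have hF : ∀ v ∈ m, |H1 F ((v - 1) ::ₘ m.erase v) - c| ≤ B + 2 / (3 * ((X : ℝ) - 3)) * (|c| + B) := by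
    intro v hv
    have s1 := sum_erase' hv
    have s2 := card_erase' hv
    have s3 := hm v hv
    have hbig : big ((v - 1) ::ₘ m.erase v) ≠ 0 := by
      intro h0
      rw [big_cons, big_of_red (hm.erase v)] at h0
      split_ifs at h0 with h3
      · simp at h0
      · simp [h0] at s1 s2
        simp [HasG] at hg
        omega
    have hlv : X ≤ lv (0 ::ₘ big ((v - 1) ::ₘ m.erase v)) + 2 := by
      rw [big_cons, big_of_red (hm.erase v)]
      simp at h3
      split_ifs with h4
      · simp [lv]; omega
      · simp [lv]; omega
    have hlv' : (X : ℝ) ≤ lv (0 ::ₘ big ((v - 1) ::ₘ m.erase v)) + 2 := by exact_mod_cast hlv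
    apply H1_bound F g N _ c B _ hbig (one_le_pred hm hv) _ _ hB
    · apply div_le_div_of_nonneg_left (by norm_num) (by linarith); linarith
    · simp [HasG] at hg ⊢; omega
    · refine (card_big_le _).trans ?_
      simp; omega
  obtain ⟨v0, hv0⟩ := Multiset.exists_mem_of_ne_zero hb
  have hB0 : 0 ≤ B + 2 / (3 * ((X : ℝ) - 3)) * (|c| + B) := (abs_nonneg _).trans (hF v0 hv0)
  have := str_bound (H1 F) X m c _ _ (by omega) hw (fun v hv => by have := hm v hv; omega) hF
  have hd : 0 ≤ 1 / (3 * ((X : ℝ) - 1)) := div_nonneg (by norm_num) (by linarith)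
  set δ := 1 / (3 * ((X : ℝ) - 1))
  change |str (H1 F) X m - c| ≤ _
  have e : str (H1 F) X m - c = (str (H1 F) X m - (1 + δ) * c) + δ * c := by ring
  rw [e]
  have h4 := abs_add_le (str (H1 F) X m - (1 + δ) * c) (δ * c)
  rw [abs_mul, abs_of_nonneg hd] at h4
  nlinarith

lemma Spl_bound (F : Multiset ℕ → ℝ) (g d : ℕ) (r : Multiset ℕ) (c B : ℝ)
    (h : Red (d ::ₘ r)) (hg : HasG (g + 1) (d ::ₘ r)) (hX : 5 ≤ lv (d ::ₘ r)) (hB0 : 0 ≤ B)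
    (hB : ∀ m, Red m → HasG g m → Multiset.card m ≤ Multiset.card r + 2 → |F m - c| ≤ B) :
    |Spl F d r - ((d : ℝ) - 1) * c| ≤ ((d : ℝ) - 1) * B + 9 / (5 * ((lv (d ::ₘ r) : ℝ) - 3)) * (|c| + B) := by
  obtain ⟨hd, hr⟩ := red_cons.1 h
  have h3 := three_lv hg
  set X := lv (d ::ₘ r) with hXdef
  have hX' : (5 : ℝ) ≤ X := by exact_mod_cast hX
  have hcB : 0 ≤ |c| + B := by positivity
  unfold Spl
  split_ifs with h2
  · subst h2
    have hl : lv (0 ::ₘ 0 ::ₘ r) = X - 1 := by simp [lv] at h3 ⊢; omega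
    have := H2_bound F g (Multiset.card r + 2) r c B (by rintro rfl; simp [HasG] at hg; omega) hr
      (by simp [HasG] at hg ⊢; omega) (by omega) hB (by omega)
    rw [hl, Nat.cast_sub (by omega)] at this
    push_cast at this
    have h5 : (2 / (3 * ((X : ℝ) - 1 - 3)) + 1 / (3 * ((X : ℝ) - 1 - 1)) * (1 + 2 / (3 * ((X : ℝ) - 1 - 3)))) ≤ 9 / (5 * ((X : ℝ) - 3)) := by
      obtain ⟨y, hy⟩ : ∃ y : ℝ, (X : ℝ) = y + 5 := ⟨X - 5, by ring⟩
      rw [hy] at hX' ⊢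
      have hy0 : 0 ≤ y := by linarith
      rw [show y + 5 - 1 - 3 = y + 1 by ring, show y + 5 - 1 - 1 = y + 3 by ring, show y + 5 - 3 = y + 2 by ring]
      rw [show 2 / (3 * (y + 1)) + 1 / (3 * (y + 3)) * (1 + 2 / (3 * (y + 1))) = (9 * y + 23) / (9 * (y+1)*(y+3)) by field_simp; ring]
      rw [div_le_div_iff₀ (by positivity) (by positivity)]
      nlinarith
    have h6 := mul_le_mul_of_nonneg_right h5 hcB
    have e : ((2 : ℕ) : ℝ) - 1 = 1 := by norm_num
    rw [e, one_mul, one_mul]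
    linarith
  · obtain ⟨e, rfl⟩ : ∃ e, d = e + 3 := ⟨d - 3, by omega⟩
    simp only [show e + 3 - 2 = e + 1 by omega]
    have hbig : big ((e + 1) ::ₘ r) ≠ 0 := by
      rw [big_cons, big_of_red hr]
      split_ifs with h'
      · simp
      · rintro rfl; simp [HasG] at hg; omega
    have h1 : ∀ v ∈ (e + 1) ::ₘ r, 1 ≤ v := by
      intro w hw
      rcases Multiset.mem_cons.1 hw with h' | h'
      · omega
      · have := hr w h'; omega
    have hlv : X ≤ lv (0 ::ₘ big ((e + 1) ::ₘ r)) + 2 := by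
      rw [big_cons, big_of_red hr]
      simp at h3
      split_ifs with h4
      · simp [lv]; omega
      · simp [lv]; omega
    have hlv' : (X : ℝ) ≤ lv (0 ::ₘ big ((e + 1) ::ₘ r)) + 2 := by exact_mod_cast hlv
    have b1 := H1_bound F g (Multiset.card r + 2) _ c B (2 / (3 * ((X : ℝ) - 3))) hbig h1
      (by simp [HasG] at hg ⊢; omega) ((card_big_le _).trans (by simp)) hB
      (by apply div_le_div_of_nonneg_left (by norm_num) (by linarith); linarith)
    have b2 : |∑ a ∈ Finset.Ico 1 (e + 1), H0 F (a ::ₘ (e + 1 - a) ::ₘ r) - e * c| ≤ e * B := by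
      have : (e : ℝ) * c = ∑ a ∈ Finset.Ico 1 (e + 1), c := by simp
      rw [this, ← Finset.sum_sub_distrib]
      refine (Finset.abs_sum_le_sum_abs _ _).trans ?_
      have : (e : ℝ) * B = ∑ a ∈ Finset.Ico 1 (e + 1), B := by simp
      rw [this]
      refine Finset.sum_le_sum fun a ha => ?_
      rw [Finset.mem_Ico] at ha
      have hh : ∀ w ∈ a ::ₘ (e + 1 - a) ::ₘ r, 1 ≤ w := by
        intro w hw
        simp at hw
        rcases hw with h' | h' | h'
        · omega
        · omega
        · have := hr w h'; omega
      apply hB _ (big_red _)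
      · rw [HasG_big hh]; simp [HasG] at hg ⊢; omega
      · exact (card_big_le _).trans (by simp)
    have h6 : 2 * (2 / (3 * ((X : ℝ) - 3))) ≤ 9 / (5 * ((X : ℝ) - 3)) := by
      have : 0 < (X : ℝ) - 3 := by linarith
      rw [← mul_div_assoc, div_le_div_iff₀ (by positivity) (by positivity)]
      nlinarith
    have h7 := mul_le_mul_of_nonneg_right h6 hcB
    push_cast
    rw [abs_le] at *
    constructor <;> nlinarith

/-- split probability -/
def qq (d : ℕ) (r : Multiset ℕ) : ℝ := 2 * ((d : ℝ) - 1) / (3 * ((lv (d ::ₘ r) : ℝ) - 1))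

theorem T_bound (F : Multiset ℕ → ℝ) (g d : ℕ) (r : Multiset ℕ) (c A B : ℝ)
    (h : Red (d ::ₘ r)) (hg : HasG (g + 1) (d ::ₘ r)) (hX : 5 ≤ lv (d ::ₘ r)) (hB0 : 0 ≤ B)
    (hA : ∀ v ∈ r, |F ((d + v - 1) ::ₘ r.erase v) - c| ≤ A)
    (hB : ∀ m, Red m → HasG g m → Multiset.card m ≤ Multiset.card r + 2 → |F m - c| ≤ B) :
    |T F d r - c| ≤ (1 - qq d r) * A + qq d r * B +
      6 / (5 * (((lv (d ::ₘ r) : ℝ) - 1) * ((lv (d ::ₘ r) : ℝ) - 3))) * (|c| + B) := by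
  have h3 := three_lv hg
  have hs := Spl_bound F g d r c B h hg hX hB0 hB
  have hm := wsum_bound r (fun v => F ((d + v - 1) ::ₘ r.erase v)) c A hA
  unfold T qq
  set X := lv (d ::ₘ r) with hXdef
  have hX' : (5 : ℝ) ≤ X := by exact_mod_cast hX
  have hw : 2 * (r.sum : ℝ) + Multiset.card r = 3 * ((X : ℝ) - 1) - 2 * ((d : ℝ) - 1) := by
    have : (3 * (X : ℝ)) = 2 * ((d : ℝ) + r.sum) + (Multiset.card r + 1) := by
      simp at h3; exact_mod_cast h3
    linarith
  rw [hw] at hm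
  generalize (r.map fun v : ℕ => (2 * (v : ℝ) + 1) * F ((d + v - 1) ::ₘ r.erase v)).sum = S at *
  generalize Spl F d r = P at *
  have hx : 0 < (X : ℝ) - 1 := by linarith
  have hx3 : 0 < (X : ℝ) - 3 := by linarith
  set x := (X : ℝ) - 1
  have e1 : 1 / (3 * x) * S + 2 / (3 * x) * P - c =
      ((S - (3 * x - 2 * ((d : ℝ) - 1)) * c) + 2 * (P - ((d : ℝ) - 1) * c)) / (3 * x) := by
    field_simp; ring
  have e2 : (1 - 2 * ((d : ℝ) - 1) / (3 * x)) * A + 2 * ((d : ℝ) - 1) / (3 * x) * B + 6 / (5 * (x * ((X : ℝ) - 3))) * (|c| + B)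
    = ((3 * x - 2 * ((d : ℝ) - 1)) * A + 2 * (((d : ℝ) - 1) * B + 9 / (5 * ((X : ℝ) - 3)) * (|c| + B))) / (3 * x) := by
    field_simp; ring
  rw [e1, e2, abs_div, abs_of_pos (by positivity : 0 < 3 * x)]
  apply div_le_div_of_nonneg_right _ (by positivity)
  refine (abs_add_le _ _).trans ?_
  rw [abs_mul, abs_two]
  linarith

end Part3

section Part4

variable {C : List ℕ → ℚ}

instance (g : ℕ) (m : Multiset ℕ) : Decidable (HasG g m) := by unfold HasG; infer_instance

def tau (g h ρ i : ℕ) : ℝ :=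
  ((2 * h - 2 + i).factorial : ℝ) * ((2 * (g - h) - 2 + (ρ - i)).factorial : ℝ) / (6 * ((2 * g - 2 + ρ).factorial : ℝ))

def Wh (g h d : ℕ) (r : Multiset ℕ) (f : ℕ → Multiset ℕ → Multiset ℕ → ℝ) : ℝ :=
  ∑ a ∈ Finset.range (d - 1), (r.antidiagonal.map fun p =>
    if HasG h (a ::ₘ p.1) then tau g h (Multiset.card r) (Multiset.card p.1) * f a p.1 p.2 else 0).sum

lemma split_genus {g d a : ℕ} {r s t : Multiset ℕ} (hg : HasG g (d ::ₘ r)) (hred : Red r)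
    (ha : a ∈ Finset.range (d - 1)) (hp : s + t = r) {h : ℕ} (hh : HasG h (a ::ₘ s)) :
    1 ≤ h ∧ h + 1 ≤ g ∧ HasG (g - h) ((d - 2 - a) ::ₘ t) ∧ Multiset.card s + 2 ≤ 3 * h
      ∧ Multiset.card t + 2 ≤ 3 * (g - h) ∧ Multiset.card s + Multiset.card t = Multiset.card r := by
  subst hp
  have h1 : Red s := fun v hv => hred v (Multiset.mem_add.2 (Or.inl hv))
  have h2 : Red t := fun v hv => hred v (Multiset.mem_add.2 (Or.inr hv))
  have := h1.two_mul_card_le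
  have := h2.two_mul_card_le
  rw [Finset.mem_range] at ha
  simp [HasG] at *
  omega

lemma split_genus' {g d a : ℕ} {r s t : Multiset ℕ} (hg : HasG g (d ::ₘ r)) (hred : Red r)
    (ha : a ∈ Finset.range (d - 1)) (hp : s + t = r) {h : ℕ} (hle : h ≤ g) (hh : HasG (g - h) ((d - 2 - a) ::ₘ t)) :
    HasG h (a ::ₘ s) := by
  subst hp
  rw [Finset.mem_range] at ha
  simp [HasG] at *
  omega

lemma Wh_congr {g h d : ℕ} {r : Multiset ℕ} {f f' : ℕ → Multiset ℕ → Multiset ℕ → ℝ}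
    (H : ∀ a ∈ Finset.range (d - 1), ∀ s t, s + t = r → HasG h (a ::ₘ s) → f a s t = f' a s t) :
    Wh g h d r f = Wh g h d r f' := by
  unfold Wh
  refine Finset.sum_congr rfl fun a ha => ?_
  congr 1
  refine Multiset.map_congr rfl fun p hp => ?_
  rw [Multiset.mem_antidiagonal] at hp
  split_ifs with hh
  · rw [H a ha _ _ hp hh]
  · rfl

lemma Wh_sub (g h d : ℕ) (r : Multiset ℕ) (f f' : ℕ → Multiset ℕ → Multiset ℕ → ℝ) :
    Wh g h d r f - Wh g h d r f' = Wh g h d r (fun a s t => f a s t - f' a s t) := by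
  unfold Wh
  rw [← Finset.sum_sub_distrib]
  refine Finset.sum_congr rfl fun a ha => ?_
  rw [← Multiset.sum_map_sub]
  congr 1
  refine Multiset.map_congr rfl fun p hp => ?_
  split_ifs with hh
  · ring
  · simp

lemma Prd_eq {g d : ℕ} {r : Multiset ℕ} (hC : IsNormalizedWitten C) (hg : HasG g (d ::ₘ r)) (hred : Red r) :
    Prd C d r = ∑ h ∈ Finset.Ico 1 g, Wh g h d r (fun a s t => cm C (a ::ₘ s) * cm C ((d - 2 - a) ::ₘ t)) := by
  unfold Prd Wh
  rw [Finset.sum_comm]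
  refine Finset.sum_congr rfl fun a ha => ?_
  rw [← Multiset.sum_map_sum]
  congr 1
  refine Multiset.map_congr rfl fun p hp => ?_
  rw [Multiset.mem_antidiagonal] at hp
  by_cases hex : ∃ h, HasG h (a ::ₘ p.1)
  · obtain ⟨h, hh⟩ := hex
    have sg := split_genus hg hred ha hp hh
    rw [Finset.sum_eq_single_of_mem h (Finset.mem_Ico.2 ⟨sg.1, by omega⟩)]
    · rw [if_pos hh]
      have l1 := lv_lower hh
      have l2 := lv_lower sg.2.2.1
      have l3 := lv_lower hg
      rw [Multiset.card_cons] at l1 l2 l3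
      unfold tau
      have e1 : lv (a ::ₘ p.1) - 1 = 2 * h - 2 + Multiset.card p.1 := by omega
      have e2 : lv ((d - 2 - a) ::ₘ p.2) - 1 = 2 * (g - h) - 2 + (Multiset.card r - Multiset.card p.1) := by omega
      have e3 : lv (d ::ₘ r) - 1 = 2 * g - 2 + Multiset.card r := by omega
      rw [e1, e2, e3]; ring
    · intro b _ hne
      rw [if_neg]
      intro hhb
      apply hne
      simp [HasG] at hh hhb; omega
  · rw [cm_vanish hC _ hex, Finset.sum_eq_zero]
    · simp
    · intro h _
      rw [if_neg]; exact fun h' => hex ⟨h, h'⟩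

lemma sum_antidiag_card (r : Multiset ℕ) (f : ℕ → ℝ) :
    (r.antidiagonal.map fun p => f (Multiset.card p.1)).sum =
      ∑ i ∈ Finset.range (Multiset.card r + 1), ((Multiset.card r).choose i : ℝ) * f i := by
  obtain ⟨l, rfl⟩ : ∃ l : List ℕ, r = (l : Multiset ℕ) := ⟨r.toList, by simp⟩
  rw [← sum_select l (fun s t => f (Multiset.card s))]
  have := Finset.sum_powerset_apply_card f (x := (Finset.univ : Finset (Fin l.length)))
  simp at this ⊢
  rw [← this]
  refine Finset.sum_congr rfl fun I _ => ?_
  congr 1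
  have := congrArg Multiset.card (select_coe l I)
  simpa using this

lemma vander (N A ρ i : ℕ) : N.choose A * ρ.choose i ≤ (N + ρ).choose (A + i) := by
  rw [Nat.add_choose_eq]
  refine Finset.single_le_sum (f := fun ij : ℕ × ℕ => N.choose ij.1 * ρ.choose ij.2) (a := (A, i)) (fun _ _ => Nat.zero_le _) ?_
  simp

lemma tau_eq {g h ρ i : ℕ} (h1 : 1 ≤ h) (h2 : h + 1 ≤ g) (hi : i ≤ ρ) :
    tau g h ρ i = 1 / (6 * ((2 * g - 2 + ρ : ℝ) * (2 * g - 3 + ρ)) * ((2 * g - 4 + ρ).choose (2 * h - 2 + i) : ℝ)) := by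
  obtain ⟨h, rfl⟩ : ∃ k, h = k + 1 := ⟨h - 1, by omega⟩
  obtain ⟨k, rfl⟩ : ∃ k, g = h + k + 2 := ⟨g - h - 2, by omega⟩
  obtain ⟨j, rfl⟩ : ∃ j, ρ = i + j := ⟨ρ - i, by omega⟩
  unfold tau
  have e1 : 2 * (h + 1) - 2 + i = 2 * h + i := by omega
  have e2 : 2 * (h + k + 2 - (h + 1)) - 2 + (i + j - i) = 2 * k + j := by omega
  have e3 : 2 * (h + k + 2) - 2 + (i + j) = (2 * h + i + (2 * k + j)) + 1 + 1 := by omega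
  have e4 : 2 * (h + k + 2) - 4 + (i + j) = 2 * h + i + (2 * k + j) := by omega
  rw [e1, e2, e3, e4]
  have := Nat.add_choose_mul_factorial_mul_factorial (2 * h + i) (2 * k + j)
  rw [← Nat.choose_symm_add] at this
  rw [Nat.factorial_succ, Nat.factorial_succ, ← this]
  have c0 : ((2 * h + i + (2 * k + j)).choose (2 * h + i) : ℝ) ≠ 0 := by
    have : 0 < (2 * h + i + (2 * k + j)).choose (2 * h + i) := Nat.choose_pos (by omega)
    positivity
  have f1 : ((2 * h + i).factorial : ℝ) ≠ 0 := by positivity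
  have f2 : ((2 * k + j).factorial : ℝ) ≠ 0 := by positivity
  push_cast
  have d1 : (2 * ((h : ℝ) + k + 2) - 2 + (i + j)) = (2 * h + i + (2 * k + j) + 1 + 1 : ℝ) := by ring
  have d2 : (2 * ((h : ℝ) + k + 2) - 3 + (i + j)) = (2 * h + i + (2 * k + j) + 1 : ℝ) := by ring
  rw [d1, d2]
  field_simp

lemma tau_choose_le {g h ρ i : ℕ} (h1 : 1 ≤ h) (h2 : h + 1 ≤ g) (hi : i ≤ ρ) :
    (ρ.choose i : ℝ) * tau g h ρ i ≤ 1 / (6 * ((2 * g - 2 + ρ : ℝ) * (2 * g - 3 + ρ)) * ((2 * g - 4).choose (2 * h - 2) : ℝ)) := by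
  rw [tau_eq h1 h2 hi]
  have hg2 : (2 : ℝ) ≤ g := by exact_mod_cast (by omega : 2 ≤ g)
  have p1 : 0 < 6 * ((2 * g - 2 + ρ : ℝ) * (2 * g - 3 + ρ)) := by
    have : (0 : ℝ) ≤ ρ := by positivity
    apply mul_pos (by norm_num); apply mul_pos <;> linarith
  have c1 : 0 < (2 * g - 4).choose (2 * h - 2) := Nat.choose_pos (by omega)
  have c2 : 0 < (2 * g - 4 + ρ).choose (2 * h - 2 + i) := Nat.choose_pos (by omega)
  have c1' : (0 : ℝ) < (2 * g - 4).choose (2 * h - 2) := by exact_mod_cast c1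
  have c2' : (0 : ℝ) < (2 * g - 4 + ρ).choose (2 * h - 2 + i) := by exact_mod_cast c2
  have v : ((2 * g - 4).choose (2 * h - 2) : ℝ) * ρ.choose i ≤ (2 * g - 4 + ρ).choose (2 * h - 2 + i) := by
    exact_mod_cast vander (2 * g - 4) (2 * h - 2) ρ i
  rw [mul_one_div, div_le_div_iff₀ (by positivity) (by positivity)]
  nlinarith

lemma tau_nonneg (g h ρ i : ℕ) : 0 ≤ tau g h ρ i := by unfold tau; positivity

lemma Wh_bound {g h d : ℕ} {r : Multiset ℕ} {f : ℕ → Multiset ℕ → Multiset ℕ → ℝ} {M : ℝ}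
    (hg : HasG g (d ::ₘ r)) (hred : Red r) (h1 : 1 ≤ h) (h2 : h + 1 ≤ g) (hM : 0 ≤ M) (k : ℕ)
    (hk : k + 1 = 3 * h ∨ k + 1 = 3 * (g - h))
    (H : ∀ a ∈ Finset.range (d - 1), ∀ s t, s + t = r → HasG h (a ::ₘ s) → |f a s t| ≤ M) :
    |Wh g h d r f| ≤ M * (k / (6 * ((2 * g - 2 + Multiset.card r : ℝ) * (2 * g - 3 + Multiset.card r)) * ((2 * g - 4).choose (2 * h - 2) : ℝ))) := by
  set ρ := Multiset.card r with hρ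
  set Q := 1 / (6 * ((2 * g - 2 + ρ : ℝ) * (2 * g - 3 + ρ)) * ((2 * g - 4).choose (2 * h - 2) : ℝ)) with hQ
  have hQ0 : 0 ≤ Q := by
    have := tau_choose_le (ρ := ρ) (i := 0) h1 h2 (Nat.zero_le _)
    refine le_trans ?_ this
    have := tau_nonneg g h ρ 0
    positivity
  -- indicator function of valid cardinalities
  let ok : ℕ → Prop := fun i => i + 2 ≤ 3 * h ∧ (ρ - i) + 2 ≤ 3 * (g - h) ∧ i ≤ ρ
  have step : |Wh g h d r f| ≤ (r.antidiagonal.map fun p => M * (if ok (Multiset.card p.1) then tau g h ρ (Multiset.card p.1) else 0)).sum := by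
    unfold Wh
    have hswap : ∑ a ∈ Finset.range (d - 1), (r.antidiagonal.map fun p =>
        if HasG h (a ::ₘ p.1) then tau g h ρ (Multiset.card p.1) * f a p.1 p.2 else 0).sum
      = (r.antidiagonal.map fun p => ∑ a ∈ Finset.range (d - 1), 
        if HasG h (a ::ₘ p.1) then tau g h ρ (Multiset.card p.1) * f a p.1 p.2 else 0).sum := by
      rw [Multiset.sum_map_sum]
    rw [hswap]
    refine (Multiset.abs_sum_le_sum_abs).trans ?_
    rw [Multiset.map_map]
    apply Multiset.sum_map_le_sum_map
    intro p hp
    rw [Multiset.mem_antidiagonal] at hp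
    simp only [Function.comp]
    by_cases hex : ∃ a ∈ Finset.range (d - 1), HasG h (a ::ₘ p.1)
    · obtain ⟨a, ha, hha⟩ := hex
      have sg := split_genus hg hred ha hp hha
      rw [Finset.sum_eq_single_of_mem a ha]
      · rw [if_pos hha, if_pos (show ok _ by refine ⟨sg.2.2.2.1, ?_, ?_⟩ <;> omega), abs_mul, abs_of_nonneg (tau_nonneg _ _ _ _), mul_comm]
        exact mul_le_mul_of_nonneg_right (H a ha _ _ hp hha) (tau_nonneg _ _ _ _)
      · intro b hb hne
        rw [if_neg]
        intro hhb
        apply hne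
        simp [HasG] at hha hhb; omega
    · rw [Finset.sum_eq_zero]
      · simp only [abs_zero]
        split_ifs
        · exact mul_nonneg hM (tau_nonneg _ _ _ _)
        · simp
      · intro a ha
        rw [if_neg]; exact fun h' => hex ⟨a, ha, h'⟩
  refine step.trans ?_
  rw [sum_antidiag_card r (fun i => M * (if ok i then tau g h ρ i else 0))]
  have : (k : ℝ) / (6 * ((2 * g - 2 + ρ : ℝ) * (2 * g - 3 + ρ)) * ((2 * g - 4).choose (2 * h - 2) : ℝ)) = k * Q := by
    rw [hQ]; ring
  rw [this]
  have b1 : ∀ i ∈ Finset.range (ρ + 1), (ρ.choose i : ℝ) * (M * (if ok i then tau g h ρ i else 0)) ≤ M * (if ok i then Q else 0) := by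
    intro i hi
    split_ifs with hok
    · have := tau_choose_le h1 h2 hok.2.2
      calc (ρ.choose i : ℝ) * (M * tau g h ρ i) = M * (ρ.choose i * tau g h ρ i) := by ring
        _ ≤ _ := mul_le_mul_of_nonneg_left this hM
    · simp
  refine (Finset.sum_le_sum b1).trans ?_
  rw [← Finset.mul_sum]
  apply mul_le_mul_of_nonneg_left _ hM
  rw [← Finset.sum_filter, Finset.sum_const, nsmul_eq_mul]
  apply mul_le_mul_of_nonneg_right _ hQ0
  norm_cast
  rcases hk with hk | hk
  · have : (Finset.range (ρ + 1)).filter ok ⊆ Finset.range k := by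
      intro i hi
      simp only [Finset.mem_filter, Finset.mem_range] at hi ⊢
      have := hi.2.1; omega
    simpa using Finset.card_le_card this
  · have : (Finset.range (ρ + 1)).filter ok ⊆ Finset.Ico (ρ + 1 - k) (ρ + 1) := by
      intro i hi
      simp only [Finset.mem_filter, Finset.mem_range, Finset.mem_Ico] at hi ⊢
      have := hi.2.2.1; have := hi.2.2.2; omega
    have := Finset.card_le_card this
    rw [Nat.card_Ico] at this
    refine this.trans ?_
    omega

lemma Wh_symm {g h d : ℕ} {r : Multiset ℕ} {f : ℕ → Multiset ℕ → Multiset ℕ → ℝ} 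
    (hg : HasG g (d ::ₘ r)) (hred : Red r) (h1 : 1 ≤ h) (h2 : h + 1 ≤ g) :
    Wh g (g - h) d r f = Wh g h d r (fun a s t => f (d - 2 - a) t s) := by
  unfold Wh
  rw [← Finset.sum_range_reflect]
  refine Finset.sum_congr rfl fun a ha => ?_
  have ha' := Finset.mem_range.1 ha
  conv_lhs => rw [← Multiset.map_swap_antidiagonal, Multiset.map_map]
  congr 1
  refine Multiset.map_congr rfl fun p hp => ?_
  have hp' := hp
  rw [Multiset.mem_antidiagonal] at hp
  simp only [Function.comp, Prod.fst_swap, Prod.snd_swap]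
  have e : d - 1 - 1 - a = d - 2 - a := by omega
  rw [e]
  by_cases hh : HasG h (a ::ₘ p.1)
  · have sg := split_genus hg hred ha hp hh
    rw [if_pos hh, if_pos sg.2.2.1]
    congr 1
    unfold tau
    have e1 : Multiset.card r - Multiset.card p.2 = Multiset.card p.1 := by omega
    have e2 : g - (g - h) = h := by omega
    have e3 : Multiset.card r - Multiset.card p.1 = Multiset.card p.2 := by omega
    rw [e1, e2, e3]; ring
  · rw [if_neg hh, if_neg]
    intro h'
    exact hh (split_genus' hg hred ha hp (by omega) h')

end Part4

section Part5

variable {C : List ℕ → ℚ}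

lemma choose_mono_half {n j k : ℕ} (h1 : j ≤ k) (h2 : 2 * k ≤ n) : n.choose j ≤ n.choose k := by
  induction k, h1 using Nat.le_induction with
  | base => exact le_rfl
  | succ k hk ih => exact (ih (by omega)).trans (Nat.choose_le_succ_of_lt_half_left (by omega))

lemma choose_mid {n j k : ℕ} (h1 : j ≤ k) (h2 : k + j ≤ n) : n.choose j ≤ n.choose k := by
  by_cases h : 2 * k ≤ n
  · exact choose_mono_half h1 h
  · rw [← Nat.choose_symm (show k ≤ n by omega)]
    exact choose_mono_half (by omega) (by omega)

/-- the per-genus weight -/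
lemma Wh_bound' {g h d : ℕ} {r : Multiset ℕ} {f : ℕ → Multiset ℕ → Multiset ℕ → ℝ} {M : ℝ}
    (hg : HasG g (d ::ₘ r)) (hred : Red r) (h1 : 1 ≤ h) (h2 : h + 1 ≤ g) (hM : 0 ≤ M) (k : ℕ)
    (hk : k + 1 = 3 * h ∨ k + 1 = 3 * (g - h)) (c : ℝ) (hc : (k : ℝ) ≤ c * ((2 * g - 4).choose (2 * h - 2) : ℝ))
    (H : ∀ a ∈ Finset.range (d - 1), ∀ s t, s + t = r → HasG h (a ::ₘ s) → |f a s t| ≤ M) :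
    |Wh g h d r f| ≤ c * (M / (6 * ((2 * g - 2 + Multiset.card r : ℝ) * (2 * g - 3 + Multiset.card r)))) := by
  refine (Wh_bound hg hred h1 h2 hM k hk H).trans ?_
  have hg2 : (2 : ℝ) ≤ g := by exact_mod_cast (by omega : 2 ≤ g)
  have p1 : 0 < 6 * ((2 * g - 2 + Multiset.card r : ℝ) * (2 * g - 3 + Multiset.card r)) := by
    have : (0 : ℝ) ≤ Multiset.card r := by positivity
    apply mul_pos (by norm_num); apply mul_pos <;> linarith
  have c1 : 0 < (2 * g - 4).choose (2 * h - 2) := Nat.choose_pos (by omega)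
  have c1' : (0 : ℝ) < (2 * g - 4).choose (2 * h - 2) := by exact_mod_cast c1
  rw [← mul_div_assoc, ← mul_div_assoc, div_le_div_iff₀ (by positivity) p1]
  have : M * (k : ℝ) ≤ M * (c * ((2 * g - 4).choose (2 * h - 2) : ℝ)) := mul_le_mul_of_nonneg_left hc hM
  have := mul_le_mul_of_nonneg_right this p1.le
  linarith

lemma mid_weight {g h : ℕ} (h1 : 2 ≤ h) (h2 : h + 2 ≤ g) :
    ∃ k : ℕ, (k + 1 = 3 * h ∨ k + 1 = 3 * (g - h)) ∧
      ((k : ℝ) ≤ 1 / ((g : ℝ) - 3) * ((2 * g - 4).choose (2 * h - 2) : ℝ)) := by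
  have hk : ∃ k : ℕ, (k + 1 = 3 * h ∨ k + 1 = 3 * (g - h)) ∧ 2 * k + 2 ≤ 3 * g := by
    by_cases hh : 2 * h ≤ g
    · exact ⟨3 * h - 1, Or.inl (by omega), by omega⟩
    · exact ⟨3 * (g - h) - 1, Or.inr (by omega), by omega⟩
  obtain ⟨k, hk, hk2⟩ := hk
  refine ⟨k, hk, ?_⟩
  have hg : (4 : ℝ) ≤ g := by exact_mod_cast (by omega : 4 ≤ g)
  have c2 : (2 * g - 4).choose 2 ≤ (2 * g - 4).choose (2 * h - 2) := choose_mid (by omega) (by omega)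
  have c3 : ((2 * g - 4).choose 2 : ℝ) = ((g : ℝ) - 2) * (2 * g - 5) := by
    rw [Nat.cast_choose_two, Nat.cast_sub (by omega)]; push_cast; ring
  have c2' : ((g : ℝ) - 2) * (2 * g - 5) ≤ ((2 * g - 4).choose (2 * h - 2) : ℝ) := by
    rw [← c3]; exact_mod_cast c2
  have hk2' : 2 * (k : ℝ) + 2 ≤ 3 * g := by exact_mod_cast hk2
  rw [one_div, ← div_eq_inv_mul, le_div_iff₀ (by linarith)]
  nlinarith

lemma sum_Wh_bound {g d : ℕ} {r : Multiset ℕ} {f : ℕ → ℕ → Multiset ℕ → Multiset ℕ → ℝ} {M : ℝ}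
    (hg : HasG g (d ::ₘ r)) (hred : Red r) (hM : 0 ≤ M)
    (H : ∀ h, ∀ a ∈ Finset.range (d - 1), ∀ s t, s + t = r → HasG h (a ::ₘ s) → |f h a s t| ≤ M) :
    |∑ h ∈ Finset.Ico 1 g, Wh g h d r (f h)| ≤
      5 * (M / (6 * ((2 * g - 2 + Multiset.card r : ℝ) * (2 * g - 3 + Multiset.card r)))) := by
  set Q := M / (6 * ((2 * g - 2 + Multiset.card r : ℝ) * (2 * g - 3 + Multiset.card r))) with hQ
  by_cases hg2 : g < 2
  · have hI : Finset.Ico 1 g = ∅ := Finset.Ico_eq_empty (by omega)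
    have e : 1 ≤ g ∨ g = 0 := by omega
    rw [hI, Finset.sum_empty, abs_zero]
    have : 0 ≤ Q := by
      rw [hQ]
      apply div_nonneg hM
      apply mul_nonneg (by norm_num)
      rcases e with e | e
      · have : g = 1 := by omega
        subst this
        push_cast
        have : Multiset.card r = 0 ∨ 1 ≤ Multiset.card r := by omega
        rcases this with h0 | h0
        · rw [h0]; norm_num
        · have : (1 : ℝ) ≤ Multiset.card r := by exact_mod_cast h0
          apply mul_nonneg <;> linarith
      · subst e
        have h1 := hred.two_mul_card_le
        have : 1 ≤ d ∨ d = 0 := by omega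
        simp [HasG] at hg
        exfalso; omega
    linarith
  rw [not_lt] at hg2
  have hg2' : (2 : ℝ) ≤ g := by exact_mod_cast hg2
  have hQ0 : 0 ≤ Q := by
    have : (0 : ℝ) ≤ Multiset.card r := by positivity
    rw [hQ]; apply div_nonneg hM
    apply mul_nonneg (by norm_num); apply mul_nonneg <;> linarith
  let w : ℕ → ℝ := fun h => (if h = 1 then 2 else 0) + (if h = g - 1 then 2 else 0) + (if 2 ≤ h ∧ h + 2 ≤ g then 1 / ((g : ℝ) - 3) else 0)
  have hb : ∀ h ∈ Finset.Ico 1 g, |Wh g h d r (f h)| ≤ w h * Q := by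
    intro h hh
    rw [Finset.mem_Ico] at hh
    have n1 : (0 : ℝ) ≤ (if 2 ≤ h ∧ h + 2 ≤ g then 1 / ((g : ℝ) - 3) else 0) := by
      split_ifs with hc
      · have : (4 : ℝ) ≤ g := by exact_mod_cast (by omega : 4 ≤ g)
        apply div_nonneg <;> linarith
      · exact le_rfl
    have n2 : (0 : ℝ) ≤ (if h = g - 1 then 2 else 0) := by split_ifs <;> norm_num
    have n3 : (0 : ℝ) ≤ (if h = 1 then 2 else 0) := by split_ifs <;> norm_num
    have c1 : 1 ≤ (2 * g - 4).choose (2 * h - 2) := Nat.choose_pos (by omega)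
    have c1' : (1 : ℝ) ≤ (2 * g - 4).choose (2 * h - 2) := by exact_mod_cast c1
    by_cases h1 : h = 1
    · refine (Wh_bound' hg hred hh.1 (by omega) hM 2 (Or.inl (by omega)) 2 (by push_cast; linarith) (H h)).trans ?_
      apply mul_le_mul_of_nonneg_right _ hQ0
      simp only [w]; rw [if_pos h1]; linarith
    · by_cases h2 : h = g - 1
      · refine (Wh_bound' hg hred hh.1 (by omega) hM 2 (Or.inr (by omega)) 2 (by push_cast; linarith) (H h)).trans ?_
        apply mul_le_mul_of_nonneg_right _ hQ0
        simp only [w]; rw [if_pos h2]; linarith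
      · obtain ⟨k, hk, hk'⟩ := mid_weight (show 2 ≤ h by omega) (show h + 2 ≤ g by omega)
        refine (Wh_bound' hg hred hh.1 (by omega) hM k hk _ hk' (H h)).trans ?_
        apply mul_le_mul_of_nonneg_right _ hQ0
        simp only [w]; rw [if_pos (show 2 ≤ h ∧ h + 2 ≤ g by omega)]; linarith
  refine (Finset.abs_sum_le_sum_abs _ _).trans ((Finset.sum_le_sum hb).trans ?_)
  rw [← Finset.sum_mul]
  apply mul_le_mul_of_nonneg_right _ hQ0
  simp only [w]
  rw [Finset.sum_add_distrib, Finset.sum_add_distrib, Finset.sum_ite_eq', Finset.sum_ite_eq', ← Finset.sum_filter, Finset.sum_const,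
    nsmul_eq_mul]
  have a1 : (if 1 ∈ Finset.Ico 1 g then (2 : ℝ) else 0) ≤ 2 := by split_ifs <;> norm_num
  have a2 : (if g - 1 ∈ Finset.Ico 1 g then (2 : ℝ) else 0) ≤ 2 := by split_ifs <;> norm_num
  have a3 : (((Finset.Ico 1 g).filter (fun h => 2 ≤ h ∧ h + 2 ≤ g)).card : ℝ) * (1 / ((g : ℝ) - 3)) ≤ 1 := by
    have hs : (Finset.Ico 1 g).filter (fun h => 2 ≤ h ∧ h + 2 ≤ g) ⊆ Finset.Ico 2 (g - 1) := by
      intro i hi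
      simp only [Finset.mem_filter, Finset.mem_Ico] at hi ⊢
      omega
    have hcard := Finset.card_le_card hs
    rw [Nat.card_Ico] at hcard
    by_cases h4 : g < 4
    · have : ((Finset.Ico 1 g).filter (fun h => 2 ≤ h ∧ h + 2 ≤ g)).card = 0 := by omega
      rw [this]; norm_num
    · have h4' : (4 : ℝ) ≤ g := by exact_mod_cast (by omega : 4 ≤ g)
      rw [mul_one_div, div_le_one (by linarith)]
      have : (((Finset.Ico 1 g).filter (fun h => 2 ≤ h ∧ h + 2 ≤ g)).card : ℝ) + 3 ≤ g := by
        exact_mod_cast (by omega)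
      linarith
  linarith

lemma tail_weight {g h : ℕ} (hg : 9 ≤ g) (h1 : 3 ≤ h) (h2 : h + 3 ≤ g) :
    ∃ k : ℕ, (k + 1 = 3 * h ∨ k + 1 = 3 * (g - h)) ∧
      ((k : ℝ) ≤ 192 / (g : ℝ) ^ 4 * ((2 * g - 4).choose (2 * h - 2) : ℝ)) := by
  have hg9 : (9 : ℝ) ≤ g := by exact_mod_cast hg
  by_cases h3 : h = 3 ∨ h + 3 = g
  · refine ⟨8, by omega, ?_⟩
    have c2 : (2 * g - 4).choose 4 ≤ (2 * g - 4).choose (2 * h - 2) := choose_mid (by omega) (by omega)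
    have c2' : ((2 * g - 4).choose 4 : ℝ) ≤ (2 * g - 4).choose (2 * h - 2) := by exact_mod_cast c2
    have c3 := Nat.pow_le_choose (α := ℝ) 4 (2 * g - 4)
    have c4 : (g : ℝ) ≤ ((2 * g - 4 + 1 - 4 : ℕ) : ℝ) := by exact_mod_cast (by omega)
    have c5 := pow_le_pow_left₀ (by positivity) c4 4
    have : ((Nat.factorial 4 : ℕ) : ℝ) = 24 := by norm_num [Nat.factorial]
    rw [this] at c3
    rw [div_mul_eq_mul_div, le_div_iff₀ (by positivity)]
    push_cast
    linarith
  · have hk : ∃ k : ℕ, (k + 1 = 3 * h ∨ k + 1 = 3 * (g - h)) ∧ 2 * k + 2 ≤ 3 * g := by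
      by_cases hh : 2 * h ≤ g
      · exact ⟨3 * h - 1, Or.inl (by omega), by omega⟩
      · exact ⟨3 * (g - h) - 1, Or.inr (by omega), by omega⟩
    obtain ⟨k, hk, hk2⟩ := hk
    refine ⟨k, hk, ?_⟩
    have c2 : (2 * g - 4).choose 6 ≤ (2 * g - 4).choose (2 * h - 2) := choose_mid (by omega) (by omega)
    have c2' : ((2 * g - 4).choose 6 : ℝ) ≤ (2 * g - 4).choose (2 * h - 2) := by exact_mod_cast c2
    have c3 := Nat.pow_le_choose (α := ℝ) 6 (2 * g - 4)
    have c4 : (g : ℝ) ≤ ((2 * g - 4 + 1 - 6 : ℕ) : ℝ) := by exact_mod_cast (by omega)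
    have c5 := pow_le_pow_left₀ (by positivity) c4 6
    have : ((Nat.factorial 6 : ℕ) : ℝ) = 720 := by norm_num [Nat.factorial]
    rw [this] at c3
    have hk2' : 2 * (k : ℝ) + 2 ≤ 3 * g := by exact_mod_cast hk2
    rw [div_mul_eq_mul_div, le_div_iff₀ (by positivity)]
    have g4 : (0 : ℝ) ≤ (g : ℝ) ^ 4 := by positivity
    have e1 : (k : ℝ) * (g : ℝ) ^ 4 ≤ (3 / 2 * g) * (g : ℝ) ^ 4 := mul_le_mul_of_nonneg_right (by linarith) g4
    have e2 : (3 / 2 * (g : ℝ)) * (g : ℝ) ^ 4 ≤ (192 / 720 * (g : ℝ) ^ 2) * (g : ℝ) ^ 4 := by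
      apply mul_le_mul_of_nonneg_right _ g4
      nlinarith
    nlinarith

lemma tail_Wh_bound {g d : ℕ} {r : Multiset ℕ} {f : ℕ → ℕ → Multiset ℕ → Multiset ℕ → ℝ} {M : ℝ}
    (hg : HasG g (d ::ₘ r)) (hred : Red r) (hM : 0 ≤ M) (hg9 : 9 ≤ g)
    (H : ∀ h, ∀ a ∈ Finset.range (d - 1), ∀ s t, s + t = r → HasG h (a ::ₘ s) → |f h a s t| ≤ M) :
    |∑ h ∈ Finset.Ico 3 (g - 2), Wh g h d r (f h)| ≤ 32 * M / (g : ℝ) ^ 5 := by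
  have hg9' : (9 : ℝ) ≤ g := by exact_mod_cast hg9
  set Q := M / (6 * ((2 * g - 2 + Multiset.card r : ℝ) * (2 * g - 3 + Multiset.card r))) with hQ
  have hQ0 : Q ≤ M / (6 * (g : ℝ) ^ 2) := by
    rw [hQ]
    apply div_le_div_of_nonneg_left hM (by positivity)
    have : (0 : ℝ) ≤ Multiset.card r := by positivity
    nlinarith
  have hb : ∀ h ∈ Finset.Ico 3 (g - 2), |Wh g h d r (f h)| ≤ 192 / (g : ℝ) ^ 4 * Q := by
    intro h hh
    rw [Finset.mem_Ico] at hh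
    obtain ⟨k, hk, hk'⟩ := tail_weight hg9 hh.1 (show h + 3 ≤ g by omega)
    exact Wh_bound' hg hred (by omega) (by omega) hM k hk _ hk' (H h)
  refine (Finset.abs_sum_le_sum_abs _ _).trans ((Finset.sum_le_sum hb).trans ?_)
  rw [Finset.sum_const, nsmul_eq_mul, Nat.card_Ico]
  have hc : ((g - 2 - 3 : ℕ) : ℝ) ≤ g := by exact_mod_cast (by omega)
  calc ((g - 2 - 3 : ℕ) : ℝ) * (192 / (g : ℝ) ^ 4 * Q) ≤ g * (192 / (g : ℝ) ^ 4 * (M / (6 * (g : ℝ) ^ 2))) := by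
        gcongr
        have : (0 : ℝ) ≤ Multiset.card r := by positivity
        rw [hQ]; apply mul_nonneg (by positivity); apply div_nonneg hM
        apply mul_nonneg (by norm_num); apply mul_nonneg <;> linarith
    _ = 32 * M / (g : ℝ) ^ 5 := by field_simp; ring

lemma erase_two (a b : ℕ) (s : Multiset ℕ) : (a ::ₘ b ::ₘ s).erase b = a ::ₘ s := by
  rw [Multiset.cons_swap, Multiset.erase_cons_head]

lemma cm_02 (hC : IsNormalizedWitten C) : cm C {0, 2} = 5 / 18 := by
  have := cm_str hC {2} ⟨1, by simp [HasG]⟩ (by simp [lv])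
  rw [show ({0, 2} : Multiset ℕ) = 0 ::ₘ {2} from rfl, this]
  simp [str, lv]
  rw [show ({1} : Multiset ℕ) = {1} from rfl, cm_one hC]; norm_num

lemma cm_11 (hC : IsNormalizedWitten C) : cm C {1, 1} = 1 / 6 := by
  have := cm_dil hC {1} (Or.inl (by simp [lv]))
  rw [cm_one hC] at this; exact this

lemma cm_4 (hC : IsNormalizedWitten C) : cm C {4} = 35 / 144 := by
  have := dvv_m hC 4 0 ⟨2, by simp [HasG]⟩ (by simp [lv])
  have h0 : cm C {0} = 0 := cm_vanish hC _ (by simp [HasG]; intro x; omega)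
  have h2 : cm C {2} = 0 := cm_vanish hC _ (by simp [HasG]; intro x; omega)
  rw [show ({4} : Multiset ℕ) = 4 ::ₘ 0 from rfl, this]
  have e02 := cm_02 hC
  have e20 : cm C {2, 0} = 5 / 18 := by rw [← e02, Multiset.pair_comm]
  have e11 := cm_11 hC
  simp only [Multiset.insert_eq_cons] at e02 e20 e11
  simp [lv, Finset.sum_range_succ, h0, h2, cm_one hC, Nat.factorial, e02, e20, e11]
  norm_num

lemma cm_003 (hC : IsNormalizedWitten C) : cm C {0, 0, 3} = 35 / 108 := by
  have := cm_str hC {0, 3} ⟨1, by simp [HasG]⟩ (by simp [lv])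
  rw [show ({0, 0, 3} : Multiset ℕ) = 0 ::ₘ {0, 3} from rfl, this]
  have e02 := cm_02 hC
  have e20 : cm C {2, 0} = 5 / 18 := by rw [← e02, Multiset.pair_comm]
  simp only [Multiset.insert_eq_cons] at e02 e20
  simp [str, lv, e02, e20, erase_two]
  norm_num [e02, e20]

lemma cm_23 (hC : IsNormalizedWitten C) : cm C {2, 3} = 1015 / 3888 := by
  have := dvv_m hC 2 {3} ⟨2, by simp [HasG]⟩ (by simp [lv])
  have h0 : cm C {0} = 0 := cm_vanish hC _ (by simp [HasG]; intro x; omega)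
  rw [show ({2, 3} : Multiset ℕ) = 2 ::ₘ {3} from rfl, this]
  have e003 := cm_003 hC
  simp only [Multiset.insert_eq_cons] at e003
  have h3 : ({3} : Multiset ℕ) = 3 ::ₘ 0 := rfl
  have hh : (Multiset.antidiagonal ({3} : Multiset ℕ)) = {(0, {3}), ({3}, 0)} := by
    rw [h3, Multiset.antidiagonal_cons]; simp
  simp [lv, h0, e003, hh, cm_4 hC]
  norm_num

def phi (X : ℕ) : ℝ := 1 - 21 / 10 / ((max X 4 : ℕ) - 1 : ℝ)

lemma phi_mono {X Y : ℕ} (h : X ≤ Y) : phi X ≤ phi Y := by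
  unfold phi
  have h1 : ((max X 4 : ℕ) : ℝ) ≤ (max Y 4 : ℕ) := by exact_mod_cast max_le_max_right 4 h
  have h2 : (4 : ℝ) ≤ (max X 4 : ℕ) := by exact_mod_cast le_max_right X 4
  have : 21 / 10 / ((max Y 4 : ℕ) - 1 : ℝ) ≤ 21 / 10 / ((max X 4 : ℕ) - 1 : ℝ) :=
    div_le_div_of_nonneg_left (by norm_num) (by linarith) (by linarith)
  linarith

lemma phi_le_four {X : ℕ} (h : X ≤ 4) : phi X = 3 / 10 := by
  unfold phi; rw [max_eq_right h]; norm_num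

lemma phi_ge {X : ℕ} : 3 / 10 ≤ phi X := by
  rw [← phi_le_four (Nat.zero_le 4)]; exact phi_mono (Nat.zero_le _)

lemma phi_le_one {X : ℕ} : phi X ≤ 1 := by
  unfold phi
  have h2 : (4 : ℝ) ≤ (max X 4 : ℕ) := by exact_mod_cast le_max_right X 4
  have : 0 ≤ 21 / 10 / ((max X 4 : ℕ) - 1 : ℝ) := div_nonneg (by norm_num) (by linarith)
  linarith

lemma phi_big {X : ℕ} (h : 4 ≤ X) : phi X = 1 - 21 / 10 / ((X : ℝ) - 1) := by
  unfold phi; rw [max_eq_left h]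

lemma phi_step {X : ℕ} (h : 5 ≤ X) :
    phi (X - 1) * (1 + 6 / (5 * (((X : ℝ) - 1) * (X - 3)))) + 5 * (1 / (6 * (((X : ℝ) - 1) * (X - 2)))) ≤ phi X := by
  rw [phi_big (by omega : 4 ≤ X - 1), phi_big (by omega : 4 ≤ X), Nat.cast_sub (by omega)]
  obtain ⟨y, rfl⟩ : ∃ y, X = y + 5 := ⟨X - 5, by omega⟩
  have hy : (0 : ℝ) ≤ y := by positivity
  push_cast
  have e1 : (y : ℝ) + 5 - 1 = y + 4 := by ring
  have e2 : (y : ℝ) + 5 - 3 = y + 2 := by ring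
  have e3 : (y : ℝ) + 5 - 2 = y + 3 := by ring
  have e4 : (y : ℝ) + 5 - 1 - 1 = y + 3 := by ring
  rw [e4, e1, e2, e3]
  rw [← sub_nonneg]
  have : 1 - 21 / 10 / ((y : ℝ) + 4) - ((1 - 21 / 10 / (y + 3)) * (1 + 6 / (5 * ((y + 4) * (y + 2)))) + 5 * (1 / (6 * ((y + 4) * (y + 3)))))
      = ((21 / 10 * (y + 2) - 6 / 5 * (y + 3 - 21 / 10) - 5 / 6 * (y + 2))) / ((y + 4) * (y + 3) * (y + 2)) := by
    field_simp; ring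
  rw [this]
  apply div_nonneg
  · linarith
  · positivity

/-- values with one small leading entry are bounded by one -/
lemma lead_bound (hC : IsNormalizedWitten C) {N : ℕ}
    (hN : ∀ m, Red m → (∃ g, HasG g m) → lv m < N → |cm C m| ≤ phi (lv m)) {a h : ℕ} {s : Multiset ℕ}
    (hs : Red s) (hh : HasG h (a ::ₘ s)) (hl : lv (a ::ₘ s) < N) : |cm C (a ::ₘ s)| ≤ 1 := by
  by_cases h2 : 2 ≤ a
  · exact (hN _ (red_cons.2 ⟨h2, hs⟩) ⟨h, hh⟩ hl).trans phi_le_one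
  by_cases h1 : a = 1
  · subst h1
    rw [cm_dil hC _ hs.lv_pos]
    refine (hN _ hs ⟨h, hasG_one_cons.1 hh⟩ ?_).trans phi_le_one
    simp [lv] at *; omega
  have h0 : a = 0 := by omega
  subst h0
  have hs0 : s ≠ 0 := by
    rintro rfl
    simp [HasG] at hh; omega
  have hb := big_of_red hs
  have hcard := Multiset.card_pos.2 hs0
  have htwo := hs.two_mul_card_le
  rw [cm_H1 hC s ⟨h, hh⟩ (by rwa [hb]) (fun v hv => by have := hs v hv; omega)]
  have h3 := three_lv hh
  set X := lv (0 ::ₘ s) with hX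
  have hX2 : 2 ≤ X := by simp at h3; omega
  have key := H1_bound (cm C) h (Multiset.card s) s 0 (phi (X - 1)) (2 / (3 * ((X : ℝ) - 1)))
    (by rwa [hb]) (fun v hv => by have := hs v hv; omega) hh (by rw [hb]) ?_ (by rw [hb])
  · simp only [sub_zero, abs_zero, zero_add] at key
    refine key.trans ?_
    have hX2' : (2 : ℝ) ≤ X := by exact_mod_cast hX2
    by_cases hX5 : X ≤ 5
    · rw [phi_le_four (by omega)]
      have : 2 / (3 * ((X : ℝ) - 1)) ≤ 2 / 3 := by
        rw [div_le_div_iff₀ (by linarith) (by norm_num)]; linarith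
      linarith
    · have hX6 : (6 : ℝ) ≤ X := by exact_mod_cast (by omega : 6 ≤ X)
      rw [phi_big (by omega), Nat.cast_sub (by omega)]
      push_cast
      obtain ⟨y, hy⟩ : ∃ y : ℝ, (X : ℝ) = y + 6 := ⟨X - 6, by ring⟩
      have hy0 : 0 ≤ y := by linarith
      rw [hy, ← sub_nonneg]
      have e1 : y + 6 - 1 = y + 5 := by ring
      have e2 : y + 6 - 1 - 1 = y + 4 := by ring
      rw [e2, e1]
      have : 1 - (1 - 21 / 10 / (y + 4) + 2 / (3 * (y + 5)) * (1 - 21 / 10 / (y + 4))) =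
        (21 / 10 * (y + 5) - 2 / 3 * (y + 4 - 21 / 10)) / ((y + 4) * (y + 5)) := by
        field_simp; ring
      rw [this]
      apply div_nonneg
      · linarith
      · positivity
  · intro m hm hg' hcm
    rw [sub_zero]
    have l1 := lv_lower hg'
    have l2 := lv_lower hh
    rw [Multiset.card_cons] at l2
    refine (hN m hm ⟨h, hg'⟩ (by omega)).trans (phi_mono (by omega))

theorem cm_bound (hC : IsNormalizedWitten C) : ∀ N : ℕ, ∀ m, Red m → (∃ g, HasG g m) → lv m < N → |cm C m| ≤ phi (lv m) := by
  intro N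
  induction N with
  | zero => intro m _ _ h; omega
  | succ N ih =>
    intro m hm hg hl
    by_cases hlt : lv m < N
    · exact ih m hm hg hlt
    obtain ⟨g, hg⟩ := hg
    by_cases h0 : m = 0
    · subst h0
      rw [cm_zero]
      refine le_trans ?_ phi_ge
      norm_num [abs_of_pos]
    obtain ⟨d, hd⟩ := Multiset.exists_mem_of_ne_zero h0
    obtain ⟨r, rfl⟩ := Multiset.exists_cons_of_mem hd
    have hl1 := lv_lower hg
    have h3 := three_lv hg
    have hcc := hm.two_mul_card_le
    rw [Multiset.card_cons] at *
    rw [Multiset.sum_cons] at *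
    obtain ⟨hd2, hr⟩ := red_cons.1 hm
    have hrr := hr.two_mul_card_le
    by_cases hX5 : 5 ≤ lv (d ::ₘ r)
    · obtain ⟨g, rfl⟩ : ∃ k, g = k + 1 := ⟨g - 1, by simp [HasG] at hg; omega⟩
      rw [cm_T hC d r ⟨_, hg⟩ hm]
      set X := lv (d ::ₘ r) with hX
      have t := T_bound (cm C) g d r 0 (phi (X - 1)) (phi (X - 1)) hm hg hX5 (le_trans (by norm_num) phi_ge) ?_ ?_
      · rw [Prd_eq hC hg hr]
        have p := sum_Wh_bound (f := fun h a s t => cm C (a ::ₘ s) * cm C ((d - 2 - a) ::ₘ t)) (M := 1) hg hr zero_le_one ?_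
        · have e1 : (2 * ((g + 1 : ℕ) : ℝ) - 2 + Multiset.card r) = X - 1 := by
            have : (X : ℝ) + 2 = 2 * ((g + 1 : ℕ) : ℝ) + (Multiset.card r + 1) := by exact_mod_cast hl1
            linarith
          have e2 : (2 * ((g + 1 : ℕ) : ℝ) - 3 + Multiset.card r) = X - 2 := by
            linarith
          rw [e1, e2] at p
          have st := phi_step hX5
          simp only [sub_zero, abs_zero, zero_add, ← hX] at t
          refine (abs_add_le _ _).trans ((add_le_add t p).trans (le_trans (le_of_eq ?_) st))
          ring
        · intro h a ha s t hst hh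
          have sg := split_genus hg hr ha hst hh
          have hs : Red s := fun v hv => hr v (by rw [← hst]; exact Multiset.mem_add.2 (Or.inl hv))
          have ht : Red t := fun v hv => hr v (by rw [← hst]; exact Multiset.mem_add.2 (Or.inr hv))
          have l1 := lv_lower hh
          have l2 := lv_lower sg.2.2.1
          rw [Multiset.card_cons] at l1 l2
          rw [abs_mul]
          exact mul_le_one₀ (lead_bound hC ih hs hh (by omega)) (abs_nonneg _) (lead_bound hC ih ht sg.2.2.1 (by omega))
      · intro v hv
        rw [sub_zero]
        have hv2 := hr v hv
        have e1 := sum_erase' hv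
        have e2 := card_erase' hv
        have hg' : HasG (g + 1) ((d + v - 1) ::ₘ r.erase v) := by
          simp [HasG] at hg ⊢; omega
        have l1 := lv_lower hg'
        rw [Multiset.card_cons] at l1
        refine (ih _ (red_cons.2 ⟨by omega, hr.erase v⟩) ⟨_, hg'⟩ (by omega)).trans (phi_mono (by omega))
      · intro m hm' hg' hcm
        rw [sub_zero]
        have l1 := lv_lower hg'
        refine (ih _ hm' ⟨_, hg'⟩ (by omega)).trans (phi_mono (by omega))
    · refine le_trans ?_ phi_ge
      have hc : Multiset.card r ≤ 1 := by omega
      have hgd := hg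
      simp [HasG] at hgd
      interval_cases hcr : Multiset.card r
      · have : r = 0 := Multiset.card_eq_zero.1 hcr
        subst this
        have hs0 : (0 : Multiset ℕ).sum = 0 := rfl
        have : d = 4 := by omega
        subst this
        have := cm_4 hC
        rw [show (4 ::ₘ 0 : Multiset ℕ) = {4} from rfl, this]; norm_num [abs_of_pos]
      · obtain ⟨e, rfl⟩ := Multiset.card_eq_one.1 hcr
        have he : 2 ≤ e := hr e (by simp)
        simp at hgd h3 hl1
        have : (d = 2 ∧ e = 3) ∨ (d = 3 ∧ e = 2) := by omega
        have h23 := cm_23 hC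
        rcases this with ⟨rfl, rfl⟩ | ⟨rfl, rfl⟩
        · rw [show (2 ::ₘ {3} : Multiset ℕ) = {2, 3} from rfl, h23]; norm_num [abs_of_pos]
        · rw [show (3 ::ₘ {2} : Multiset ℕ) = {2, 3} from Multiset.pair_comm 3 2, h23]; norm_num [abs_of_pos]

theorem cm_le_one (hC : IsNormalizedWitten C) {m : Multiset ℕ} (hm : Red m) : |cm C m| ≤ 1 := by
  by_cases hg : ∃ g, HasG g m
  · exact (cm_bound hC (lv m + 1) m hm hg (by omega)).trans phi_le_one
  · rw [cm_vanish hC m hg]; simp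

theorem cm_cons_le_one (hC : IsNormalizedWitten C) {a : ℕ} {s : Multiset ℕ} (hs : Red s) : |cm C (a ::ₘ s)| ≤ 1 := by
  by_cases hg : ∃ g, HasG g (a ::ₘ s)
  · obtain ⟨g, hg⟩ := hg
    exact lead_bound hC (cm_bound hC (lv (a ::ₘ s) + 1)) hs hg (by omega)
  · rw [cm_vanish hC _ hg]; simp

end Part5

section Part6

variable {C : List ℕ → ℚ}

/-- `d` is a minimal entry of `d ::ₘ r` -/
def IsMin (d : ℕ) (r : Multiset ℕ) : Prop := ∀ v ∈ r, d ≤ v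

lemma exists_min {m : Multiset ℕ} (h : m ≠ 0) : ∃ d r, m = d ::ₘ r ∧ IsMin d r := by
  obtain ⟨d, hd, hmin⟩ : ∃ d ∈ m, ∀ v ∈ m, d ≤ v := by
    have hne : (m.toFinset).Nonempty := by simpa [Multiset.toFinset_nonempty] using h
    refine ⟨m.toFinset.min' hne, ?_, ?_⟩
    · simpa using Finset.min'_mem m.toFinset hne
    · intro v hv; exact Finset.min'_le _ _ (by simpa using hv)
  obtain ⟨r, rfl⟩ := Multiset.exists_cons_of_mem hd
  exact ⟨d, r, rfl, fun v hv => hmin v (Multiset.mem_cons_of_mem hv)⟩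

lemma qq_nonneg {d g : ℕ} {r : Multiset ℕ} (h : Red (d ::ₘ r)) (hg : HasG g (d ::ₘ r)) : 0 ≤ qq d r := by
  have hd := (red_cons.1 h).1
  have h3 := three_lv hg
  rw [Multiset.sum_cons, Multiset.card_cons] at h3
  have : 1 ≤ lv (d ::ₘ r) := by omega
  have : (1 : ℝ) ≤ lv (d ::ₘ r) := by exact_mod_cast this
  have : (2 : ℝ) ≤ d := by exact_mod_cast hd
  unfold qq
  apply div_nonneg <;> linarith

lemma qq_le {d g : ℕ} {r : Multiset ℕ} (h : Red (d ::ₘ r)) (hg : HasG g (d ::ₘ r)) (hm : IsMin d r) :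
    qq d r ≤ 1 / (Multiset.card r + 1 : ℝ) := by
  have hd := (red_cons.1 h).1
  have h3 := three_lv hg
  have hs : Multiset.card r * d ≤ r.sum := by simpa using Multiset.card_nsmul_le_sum hm
  rw [Multiset.sum_cons, Multiset.card_cons] at h3
  have h2 : 2 ≤ lv (d ::ₘ r) := by
    rcases Nat.lt_or_ge (Multiset.card r) 1 with h0 | h0
    · have : r = 0 := Multiset.card_eq_zero.1 (by omega)
      subst this
      simp [HasG] at hg
      have hs0 : (0 : Multiset ℕ).sum = 0 := rfl
      have hc0 : Multiset.card (0 : Multiset ℕ) = 0 := rfl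
      omega
    · have := (red_cons.1 h).2.two_mul_card_le
      omega
  have h2' : (2 : ℝ) ≤ lv (d ::ₘ r) := by exact_mod_cast h2
  have h3' : 3 * (lv (d ::ₘ r) : ℝ) = 2 * (d + r.sum) + (Multiset.card r + 1) := by exact_mod_cast h3
  have hs' : (Multiset.card r : ℝ) * d ≤ r.sum := by exact_mod_cast hs
  unfold qq
  rw [div_le_div_iff₀ (by linarith) (by positivity)]
  have : (0 : ℝ) ≤ Multiset.card r := by positivity
  nlinarith

/-- cumulative weights -/
def ee (n : ℕ) : ℝ := if n ≤ 1 then 0 else if n = 2 then 19/10 else 275/100 + 6/10 * ((n : ℝ) - 3)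

lemma ee_one : ee 1 = 0 := by simp [ee]
lemma ee_zero : ee 0 = 0 := by simp [ee]
lemma ee_two : ee 2 = 19/10 := by simp [ee]
lemma ee_three : ee 3 = 275/100 := by simp [ee]
lemma ee_big {n : ℕ} (h : 3 ≤ n) : ee n = 275/100 + 6/10 * ((n : ℝ) - 3) := by
  unfold ee; rw [if_neg (by omega), if_neg (by omega)]
lemma ee_nonneg (n : ℕ) : 0 ≤ ee n := by
  rcases Nat.lt_or_ge n 3 with h | h
  · interval_cases n
    · rw [ee_zero]
    · rw [ee_one]
    · rw [ee_two]; norm_num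
  · rw [ee_big h]; have : (3 : ℝ) ≤ n := by exact_mod_cast h
    linarith
lemma ee_ge {n : ℕ} (h : 2 ≤ n) : 19/10 ≤ ee n := by
  rcases Nat.lt_or_ge n 3 with h' | h'
  · have : n = 2 := by omega
    rw [this, ee_two]
  · rw [ee_big h']; have : (3 : ℝ) ≤ n := by exact_mod_cast h'
    linarith
lemma ee_le (n : ℕ) : ee n ≤ n := by
  rcases Nat.lt_or_ge n 3 with h | h
  · interval_cases n
    · rw [ee_zero]; simp
    · rw [ee_one]; norm_num
    · rw [ee_two]; norm_num
  · rw [ee_big h]; have : (3 : ℝ) ≤ n := by exact_mod_cast h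
    linarith
lemma ee_mono {n k : ℕ} (h : n ≤ k) : ee n ≤ ee k := by
  rcases Nat.lt_or_ge k 3 with h' | h'
  · rcases Nat.lt_or_ge n 2 with h2 | h2
    · interval_cases n
      · rw [ee_zero]; exact ee_nonneg _
      · rw [ee_one]; exact ee_nonneg _
    · have : n = k := by omega
      rw [this]
  · rw [ee_big h']
    have hk : (3 : ℝ) ≤ k := by exact_mod_cast h'
    rcases Nat.lt_or_ge n 3 with h2 | h2
    · interval_cases n
      · rw [ee_zero]; linarith
      · rw [ee_one]; linarith
      · rw [ee_two]; linarith
    · rw [ee_big h2]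
      have : (n : ℝ) ≤ k := by exact_mod_cast h
      linarith

/-- key combinatorial inequality for the weights -/
lemma ee_key {n : ℕ} (hn : 2 ≤ n) {q : ℝ} (hq0 : 0 ≤ q) (hq : q ≤ 1 / n) :
    (1 - q) * ee (n - 1) + q * (1 + 1005/1000 * ee (n + 1)) + 15/1000 ≤ ee n := by
  have hn' : (2 : ℝ) ≤ n := by exact_mod_cast hn
  have hqn : q * n ≤ 1 := by rw [le_div_iff₀ (by linarith)] at hq; exact hq
  have e1 := ee_le (n + 1)
  push_cast at e1
  have hq2 : q ≤ 1 / 2 := by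
    refine hq.trans ?_
    rw [div_le_div_iff₀ (by linarith) (by norm_num)]; linarith
  have e2 : q * ee (n + 1) ≤ 3 / 2 := by
    calc q * ee (n+1) ≤ q * (n + 1) := mul_le_mul_of_nonneg_left e1 hq0
      _ = q * n + q := by ring
      _ ≤ _ := by linarith
  have main : q * (1 + ee (n + 1) - ee (n - 1)) + 225/10000 ≤ ee n - ee (n - 1) := by
    rcases Nat.lt_or_ge n 4 with h | h
    · interval_cases n
      · norm_num [ee_one, ee_two, ee_three]; linarith
      · have := ee_big (show 3 ≤ 4 by norm_num)
        norm_num [ee_two, ee_three, this]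
        norm_num at hqn
        linarith
    · rw [ee_big (by omega), ee_big (by omega), ee_big (by omega), Nat.cast_sub (by omega)]
      push_cast
      have : (4 : ℝ) ≤ n := by exact_mod_cast h
      nlinarith
  nlinarith

lemma sum_min_bound (N : ℕ) : ∑ a ∈ Finset.range (N + 1), ((min a (N - a) : ℕ) : ℝ) ≤ (N : ℝ) ^ 2 / 4 := by
  induction N using Nat.twoStepInduction with
  | zero => simp
  | one => simp [Finset.sum_range_succ]
  | more N ih _ =>
    rw [Finset.sum_range_succ, Finset.sum_range_succ']
    have : ∀ a ∈ Finset.range (N + 1), ((min (a + 1) (N + 2 - (a + 1)) : ℕ) : ℝ) = ((min a (N - a) : ℕ) : ℝ) + 1 := by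
      intro a ha
      rw [Finset.mem_range] at ha
      have : min (a + 1) (N + 2 - (a + 1)) = min a (N - a) + 1 := by omega
      rw [this]; push_cast; ring
    rw [Finset.sum_congr rfl this, Finset.sum_add_distrib]
    simp only [Finset.sum_const, Finset.card_range, nsmul_eq_mul, mul_one]
    push_cast at ih
    simp
    nlinarith

def sg (D : Multiset ℕ → ℝ) (g : ℕ) : ℝ := D {3 * g - 2}

lemma card_one_genus {g : ℕ} {m : Multiset ℕ} (hg : HasG g m) (h : Multiset.card m = 1) : m = {3 * g - 2} := by
  obtain ⟨a, rfl⟩ := Multiset.card_eq_one.1 h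
  simp [HasG] at hg
  congr 1; omega

lemma small_arith {M B W n G X e s : ℝ} (hM : 0 ≤ M) (hB1 : 0 ≤ B) (hW0 : 0 ≤ W) (hn1 : 1 ≤ n) (hG : 500 ≤ G)
    (hlX : X + 2 = 2 * G + (n + 1)) (he : e ≤ n + 2) (he0 : 0 ≤ e) (hsg : s ≤ M * G ^ 2 * W) :
    6 / (5 * ((X - 1) * (X - 3))) * (s + (B * W + B * e * (1005/1000 * W))) ≤ (12/10 * M + 6/1000 * B) * W := by
  have hden : 0 < 5 * ((X - 1) * (X - 3)) := by
    apply mul_pos (by norm_num); apply mul_pos <;> linarith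
  rw [div_mul_eq_mul_div, div_le_iff₀ hden]
  have hX : X = 2 * G + n - 1 := by linarith
  subst hX
  have a1 : G ^ 2 ≤ ((2 * G + n - 1 - 1) * (2 * G + n - 1 - 3)) := by nlinarith
  have a2 : B * W + B * e * (1005/1000 * W) ≤ B * W * (1 + 1005/1000 * (n + 2)) := by
    have : B * W * e ≤ B * W * (n + 2) := mul_le_mul_of_nonneg_left he (by positivity)
    nlinarith
  have a3 : 6 * (1 + 1005/1000 * (n + 2)) ≤ 6/1000 * (5 * ((2 * G + n - 1 - 1) * (2 * G + n - 1 - 3))) := by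
    nlinarith
  have a4 := mul_le_mul_of_nonneg_left a3 (mul_nonneg hB1 hW0)
  have a5 := mul_le_mul_of_nonneg_left a1 (mul_nonneg hM hW0)
  have a6 : 0 ≤ M * W * G ^ 2 := by positivity
  nlinarith

lemma comb_arith {x K W t s q e1 e2 e3 B M p : ℝ} (tri : x ≤ p + t) (hp : p ≤ K * W) 
    (ht : t ≤ (1 - q) * (B * e1 * W) + q * (B * W + B * e3 * (1005/1000 * W)) + s)
    (key : B * W * ((1 - q) * e1 + q * (1 + 1005/1000 * e3) + 15/1000) ≤ B * W * e2)
    (KB : (K + 12/10 * M) * W ≤ 5/1000 * B * W) (small : s ≤ (12/10 * M + 6/1000 * B) * W) (h : 0 ≤ B * W := by positivity) :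
    x ≤ B * e2 * W := by
  nlinarith

section stab
variable {D : Multiset ℕ → ℝ} {w : ℕ → ℝ} {M K B : ℝ} {g₀ : ℕ}

/-- the bound we propagate -/
def Good (D : Multiset ℕ → ℝ) (w : ℕ → ℝ) (B : ℝ) (g : ℕ) : Prop :=
  |sg D g - sg D (g - 1)| ≤ B * w g ∧
    ∀ m, Red m → HasG g m → |D m - sg D g| ≤ B * ee (Multiset.card m) * w g

lemma good_multi (hM : 0 ≤ M) (hK : 0 ≤ K) (hB : 200 * (K + 2 * M) ≤ B) (hB1 : 0 ≤ B)
    (hw : ∀ g, 0 ≤ w g)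
    (h1 : ∀ g m, 1 ≤ g → Red m → HasG g m → |D m| ≤ M * (g : ℝ) ^ 2 * w g)
    {g : ℕ} (hg400 : 500 ≤ g) (hw1 : w (g - 1) ≤ 1005/1000 * w g)
    (h2 : ∀ d r, Red (d ::ₘ r) → HasG g (d ::ₘ r) → IsMin d r → |D (d ::ₘ r) - T D d r| ≤ K * w g)
    (hprev : Good D w B (g - 1)) (hΔ : |sg D g - sg D (g - 1)| ≤ B * w g) :
    ∀ n m, Multiset.card m = n → Red m → HasG g m → |D m - sg D g| ≤ B * ee (Multiset.card m) * w g := by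
  intro n
  induction n with
  | zero =>
    intro m hc _ hgm
    have := Multiset.card_eq_zero.1 hc
    subst this
    simp [HasG] at hgm; omega
  | succ n ih =>
    intro m hc hm hgm
    rcases Nat.eq_zero_or_pos n with hn0 | hn0
    · subst hn0
      rw [card_one_genus hgm hc]
      simp [sg, ee_one]
    have hm0 : m ≠ 0 := by rintro rfl; simp at hc
    obtain ⟨d, r, rfl, hmin⟩ := exists_min hm0
    rw [Multiset.card_cons] at hc
    have hr : Multiset.card r = n := by omega
    have hres := h2 d r hm hgm hmin
    obtain ⟨hd2, hrr⟩ := red_cons.1 hm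
    obtain ⟨g', rfl⟩ : ∃ g', g = g' + 1 := ⟨g - 1, by omega⟩
    rw [Nat.add_sub_cancel] at *
    set W := w (g' + 1) with hW
    have hW0 : 0 ≤ W := hw _
    have hl := lv_lower hgm
    rw [Multiset.card_cons, hr] at hl
    have hX5 : 5 ≤ lv (d ::ₘ r) := by omega
    set X := lv (d ::ₘ r) with hX
    have hG : (500 : ℝ) ≤ ((g' + 1 : ℕ) : ℝ) := by exact_mod_cast hg400
    set G : ℝ := ((g' + 1 : ℕ) : ℝ) with hGdef
    have hlX : (X : ℝ) + 2 = 2 * G + (n + 1) := by rw [hGdef]; exact_mod_cast hl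
    have hsg := h1 (g' + 1) {3 * (g' + 1) - 2} (by omega) (by intro v hv; rw [Multiset.mem_singleton] at hv; omega)
      (by simp [HasG]; omega)
    change |sg D (g' + 1)| ≤ M * G ^ 2 * W at hsg
    have t := T_bound D g' d r (sg D (g' + 1)) (B * ee n * W) (B * W + B * ee (n + 2) * (1005/1000 * W)) hm hgm hX5
      (by have := ee_nonneg (n + 2); positivity) ?_ ?_
    · rw [← hX] at t
      have hq0 := qq_nonneg hm hgm
      have hq := qq_le hm hgm hmin
      rw [hr] at hq
      have key := ee_key (show 2 ≤ n + 1 by omega) hq0 (by push_cast; exact hq)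
      rw [Nat.add_sub_cancel] at key
      rw [Multiset.card_cons, hr]
      have hn1 : (1 : ℝ) ≤ n := by exact_mod_cast hn0
      have hden : 0 < 5 * (((X : ℝ) - 1) * (X - 3)) := by
        apply mul_pos (by norm_num); apply mul_pos <;> linarith
      have he := ee_le (n + 2)
      push_cast at he
      have small := small_arith (n := (n : ℝ)) hM hB1 hW0 hn1 hG hlX he (ee_nonneg _) hsg
      have tri : |D (d ::ₘ r) - sg D (g' + 1)| ≤ |D (d ::ₘ r) - T D d r| + |T D d r - sg D (g' + 1)| := abs_sub_le _ _ _
      have keyBW := mul_le_mul_of_nonneg_left key (show 0 ≤ B * W by positivity)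
      have KB : (K + 12/10 * M) * W ≤ 5/1000 * B * W := by
        apply mul_le_mul_of_nonneg_right _ hW0; linarith
      exact comb_arith tri hres t keyBW KB small
    · intro v hv
      have e2 := card_erase' hv
      have e1 := sum_erase' hv
      have hv2 := hrr v hv
      have := ih ((d + v - 1) ::ₘ r.erase v) (by rw [Multiset.card_cons]; omega) (red_cons.2 ⟨by omega, hrr.erase v⟩)
        (by simp [HasG] at hgm ⊢; omega)
      rwa [Multiset.card_cons, show Multiset.card (r.erase v) + 1 = n by omega] at this
    · intro m' hm' hg' hc'
      have p := hprev.2 m' hm' hg'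
      have hee : ee (Multiset.card m') ≤ ee (n + 2) := ee_mono (by omega)
      have p2 : |D m' - sg D g'| ≤ B * ee (n + 2) * (1005/1000 * W) := by
        refine p.trans ?_
        have := ee_nonneg (Multiset.card m')
        have := ee_nonneg (n + 2)
        have := hw g'
        gcongr
      have : |D m' - sg D (g' + 1)| ≤ |D m' - sg D g'| + |sg D g' - sg D (g' + 1)| := abs_sub_le _ _ _
      rw [abs_sub_comm (sg D g')] at this
      linarith

lemma pair_bound (hB1 : 0 ≤ B)
    {γ : ℕ} (hγ : 400 ≤ γ) {W : ℝ} (hW : 0 ≤ W) (hw1 : w γ ≤ 1005/1000 * W) (hw2 : w (γ - 1) ≤ 1005/1000 * W)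
    (h2 : ∀ d r, Red (d ::ₘ r) → HasG γ (d ::ₘ r) → IsMin d r → |D (d ::ₘ r) - T D d r| ≤ K * w γ)
    (hprev : Good D w B (γ - 1)) (hcur : Good D w B γ) {a b : ℕ} (ha : 2 ≤ a) (hab : a ≤ b) (hs : a + b + 1 = 3 * γ) :
    |D {a, b} - sg D γ| ≤ 2 * ((a : ℝ) - 1) / (6 * γ - 3) * (B * W * (38/10)) +
      6 / (5 * ((2 * γ - 1) * (2 * (γ : ℝ) - 3))) * (|sg D γ| + B * W * (38/10)) + K * w γ := by
  have hm : Red (a ::ₘ {b}) := by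
    intro v hv; simp at hv; omega
  have hgm : HasG γ (a ::ₘ {b}) := by simp [HasG]; omega
  have hmin : IsMin a {b} := by intro v hv; simp at hv; omega
  have hres := h2 a {b} hm hgm hmin
  have hl := lv_lower hgm
  simp only [Multiset.card_cons, Multiset.card_singleton] at hl
  have hX : lv (a ::ₘ {b}) = 2 * γ := by omega
  obtain ⟨γ', rfl⟩ : ∃ k, γ = k + 1 := ⟨γ - 1, by omega⟩
  rw [Nat.add_sub_cancel] at *
  have t := T_bound D γ' a {b} (sg D (γ' + 1)) 0 (B * W * (38/10)) hm hgm (by omega) (by positivity) ?_ ?_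
  · unfold qq at t
    rw [hX] at t
    push_cast at t ⊢
    have tri : |D (a ::ₘ {b}) - sg D (γ' + 1)| ≤ |D (a ::ₘ {b}) - T D a {b}| + |T D a {b} - sg D (γ' + 1)| := abs_sub_le _ _ _
    have e : 3 * (2 * ((γ' : ℝ) + 1) - 1) = 6 * ((γ' : ℝ) + 1) - 3 := by ring
    rw [e] at t
    rw [show ({a, b} : Multiset ℕ) = a ::ₘ {b} from rfl]
    linarith
  · intro v hv
    rw [Multiset.mem_singleton] at hv
    subst hv
    rw [Multiset.erase_singleton, show a + v - 1 = 3 * (γ' + 1) - 2 by omega]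
    simp [sg]
  · intro m' hm' hg' hc'
    rw [Multiset.card_singleton] at hc'
    have p := hprev.2 m' hm' hg'
    have hee : ee (Multiset.card m') ≤ 275/100 := by rw [← ee_three]; exact ee_mono (by omega)
    have p2 : |D m' - sg D γ'| ≤ B * (275/100) * (1005/1000 * W) := by
      refine p.trans ?_
      have := ee_nonneg (Multiset.card m')
      have b1 : B * ee (Multiset.card m') ≤ B * (275/100) := mul_le_mul_of_nonneg_left hee hB1
      calc B * ee (Multiset.card m') * w γ' ≤ B * ee (Multiset.card m') * (1005/1000 * W) := 
            mul_le_mul_of_nonneg_left hw2 (by positivity)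
        _ ≤ _ := mul_le_mul_of_nonneg_right b1 (by positivity)
    have p3 : |sg D (γ' + 1) - sg D γ'| ≤ B * (1005/1000 * W) :=
      hcur.1.trans (mul_le_mul_of_nonneg_left hw1 hB1)
    have : |D m' - sg D (γ' + 1)| ≤ |D m' - sg D γ'| + |sg D γ' - sg D (γ' + 1)| := abs_sub_le _ _ _
    rw [abs_sub_comm (sg D γ')] at this
    have : 0 ≤ B * W := by positivity
    have e3 : B * (275/100) * (1005/1000 * W) + B * (1005/1000 * W) = (376875 / 100000) * (B * W) := by ring
    clear hγ
    linarith

lemma single_arith {γ M K B W s S A : ℝ} (hγ : 400 ≤ γ) (hM : 0 ≤ M) (hK : 0 ≤ K) (hB : 200 * (K + 2 * M) ≤ B) (hW : 0 ≤ W)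
    (hs0 : 0 ≤ s) (hs : s ≤ M * γ ^ 2 * (1005/1000 * W))
    (hA : A ≤ 2 / (6 * γ - 3) * (B * W * (38/10)) * ((3 * γ - 3) ^ 2 / 4) + (3 * γ - 2) * S)
    (hS : S = 6 / (5 * ((2 * γ - 1) * (2 * γ - 3))) * (s + B * W * (38/10)) + K * (1005/1000 * W)) :
    1 / (3 * γ) * (2 * (2 / (3 * (2 * γ - 1)) * s) + A) + K * W ≤ B * W := by
  have hB0 : 0 ≤ B := by linarith
  have hBW : 0 ≤ B * W := by positivity
  have d1 : 0 < 2 * γ - 1 := by linarith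
  have d3 : 0 < 2 * γ - 3 := by linarith
  have i1 : 2 / (6 * γ - 3) * ((3 * γ - 3) ^ 2 / 4) ≤ 3 * γ * (1/4) := by
    rw [div_mul_eq_mul_div, div_le_iff₀ (by linarith)]; nlinarith
  have i1' := mul_le_mul_of_nonneg_left i1 (show 0 ≤ B * W * (38/10) by positivity)
  have j1 : γ ^ 2 ≤ (2 * γ - 1) * (2 * γ - 3) := by nlinarith
  have hMW : 0 ≤ M * W := by positivity
  have i2 : 6 / (5 * ((2 * γ - 1) * (2 * γ - 3))) * (s + B * W * (38/10)) ≤ 122/100 * (M * W) + 1/1000 * (B * W) := by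
    rw [div_mul_eq_mul_div, div_le_iff₀ (by positivity)]
    have k1 := mul_le_mul_of_nonneg_left j1 hMW
    have k2 : 24 ≤ 1/1000 * (5 * ((2 * γ - 1) * (2 * γ - 3))) := by nlinarith
    have k3 := mul_le_mul_of_nonneg_left k2 hBW
    nlinarith
  have hSle : S ≤ 122/100 * (M * W) + 1/1000 * (B * W) + K * (1005/1000 * W) := by rw [hS]; linarith
  have hKW : 0 ≤ K * W := by positivity
  have hT0 : 0 ≤ 122/100 * (M * W) + 1/1000 * (B * W) + K * (1005/1000 * W) := by nlinarith
  have i3 : (3 * γ - 2) * S ≤ 3 * γ * (122/100 * (M * W) + 1/1000 * (B * W) + K * (1005/1000 * W)) := by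
    calc (3 * γ - 2) * S ≤ (3 * γ - 2) * (122/100 * (M * W) + 1/1000 * (B * W) + K * (1005/1000 * W)) :=
          mul_le_mul_of_nonneg_left hSle (by linarith)
      _ ≤ _ := mul_le_mul_of_nonneg_right (by linarith) hT0
  have i4 : 2 * (2 / (3 * (2 * γ - 1)) * s) ≤ 3 * γ * (M * W) := by
    have : 2 / (3 * (2 * γ - 1)) * s ≤ γ * (M * W) := by
      rw [div_mul_eq_mul_div, div_le_iff₀ (by positivity)]
      have : 2 * s ≤ 2 * (1005/1000) * (M * W) * γ ^ 2 := by nlinarith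
      have : 0 ≤ (M * W) * (γ * (2 * γ - 1)) := by positivity
      nlinarith
    have : 0 ≤ γ * (M * W) := by positivity
    linarith
  rw [one_div, ← div_eq_inv_mul, ← le_sub_iff_add_le, div_le_iff₀ (by linarith)]
  have fin : 95/100 * (B * W) + 122/100 * (M * W) + 1/1000 * (B * W) + 1005/1000 * (K * W) + M * W ≤ B * W - K * W := by
    have := mul_le_mul_of_nonneg_right hB hW
    nlinarith
  have fin' := mul_le_mul_of_nonneg_left fin (show 0 ≤ 3 * γ by linarith)
  nlinarith

lemma good_single (hM : 0 ≤ M) (hK : 0 ≤ K) (hB : 200 * (K + 2 * M) ≤ B) 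
    (hw : ∀ g, 0 ≤ w g)
    (h1 : ∀ g m, 1 ≤ g → Red m → HasG g m → |D m| ≤ M * (g : ℝ) ^ 2 * w g)
    {γ : ℕ} (hγ : 400 ≤ γ) (hw1 : w γ ≤ 1005/1000 * w (γ + 1)) (hw2 : w (γ - 1) ≤ 1005/1000 * w (γ + 1))
    (h2 : ∀ d r, Red (d ::ₘ r) → HasG γ (d ::ₘ r) → IsMin d r → |D (d ::ₘ r) - T D d r| ≤ K * w γ)
    (h2' : ∀ d r, Red (d ::ₘ r) → HasG (γ + 1) (d ::ₘ r) → IsMin d r → |D (d ::ₘ r) - T D d r| ≤ K * w (γ + 1))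
    (hprev : Good D w B (γ - 1)) (hcur : Good D w B γ) : |sg D (γ + 1) - sg D γ| ≤ B * w (γ + 1) := by
  have hB1 : 0 ≤ B := by linarith
  set W := w (γ + 1) with hWd
  have hW : 0 ≤ W := hw _
  have hγ' : (400 : ℝ) ≤ γ := by exact_mod_cast hγ
  have hred : Red ((3 * γ + 1) ::ₘ 0) := by intro v hv; simp at hv; omega
  have hgm : HasG (γ + 1) ((3 * γ + 1) ::ₘ 0) := by simp [HasG]; omega
  have hres := h2' (3 * γ + 1) 0 hred hgm (by intro v hv; simp at hv)
  have hl := lv_lower hgm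
  rw [Multiset.card_cons, Multiset.card_zero] at hl
  have hX : lv ((3 * γ + 1) ::ₘ 0) = 2 * γ + 1 := by omega
  have hsb := h1 γ {3 * γ - 2} (by omega) (by intro v hv; rw [Multiset.mem_singleton] at hv; omega)
      (by simp [HasG]; omega)
  change |sg D γ| ≤ _ at hsb
  have hsb' : |sg D γ| ≤ M * (γ : ℝ) ^ 2 * (1005/1000 * W) := hsb.trans (mul_le_mul_of_nonneg_left hw1 (by positivity))
  set s := sg D γ with hs
  have hT : T D (3 * γ + 1) 0 = 1 / (3 * (γ : ℝ)) * (2 * H1 D {3 * γ - 1} + ∑ a ∈ Finset.range (3 * γ - 2), H0 D {a + 1, 3 * γ - 2 - a}) := by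
    unfold T Spl
    rw [hX, if_neg (by omega)]
    rw [show 3 * γ + 1 - 2 = 3 * γ - 1 by omega, Finset.sum_Ico_eq_sum_range]
    rw [show 3 * γ - 1 - 1 = 3 * γ - 2 by omega]
    have : ∀ a ∈ Finset.range (3 * γ - 2), H0 D ((1 + a) ::ₘ (3 * γ - 1 - (1 + a)) ::ₘ 0) = H0 D {a + 1, 3 * γ - 2 - a} := by
      intro a _
      rw [show 1 + a = a + 1 by omega, show 3 * γ - 1 - (a + 1) = 3 * γ - 2 - a by omega]; rfl
    rw [Finset.sum_congr rfl this]
    simp only [Multiset.map_zero, Multiset.sum_zero, mul_zero, zero_add]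
    congr 1
    push_cast
    field_simp
    ring
  set S := 6 / (5 * ((2 * γ - 1) * (2 * (γ : ℝ) - 3))) * (|s| + B * W * (38/10)) + K * (1005/1000 * W) with hS
  have hS0 : 0 ≤ S := by
    have : 0 ≤ 6 / (5 * ((2 * γ - 1) * (2 * (γ : ℝ) - 3))) := by
      apply div_nonneg (by norm_num); apply mul_nonneg (by norm_num); apply mul_nonneg <;> linarith
    have := abs_nonneg s
    positivity
  have hterm : ∀ a ∈ Finset.range (3 * γ - 2), |H0 D {a + 1, 3 * γ - 2 - a} - s| ≤
      2 / (6 * γ - 3) * (B * W * (38/10)) * ((min a (3 * γ - 3 - a) : ℕ) : ℝ) + S := by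
    intro a ha
    rw [Finset.mem_range] at ha
    have hnn : 0 ≤ 2 / (6 * (γ : ℝ) - 3) * (B * W * (38/10)) * ((min a (3 * γ - 3 - a) : ℕ) : ℝ) := by
      have : 0 ≤ 2 / (6 * (γ : ℝ) - 3) := div_nonneg (by norm_num) (by linarith)
      positivity
    rcases Nat.eq_zero_or_pos a with h0 | h0
    · subst h0
      have : H0 D {0 + 1, 3 * γ - 2 - 0} = s := by
        unfold H0
        rw [show ({0 + 1, 3 * γ - 2 - 0} : Multiset ℕ) = 1 ::ₘ (3 * γ - 2) ::ₘ 0 from rfl, big_cons, big_cons, if_neg (by norm_num), if_pos (by omega)]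
        rfl
      rw [this]; simpa using add_nonneg hnn hS0
    rcases Nat.lt_or_ge a (3 * γ - 3) with h3 | h3
    · have hR : H0 D {a + 1, 3 * γ - 2 - a} = D {a + 1, 3 * γ - 2 - a} := by
        unfold H0
        rw [big_of_red]
        intro v hv; simp at hv; omega
      rw [hR]
      have hKw : K * w γ ≤ K * (1005/1000 * W) := mul_le_mul_of_nonneg_left hw1 hK
      rcases Nat.le_total (a + 1) (3 * γ - 2 - a) with hab | hab
      · have := pair_bound hB1 hγ hW hw1 hw2 h2 hprev hcur (show 2 ≤ a + 1 by omega) hab (by omega)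
        rw [show min a (3 * γ - 3 - a) = a by omega]
        refine this.trans ?_
        rw [hS]; push_cast
        have : 2 * ((a : ℝ) + 1 - 1) / (6 * γ - 3) * (B * W * (38/10)) = 2 / (6 * γ - 3) * (B * W * (38/10)) * a := by ring
        rw [this]; linarith
      · have := pair_bound hB1 hγ hW hw1 hw2 h2 hprev hcur (show 2 ≤ 3 * γ - 2 - a by omega) hab (by omega)
        rw [show min a (3 * γ - 3 - a) = 3 * γ - 3 - a by omega, Multiset.pair_comm]
        refine this.trans ?_
        rw [hS]
        have e : ((3 * γ - 2 - a : ℕ) : ℝ) = ((3 * γ - 3 - a : ℕ) : ℝ) + 1 := by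
          exact_mod_cast (by omega : 3 * γ - 2 - a = 3 * γ - 3 - a + 1)
        rw [e]
        have : 2 * (((3 * γ - 3 - a : ℕ) : ℝ) + 1 - 1) / (6 * γ - 3) * (B * W * (38/10)) = 2 / (6 * γ - 3) * (B * W * (38/10)) * ((3 * γ - 3 - a : ℕ) : ℝ) := by ring
        rw [this]; linarith
    · have ha' : a = 3 * γ - 3 := by omega
      have : H0 D {a + 1, 3 * γ - 2 - a} = s := by
        unfold H0
        rw [show ({a + 1, 3 * γ - 2 - a} : Multiset ℕ) = (a + 1) ::ₘ (3 * γ - 2 - a) ::ₘ 0 from rfl, big_cons, big_cons, if_pos (by omega), if_neg (by omega)]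
        rw [show a + 1 = 3 * γ - 2 by omega]; rfl
      rw [this]; simpa using add_nonneg hnn hS0
  have hH1 : H1 D {3 * γ - 1} - s = 2 / (3 * (2 * (γ : ℝ) - 1)) * s := by
    unfold H1
    rw [big_of_red (by intro v hv; simp at hv; omega)]
    have hl2 := lv_lower (show HasG γ (0 ::ₘ {3 * γ - 1}) by simp [HasG]; omega)
    simp only [Multiset.card_cons, Multiset.card_singleton] at hl2
    unfold str
    rw [show lv (0 ::ₘ {3 * γ - 1}) = 2 * γ by omega]
    simp only [Multiset.map_singleton, Multiset.sum_singleton, Multiset.erase_singleton]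
    rw [if_pos (by omega)]
    have : H0 D ((3 * γ - 1 - 1) ::ₘ 0) = s := by
      unfold H0
      rw [big_of_red (by intro v hv; simp at hv; omega), show 3 * γ - 1 - 1 = 3 * γ - 2 by omega]; rfl
    rw [this, Nat.cast_sub (by omega)]
    push_cast
    have : (2 * (γ : ℝ) - 1) ≠ 0 := by linarith
    field_simp
    ring
  have hsum : |∑ a ∈ Finset.range (3 * γ - 2), (H0 D {a + 1, 3 * γ - 2 - a} - s)| ≤
      2 / (6 * γ - 3) * (B * W * (38/10)) * ((3 * γ - 3) ^ 2 / 4) + (3 * γ - 2) * S := by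
    refine (Finset.abs_sum_le_sum_abs _ _).trans ((Finset.sum_le_sum hterm).trans ?_)
    rw [Finset.sum_add_distrib, ← Finset.mul_sum, Finset.sum_const, Finset.card_range, nsmul_eq_mul]
    have sm := sum_min_bound (3 * γ - 3)
    rw [show 3 * γ - 3 + 1 = 3 * γ - 2 by omega, Nat.cast_sub (by omega)] at sm
    rw [Nat.cast_sub (by omega : 2 ≤ 3 * γ)]
    push_cast at sm ⊢
    have : 0 ≤ 2 / (6 * (γ : ℝ) - 3) * (B * W * (38/10)) := by
      have : 0 ≤ 2 / (6 * (γ : ℝ) - 3) := div_nonneg (by norm_num) (by linarith)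
      positivity
    have := mul_le_mul_of_nonneg_left sm this
    linarith
  have hTs : T D (3 * γ + 1) 0 - s = 1 / (3 * (γ : ℝ)) * (2 * (H1 D {3 * γ - 1} - s) + ∑ a ∈ Finset.range (3 * γ - 2), (H0 D {a + 1, 3 * γ - 2 - a} - s)) := by
    rw [hT, Finset.sum_sub_distrib, Finset.sum_const, Finset.card_range, nsmul_eq_mul, Nat.cast_sub (by omega : 2 ≤ 3 * γ)]
    push_cast
    field_simp
    ring
  have hTb : |T D (3 * γ + 1) 0 - s| ≤ 1 / (3 * (γ : ℝ)) * (2 * (2 / (3 * (2 * (γ : ℝ) - 1)) * |s|) + |∑ a ∈ Finset.range (3 * γ - 2), (H0 D {a + 1, 3 * γ - 2 - a} - s)|) := by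
    rw [hTs, abs_mul, abs_of_nonneg (show 0 ≤ 1 / (3 * (γ : ℝ)) by positivity)]
    apply mul_le_mul_of_nonneg_left _ (by positivity)
    refine (abs_add_le _ _).trans ?_
    rw [hH1, abs_mul, abs_mul, abs_of_nonneg (show 0 ≤ 2 / (3 * (2 * (γ : ℝ) - 1)) from div_nonneg (by norm_num) (by linarith))]
    simp
  have fin := single_arith hγ' hM hK hB hW (abs_nonneg s) hsb' hsum hS
  have e : sg D (γ + 1) = D ((3 * γ + 1) ::ₘ 0) := by
    unfold sg; rw [show 3 * (γ + 1) - 2 = 3 * γ + 1 by omega]; rfl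
  have tri : |D ((3 * γ + 1) ::ₘ 0) - s| ≤ |D ((3 * γ + 1) ::ₘ 0) - T D (3 * γ + 1) 0| + |T D (3 * γ + 1) 0 - s| := abs_sub_le _ _ _
  rw [e]
  linarith

end stab

end Part6

section Part7

variable {C : List ℕ → ℚ}

lemma w_ratio {j g : ℕ} (h : 500 * (j + 2) + 2 ≤ g) (k : ℕ) (hk : k ≤ 2) :
    1 / ((g - k : ℕ) : ℝ) ^ (j + 2) ≤ 1005/1000 * (1 / (g : ℝ) ^ (j + 2)) := by
  have hg : (500 : ℝ) * (j + 2) + 2 ≤ g := by exact_mod_cast h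
  have hj : (0 : ℝ) ≤ j := by positivity
  have hg0 : (0 : ℝ) < g := by linarith
  have hk' : (k : ℝ) ≤ 2 := by exact_mod_cast hk
  rw [Nat.cast_sub (by omega)]
  have hp : (0 : ℝ) < g - k := by linarith
  have b := one_add_mul_le_pow (a := -((k : ℝ) / g)) (by
    have : (k : ℝ) / g ≤ 1 := by rw [div_le_one hg0]; linarith
    linarith) (j + 2)
  have e : (1 + -((k : ℝ) / g)) = (g - k) / g := by field_simp; ring
  rw [e, div_pow, le_div_iff₀ (by positivity)] at b
  rw [mul_one_div, div_le_div_iff₀ (by positivity) (by positivity), one_mul]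
  have b2 : (k : ℝ) / g * (j + 2) ≤ 4/1000 := by
    rw [div_mul_eq_mul_div, div_le_iff₀ hg0]
    have : (k : ℝ) * (j + 2) ≤ 2 * (j + 2) := mul_le_mul_of_nonneg_right hk' (by linarith)
    linarith
  push_cast at b
  have : 996/1000 * (g : ℝ) ^ (j + 2) ≤ (g - k : ℝ) ^ (j + 2) := by
    refine le_trans ?_ b
    apply mul_le_mul_of_nonneg_right _ (by positivity)
    nlinarith
  have : 0 < (g : ℝ) ^ (j + 2) := by positivity
  linarith

lemma single_red {g : ℕ} (h : 2 ≤ g) : Red {3 * g - 2} ∧ HasG g {3 * g - 2} := by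
  constructor
  · intro v hv; rw [Multiset.mem_singleton] at hv; omega
  · simp [HasG]; omega

lemma good_all {D : Multiset ℕ → ℝ} {M K : ℝ} {g₁ j : ℕ} (hM : 0 ≤ M) (hK : 0 ≤ K)
    (h1 : ∀ g m, 1 ≤ g → Red m → HasG g m → |D m| ≤ M / (g : ℝ) ^ j)
    (h2 : ∀ g d r, g₁ ≤ g → Red (d ::ₘ r) → HasG g (d ::ₘ r) → IsMin d r → |D (d ::ₘ r) - T D d r| ≤ K / (g : ℝ) ^ (j + 2)) :
    ∃ B, 0 ≤ B ∧ ∀ g, 3 ≤ g → Good D (fun g => 1 / (g : ℝ) ^ (j + 2)) B g := by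
  set g₀ := g₁ + 500 * (j + 2) + 10 with hg0
  set B := 200 * (K + 2 * M) + 2 * M * (g₀ : ℝ) ^ (j + 2) with hB
  have hB0 : 0 ≤ B := by positivity
  refine ⟨B, hB0, ?_⟩
  have hBB : 200 * (K + 2 * M) ≤ B := by
    have : 0 ≤ 2 * M * (g₀ : ℝ) ^ (j + 2) := by positivity
    linarith
  have hw : ∀ g : ℕ, 0 ≤ (fun g : ℕ => 1 / (g : ℝ) ^ (j + 2)) g := fun g => by positivity
  have h1' : ∀ g m, 1 ≤ g → Red m → HasG g m → |D m| ≤ M * (g : ℝ) ^ 2 * (fun g : ℕ => 1 / (g : ℝ) ^ (j + 2)) g := by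
    intro g m hg hm hgm
    refine (h1 g m hg hm hgm).trans (le_of_eq ?_)
    have : (g : ℝ) ≠ 0 := by positivity
    simp only []
    field_simp
    ring
  have h2' : ∀ g, g₁ ≤ g → ∀ d r, Red (d ::ₘ r) → HasG g (d ::ₘ r) → IsMin d r → |D (d ::ₘ r) - T D d r| ≤ K * (fun g : ℕ => 1 / (g : ℝ) ^ (j + 2)) g := by
    intro g hg d r a b c
    have := h2 g d r hg a b c
    simpa [div_eq_mul_inv] using this
  have hDM : ∀ g m, 1 ≤ g → Red m → HasG g m → |D m| ≤ M := by
    intro g m hg hm hgm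
    refine (h1 g m hg hm hgm).trans (div_le_self hM ?_)
    exact one_le_pow₀ (by exact_mod_cast hg)
  intro g
  induction g using Nat.strong_induction_on with
  | _ g ih =>
  intro hg3
  rcases Nat.lt_or_ge g₀ g with hlt | hge
  · obtain ⟨γ, rfl⟩ : ∃ k, g = k + 1 := ⟨g - 1, by omega⟩
    have c := ih γ (by omega) (by omega)
    have p := ih (γ - 1) (by omega) (by omega)
    have s := good_single hM hK hBB hw h1' (γ := γ) (by omega)
      (by have := w_ratio (j := j) (g := γ + 1) (by omega) 1 (by omega); rwa [Nat.add_sub_cancel] at this)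
      (by have := w_ratio (j := j) (g := γ + 1) (by omega) 2 (by omega); rwa [show γ + 1 - 2 = γ - 1 by omega] at this)
      (h2' γ (by omega)) (h2' (γ + 1) (by omega)) p c
    refine ⟨s, fun m hm hgm => ?_⟩
    exact good_multi hM hK hBB hB0 hw h1' (g := γ + 1) (by omega)
      (by have := w_ratio (j := j) (g := γ + 1) (by omega) 1 (by omega); exact this)
      (h2' (γ + 1) (by omega)) c s _ m rfl hm hgm
  · have hgg : (g : ℝ) ≤ g₀ := by exact_mod_cast hge
    have hgp : (0 : ℝ) < g := by exact_mod_cast (by omega : 0 < g)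
    have base : 2 * M ≤ B * (1 / (g : ℝ) ^ (j + 2)) := by
      rw [mul_one_div, le_div_iff₀ (by positivity)]
      have : 2 * M * (g : ℝ) ^ (j + 2) ≤ 2 * M * (g₀ : ℝ) ^ (j + 2) := by gcongr
      have : 0 ≤ 200 * (K + 2 * M) := by positivity
      linarith
    have sb : ∀ k, 2 ≤ k → |sg D k| ≤ M := fun k hk => hDM k _ (by omega) (single_red hk).1 (single_red hk).2
    constructor
    · refine (abs_sub _ _).trans ?_
      have := sb g (by omega)
      have := sb (g - 1) (by omega)
      simp only []
      linarith
    · intro m hm hgm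
      rcases Nat.lt_or_ge (Multiset.card m) 2 with hc | hc
      · rcases Nat.lt_or_ge (Multiset.card m) 1 with hc0 | hc1
        · have : m = 0 := Multiset.card_eq_zero.1 (by omega)
          subst this
          simp [HasG] at hgm; omega
        · have hc1 : Multiset.card m = 1 := by omega
          rw [hc1, ee_one, card_one_genus hgm hc1]; simp [sg]
      · have e := ee_ge hc
        refine (abs_sub _ _).trans ?_
        have := sb g (by omega)
        have := hDM g m (by omega) hm hgm
        have h0 : 0 ≤ B * (1 / (g : ℝ) ^ (j + 2)) := by positivity
        have : B * (1 / (g : ℝ) ^ (j + 2)) * 1 ≤ B * (1 / (g : ℝ) ^ (j + 2)) * ee (Multiset.card m) :=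
          mul_le_mul_of_nonneg_left (by linarith) h0
        simp only []
        linarith

lemma tele_bound (j k : ℕ) (hk : 1 ≤ k) :
    1 / ((k + 1 : ℕ) : ℝ) ^ (j + 2) ≤ 1 / (k : ℝ) ^ (j + 1) - 1 / ((k + 1 : ℕ) : ℝ) ^ (j + 1) := by
  have hk' : (1 : ℝ) ≤ k := by exact_mod_cast hk
  have hp : (0 : ℝ) < k := by linarith
  push_cast
  have h1 : 1 / (k : ℝ) ^ (j + 1) ≥ (1 + 1 / k) * (1 / ((k : ℝ) + 1) ^ (j + 1)) := by
    have e : (1 + 1 / (k : ℝ)) = (k + 1) / k := by field_simp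
    rw [e, mul_one_div, ge_iff_le, div_div, div_le_div_iff₀ (by positivity) (by positivity)]
    have : (k : ℝ) ^ j ≤ ((k : ℝ) + 1) ^ j := by gcongr; linarith
    have e1 : ((k : ℝ) + 1) * (k : ℝ) ^ (j + 1) = ((k : ℝ) * (k + 1)) * (k : ℝ) ^ j := by ring
    have e2 : 1 * ((k : ℝ) * ((k : ℝ) + 1) ^ (j + 1)) = ((k : ℝ) * (k + 1)) * ((k : ℝ) + 1) ^ j := by ring
    rw [e1, e2]; gcongr
  have h2 : 1 / ((k : ℝ) + 1) ^ (j + 2) ≤ 1 / k * (1 / ((k : ℝ) + 1) ^ (j + 1)) := by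
    have e3 : 1 / (k : ℝ) * (1 / ((k : ℝ) + 1) ^ (j + 1)) = 1 / ((k : ℝ) * ((k : ℝ) + 1) ^ (j + 1)) := by field_simp
    rw [e3]
    apply one_div_le_one_div_of_le (by positivity)
    rw [pow_succ ((k : ℝ) + 1) (j + 1)]
    nlinarith [pow_pos (show (0 : ℝ) < k + 1 by linarith) (j + 1)]
  linarith

theorem stab {D : Multiset ℕ → ℝ} {M K : ℝ} {g₁ j : ℕ}
    (h1 : ∀ g m, 1 ≤ g → Red m → HasG g m → |D m| ≤ M / (g : ℝ) ^ j)
    (h2 : ∀ g d r, g₁ ≤ g → Red (d ::ₘ r) → HasG g (d ::ₘ r) → IsMin d r → |D (d ::ₘ r) - T D d r| ≤ K / (g : ℝ) ^ (j + 2)) :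
    ∃ L K', ∀ g m, 1 ≤ g → Red m → HasG g m → |D m - L| ≤ K' / (g : ℝ) ^ (j + 1) := by
  have h1' : ∀ g m, 1 ≤ g → Red m → HasG g m → |D m| ≤ |M| / (g : ℝ) ^ j := fun g m a b c =>
    (h1 g m a b c).trans (by gcongr; exact le_abs_self _)
  have h2' : ∀ g d r, g₁ ≤ g → Red (d ::ₘ r) → HasG g (d ::ₘ r) → IsMin d r → |D (d ::ₘ r) - T D d r| ≤ |K| / (g : ℝ) ^ (j + 2) :=
    fun g d r a b c e => (h2 g d r a b c e).trans (by gcongr; exact le_abs_self _)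
  obtain ⟨B, hB, hgood⟩ := good_all (abs_nonneg M) (abs_nonneg K) h1' h2'
  let t : ℕ → ℝ := fun g => 1 / (g : ℝ) ^ (j + 1)
  have hstep : ∀ k, 2 ≤ k → |sg D (k + 1) - sg D k| ≤ B * (t k - t (k + 1)) := by
    intro k hk
    have := (hgood (k + 1) (by omega)).1
    rw [Nat.add_sub_cancel] at this
    exact this.trans (mul_le_mul_of_nonneg_left (tele_bound j k (by omega)) hB)
  have hchain : ∀ k i, 2 ≤ k → |sg D (k + i) - sg D k| ≤ B * (t k - t (k + i)) := by
    intro k i hk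
    induction i with
    | zero => simp
    | succ i ih =>
      have := hstep (k + i) (by omega)
      have tri := abs_sub_le (sg D (k + i + 1)) (sg D (k + i)) (sg D k)
      rw [← Nat.add_assoc]
      nlinarith
  have ht0 : ∀ k, 0 ≤ t k := fun k => by positivity
  have hb : ∀ k n, 2 ≤ k → k ≤ n → |sg D n - sg D k| ≤ B * t k := by
    intro k n hk hn
    obtain ⟨i, rfl⟩ := Nat.exists_eq_add_of_le hn
    refine (hchain k i hk).trans ?_
    have := mul_nonneg hB (ht0 (k + i))
    nlinarith
  have htt : Filter.Tendsto (fun k => 2 * (B * t k)) Filter.atTop (nhds 0) := by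
    have : Filter.Tendsto t Filter.atTop (nhds 0) := by
      have h := Filter.tendsto_pow_atTop (α := ℝ) (n := j + 1) (by omega)
      have h' := h.comp (tendsto_natCast_atTop_atTop (R := ℝ))
      have := h'.inv_tendsto_atTop
      refine this.congr (fun k => ?_)
      simp [t]
    simpa using (this.const_mul B).const_mul 2
  have hcau : CauchySeq (fun k => sg D (k + 2)) := by
    refine cauchySeq_of_le_tendsto_0 (fun k => 2 * (B * t (k + 2))) ?_ (htt.comp (Filter.tendsto_add_atTop_nat 2))
    intro n m N hn hm
    rw [Real.dist_eq]
    have a1 := hb (N + 2) (n + 2) (by omega) (by omega)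
    have a2 := hb (N + 2) (m + 2) (by omega) (by omega)
    have tri := abs_sub_le (sg D (n + 2)) (sg D (N + 2)) (sg D (m + 2))
    rw [abs_sub_comm (sg D (N + 2))] at tri
    linarith
  obtain ⟨L, hL⟩ := cauchySeq_tendsto_of_complete hcau
  have hL' : ∀ k, 2 ≤ k → |sg D k - L| ≤ B * t k := by
    intro k hk
    have : Filter.Tendsto (fun n => |sg D (n + 2) - sg D k|) Filter.atTop (nhds |L - sg D k|) :=
      (hL.sub_const _).abs
    have := le_of_tendsto this (b := B * t k) (by
      filter_upwards [Filter.eventually_ge_atTop k] with n hn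
      exact hb k (n + 2) hk (by omega))
    rwa [abs_sub_comm] at this
  refine ⟨L, 4 * B + (|M| + |L|) * 2 ^ (j + 1), ?_⟩
  intro g m hg hm hgm
  have hgp : (0 : ℝ) < g := by exact_mod_cast hg
  rcases Nat.lt_or_ge g 3 with h3 | h3
  · have hDm : |D m| ≤ |M| := (h1' g m hg hm hgm).trans (div_le_self (abs_nonneg _) (one_le_pow₀ (by exact_mod_cast hg)))
    refine (abs_sub _ _).trans ?_
    rw [le_div_iff₀ (by positivity)]
    have : (g : ℝ) ^ (j + 1) ≤ 2 ^ (j + 1) := by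
      gcongr; exact_mod_cast (by omega : g ≤ 2)
    have n1 := abs_nonneg L
    have n2 := abs_nonneg M
    calc (|D m| + |L|) * (g : ℝ) ^ (j + 1) ≤ (|M| + |L|) * 2 ^ (j + 1) := by gcongr
      _ ≤ _ := by linarith
  · have p := (hgood g h3).2 m hm hgm
    have hc : Multiset.card m ≤ 3 * g := by
      have := hm.two_mul_card_le
      unfold HasG at hgm; omega
    have hc' : ee (Multiset.card m) ≤ 3 * g := (ee_le _).trans (by exact_mod_cast hc)
    have p2 : |D m - sg D g| ≤ 3 * B * t g := by
      refine p.trans ?_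
      have : B * (3 * g) * (1 / (g : ℝ) ^ (j + 2)) = 3 * B * t g := by
        simp only [t]; field_simp; ring
      rw [← this]
      gcongr
    have p3 := hL' g (by omega)
    have tri := abs_sub_le (D m) (sg D g) L
    have : (4 * B + (|M| + |L|) * 2 ^ (j + 1)) / (g : ℝ) ^ (j + 1) = 4 * B * t g + (|M| + |L|) * 2 ^ (j + 1) * t g := by
      simp only [t]; ring
    rw [this]
    have : 0 ≤ (|M| + |L|) * 2 ^ (j + 1) * t g := by have := ht0 g; positivity
    linarith

end Part7

section Part8

/-- dense univariate polynomials over a coefficient type -/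
structure PL (α : Type) where
  l : List α

namespace PL
variable {α : Type}

def addL [Add α] : List α → List α → List α
  | [], b => b
  | a, [] => a
  | x :: a, y :: b => (x + y) :: addL a b

def mulL [Add α] [Mul α] [Zero α] : List α → List α → List α
  | [], _ => []
  | x :: a, b => addL (b.map (x * ·)) (0 :: mulL a b)

instance [Add α] : Add (PL α) := ⟨fun a b => ⟨addL a.l b.l⟩⟩
instance [Add α] [Mul α] [Zero α] : Mul (PL α) := ⟨fun a b => ⟨mulL a.l b.l⟩⟩
instance : Zero (PL α) := ⟨⟨[]⟩⟩

def evL (φ : α → ℝ) (t : ℝ) : List α → ℝ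
  | [] => 0
  | x :: a => φ x + t * evL φ t a

def ev (φ : α → ℝ) (t : ℝ) (p : PL α) : ℝ := evL φ t p.l
end PL

/-- evaluation is a homomorphism -/
structure Hom' {α : Type} [Add α] [Mul α] [Zero α] (φ : α → ℝ) : Prop where
  add : ∀ a b, φ (a + b) = φ a + φ b
  mul : ∀ a b, φ (a * b) = φ a * φ b
  zero : φ 0 = 0

lemma Hom'.evL_add {α : Type} [Add α] [Mul α] [Zero α] {φ : α → ℝ} (h : Hom' φ) (t : ℝ) (a b : List α) :
    PL.evL φ t (PL.addL a b) = PL.evL φ t a + PL.evL φ t b := by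
  induction a generalizing b with
  | nil => simp [PL.addL, PL.evL]
  | cons x a ih =>
    cases b with
    | nil => simp [PL.addL, PL.evL]
    | cons y b => simp [PL.addL, PL.evL, ih, h.add]; ring

lemma Hom'.evL_smul {α : Type} [Add α] [Mul α] [Zero α] {φ : α → ℝ} (h : Hom' φ) (t : ℝ) (x : α) (b : List α) :
    PL.evL φ t (b.map (x * ·)) = φ x * PL.evL φ t b := by
  induction b with
  | nil => simp [PL.evL]
  | cons y b ih => simp [PL.evL, ih, h.mul]; ring

lemma Hom'.evL_mul {α : Type} [Add α] [Mul α] [Zero α] {φ : α → ℝ} (h : Hom' φ) (t : ℝ) (a b : List α) :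
    PL.evL φ t (PL.mulL a b) = PL.evL φ t a * PL.evL φ t b := by
  induction a with
  | nil => simp [PL.mulL, PL.evL]
  | cons x a ih =>
    simp [PL.mulL, PL.evL, h.evL_add, h.evL_smul, ih, h.zero]; ring

lemma Hom'.pl {α : Type} [Add α] [Mul α] [Zero α] {φ : α → ℝ} (h : Hom' φ) (t : ℝ) : Hom' (PL.ev φ t) :=
  ⟨fun a b => h.evL_add t a.l b.l, fun a b => h.evL_mul t a.l b.l, rfl⟩

abbrev K0 := PL ℚ
abbrev K1 := PL K0
abbrev K2 := PL K1
abbrev K3 := PL K2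
abbrev K4 := PL K3
abbrev K5 := PL K4
abbrev K6 := PL K5
abbrev K7 := List K6

def e0 (P : ℕ → ℝ) : K0 → ℝ := PL.ev (fun q : ℚ => (q : ℝ)) (P 1)
def e1 (P : ℕ → ℝ) : K1 → ℝ := PL.ev (e0 P) (P 2)
def e2 (P : ℕ → ℝ) : K2 → ℝ := PL.ev (e1 P) (P 3)
def e3 (P : ℕ → ℝ) : K3 → ℝ := PL.ev (e2 P) (P 4)
def e4 (P : ℕ → ℝ) : K4 → ℝ := PL.ev (e3 P) (P 5)
def e5 (P : ℕ → ℝ) : K5 → ℝ := PL.ev (e4 P) (P 6)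
def e6 (P : ℕ → ℝ) : K6 → ℝ := PL.ev (e5 P) (P 7)
def e7 (h : ℝ) (P : ℕ → ℝ) : K7 → ℝ := PL.evL (e6 P) h

lemma hom0 (P : ℕ → ℝ) : Hom' (e0 P) := Hom'.pl ⟨by intro a b; push_cast; rfl, by intro a b; push_cast; rfl, by simp⟩ _
lemma hom6 (P : ℕ → ℝ) : Hom' (e6 P) := ((((((hom0 P).pl _).pl _).pl _).pl _).pl _).pl _

/-- a bounded function on the box -/
def Bdd' {α : Type} (φ : (ℕ → ℝ) → α → ℝ) : Prop :=
  ∀ a, ∃ B, 0 ≤ B ∧ ∀ P : ℕ → ℝ, (∀ i, |P i| ≤ 2) → |φ P a| ≤ B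

lemma bddL {α : Type} {φ : (ℕ → ℝ) → α → ℝ} (h : Bdd' φ) (t : (ℕ → ℝ) → ℝ) (ht : ∀ P : ℕ → ℝ, (∀ i, |P i| ≤ 2) → |t P| ≤ 2) :
    Bdd' (fun P (l : List α) => PL.evL (φ P) (t P) l) := by
  intro l
  induction l with
  | nil => exact ⟨0, le_rfl, fun P hP => by simp [PL.evL]⟩
  | cons x a ih =>
    obtain ⟨B, hB, h1⟩ := ih
    obtain ⟨B', hB', h2⟩ := h x
    refine ⟨B' + 2 * B, by positivity, fun P hP => ?_⟩
    simp only [PL.evL]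
    refine (abs_add_le _ _).trans ?_
    rw [abs_mul]
    have := h1 P hP
    have := h2 P hP
    have := ht P hP
    gcongr

lemma bddPL {α : Type} {φ : (ℕ → ℝ) → α → ℝ} (h : Bdd' φ) (i : ℕ) :
    Bdd' (fun P (l : PL α) => PL.ev (φ P) (P i) l) :=
  fun l => bddL h (fun P => P i) (fun P hP => hP i) l.l

lemma bdd6 : Bdd' e6 := by
  have h : Bdd' (fun (_ : ℕ → ℝ) (q : ℚ) => (q : ℝ)) := fun q => ⟨|(q : ℝ)|, abs_nonneg _, fun _ _ => le_rfl⟩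
  exact bddPL (bddPL (bddPL (bddPL (bddPL (bddPL (bddPL h 1) 2) 3) 4) 5) 6) 7

/-- box of validity -/
def Box (h : ℝ) (P : ℕ → ℝ) : Prop := 0 < h ∧ h ≤ 1 / 40 ∧ ∀ i, |P i| ≤ 2

lemma bdd7 (l : K7) : ∃ B, 0 ≤ B ∧ ∀ h P, Box h P → |e7 h P l| ≤ B := by
  induction l with
  | nil => exact ⟨0, le_rfl, fun h P hP => by simp [e7, PL.evL]⟩
  | cons x a ih =>
    obtain ⟨B, hB, h1⟩ := ih
    obtain ⟨B', hB', h2⟩ := bdd6 x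
    refine ⟨B' + 1 * B, by positivity, fun h P hP => ?_⟩
    simp only [e7, PL.evL]
    refine (abs_add_le _ _).trans ?_
    rw [abs_mul]
    have := h1 h P hP
    have := h2 P hP.2.2
    have : |h| ≤ 1 := by rw [abs_of_pos hP.1]; linarith [hP.2.1]
    simp only [e7] at *
    gcongr

lemma evL_take {α : Type} (φ : α → ℝ) (t : ℝ) (n : ℕ) (l : List α) :
    PL.evL φ t l = PL.evL φ t (l.take n) + t ^ n * PL.evL φ t (l.drop n) := by
  induction n generalizing l with
  | zero => simp [PL.evL]
  | succ n ih =>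
    cases l with
    | nil => simp [PL.evL]
    | cons x a => simp only [List.take_succ_cons, List.drop_succ_cons, PL.evL]; rw [ih a]; ring

/-- expressions -/
inductive Ex where
  | h : Ex
  | P : ℕ → Ex
  | c : ℚ → Ex
  | geo : ℕ → Ex
  | add : Ex → Ex → Ex
  | mul : Ex → Ex → Ex
  | hm : Ex → Ex

namespace Ex
instance : Add Ex := ⟨add⟩
instance : Mul Ex := ⟨mul⟩

def ev (t : ℝ) (P : ℕ → ℝ) : Ex → ℝ
  | h => t
  | .P i => P i
  | c q => q
  | geo k => 1 / (1 - k * t)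
  | add a b => ev t P a + ev t P b
  | mul a b => ev t P a * ev t P b
  | hm a => t * ev t P a

/-- all geometric indices at most 20, all variables in range -/
def ok : Ex → Bool
  | h => true
  | .P i => 1 ≤ i && i ≤ 7
  | c _ => true
  | geo k => k ≤ 20
  | add a b => ok a && ok b
  | mul a b => ok a && ok b
  | hm a => ok a

def k0 (q : ℚ) : K0 := ⟨[q]⟩
def k1 (q : K0) : K1 := ⟨[q]⟩
def k2 (q : K1) : K2 := ⟨[q]⟩
def k3 (q : K2) : K3 := ⟨[q]⟩
def k4 (q : K3) : K4 := ⟨[q]⟩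
def k5 (q : K4) : K5 := ⟨[q]⟩
def k6 (q : K5) : K6 := ⟨[q]⟩
def cst (q : ℚ) : K6 := k6 (k5 (k4 (k3 (k2 (k1 (k0 q))))))

def vr : ℕ → K6
  | 1 => k6 (k5 (k4 (k3 (k2 (k1 ⟨[0, 1]⟩)))))
  | 2 => k6 (k5 (k4 (k3 (k2 ⟨[0, k0 1]⟩))))
  | 3 => k6 (k5 (k4 (k3 ⟨[0, k1 (k0 1)]⟩)))
  | 4 => k6 (k5 (k4 ⟨[0, k2 (k1 (k0 1))]⟩))
  | 5 => k6 (k5 ⟨[0, k3 (k2 (k1 (k0 1)))]⟩)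
  | 6 => k6 ⟨[0, k4 (k3 (k2 (k1 (k0 1))))]⟩
  | _ => ⟨[0, k5 (k4 (k3 (k2 (k1 (k0 1)))))]⟩

def ser : ℕ → Ex → K7
  | _, h => [0, cst 1]
  | _, .P i => [vr i]
  | _, c q => if q = 0 then [] else [cst q]
  | n, geo k => [cst 1, cst k, cst (k ^ 2), cst (k ^ 3), cst (k ^ 4)].take n
  | n, add a b => PL.addL (ser n a) (ser n b)
  | n, mul a b => (PL.mulL (ser n a) (ser n b)).take n
  | 0, hm _ => []
  | n + 1, hm a => 0 :: ser n a

lemma e6_cst (P : ℕ → ℝ) (q : ℚ) : e6 P (cst q) = q := by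
  simp [cst, k6, k5, k4, k3, k2, k1, k0, e6, e5, e4, e3, e2, e1, e0, PL.ev, PL.evL]

lemma e6_vr (P : ℕ → ℝ) (i : ℕ) (h1 : 1 ≤ i) (h2 : i ≤ 7) : e6 P (vr i) = P i := by
  interval_cases i <;>
  simp [vr, k6, k5, k4, k3, k2, k1, k0, e6, e5, e4, e3, e2, e1, e0, PL.ev, PL.evL]

lemma bdd (e : Ex) (he : e.ok = true) : ∃ B, 0 ≤ B ∧ ∀ t P, Box t P → |e.ev t P| ≤ B := by
  induction e with
  | h => exact ⟨1, by norm_num, fun t P hP => by rw [ev, abs_of_pos hP.1]; linarith [hP.2.1]⟩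
  | P i => exact ⟨2, by norm_num, fun t P hP => hP.2.2 i⟩
  | c q => exact ⟨|(q : ℝ)|, abs_nonneg _, fun t P hP => le_rfl⟩
  | geo k =>
    refine ⟨2, by norm_num, fun t P hP => ?_⟩
    simp [ok] at he
    have hk : (k : ℝ) ≤ 20 := by exact_mod_cast he
    have : (k : ℝ) * t ≤ 1 / 2 := by nlinarith [hP.1, hP.2.1]
    rw [ev, abs_of_nonneg (by apply div_nonneg <;> linarith), div_le_iff₀ (by linarith)]
    linarith
  | add a b iha ihb =>
    simp [ok] at he
    obtain ⟨A, hA, h1⟩ := iha he.1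
    obtain ⟨B, hB, h2⟩ := ihb he.2
    exact ⟨A + B, by positivity, fun t P hP => (abs_add_le _ _).trans (add_le_add (h1 t P hP) (h2 t P hP))⟩
  | mul a b iha ihb =>
    simp [ok] at he
    obtain ⟨A, hA, h1⟩ := iha he.1
    obtain ⟨B, hB, h2⟩ := ihb he.2
    refine ⟨A * B, by positivity, fun t P hP => ?_⟩
    rw [ev, abs_mul]
    exact mul_le_mul (h1 t P hP) (h2 t P hP) (abs_nonneg _) hA
  | hm a iha =>
    simp [ok] at he
    obtain ⟨A, hA, h1⟩ := iha he
    refine ⟨A, hA, fun t P hP => ?_⟩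
    have := h1 t P hP
    rw [ev, abs_mul, abs_of_pos hP.1]
    nlinarith [hP.1, hP.2.1, abs_nonneg (ev t P a)]

lemma geo_err (k : ℕ) (t : ℝ) (hk : (k : ℝ) * t ≤ 1 / 2) :
    1 / (1 - (k : ℝ) * t) = 1 + t * (k + t * ((k : ℝ) ^ 2 + t * ((k : ℝ) ^ 3 + t * ((k : ℝ) ^ 4 + t * ((k : ℝ) ^ 5 / (1 - (k : ℝ) * t)))))) := by
  have : 1 - (k : ℝ) * t ≠ 0 := by linarith
  field_simp
  ring

theorem ser_spec (e : Ex) (he : e.ok = true) (n : ℕ) (hn : n ≤ 5) :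
    ∃ K, 0 ≤ K ∧ ∀ t P, Box t P → |e.ev t P - e7 t P (ser n e)| ≤ K * t ^ n := by
  induction e generalizing n with
  | h =>
    refine ⟨0, le_rfl, fun t P hP => ?_⟩
    simp [ev, ser, e7, PL.evL, e6_cst, (hom6 P).zero]
  | P i =>
    refine ⟨0, le_rfl, fun t P hP => ?_⟩
    simp [ok] at he
    simp [ev, ser, e7, PL.evL, e6_vr P i he.1 he.2]
  | c q =>
    refine ⟨0, le_rfl, fun t P hP => ?_⟩
    by_cases hq : q = 0
    · simp [ev, ser, e7, PL.evL, hq]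
    · simp [ev, ser, e7, PL.evL, e6_cst, hq]
  | geo k =>
    simp [ok] at he
    have hk : (k : ℝ) ≤ 20 := by exact_mod_cast he
    set l : K7 := [cst 1, cst k, cst (k ^ 2), cst (k ^ 3), cst (k ^ 4)] with hl
    obtain ⟨D, hD, h5⟩ := bdd7 (l.drop n)
    refine ⟨2 * (k : ℝ) ^ 5 + D, by positivity, fun t P hP => ?_⟩
    have hkt : (k : ℝ) * t ≤ 1 / 2 := by nlinarith [hP.1, hP.2.1]
    have : ev t P (geo k) - e7 t P l = t ^ 5 * ((k : ℝ) ^ 5 / (1 - (k : ℝ) * t)) := by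
      simp only [ev, hl, e7, PL.evL, e6_cst]
      rw [geo_err k t hkt]
      push_cast
      ring
    have hs : ser n (geo k) = l.take n := by simp [ser, hl]
    have hd : e7 t P l = e7 t P (l.take n) + t ^ n * e7 t P (l.drop n) := evL_take _ _ n _
    have hp : 0 < 1 - (k : ℝ) * t := by linarith
    have e : ev t P (geo k) - e7 t P (ser n (geo k)) = t ^ 5 * ((k : ℝ) ^ 5 / (1 - (k : ℝ) * t)) + t ^ n * e7 t P (l.drop n) := by
      rw [hs]; linarith
    have hp0 := hP.1
    have tn : 0 ≤ t ^ n := by positivity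
    have t5 : t ^ 5 ≤ t ^ n := pow_le_pow_of_le_one hP.1.le (by linarith [hP.2.1]) hn
    have a1 : (k : ℝ) ^ 5 / (1 - (k : ℝ) * t) ≤ 2 * (k : ℝ) ^ 5 := by
      rw [div_le_iff₀ hp]
      nlinarith [pow_nonneg (Nat.cast_nonneg (α := ℝ) k) 5]
    have a0 : 0 ≤ (k : ℝ) ^ 5 / (1 - (k : ℝ) * t) := by positivity
    rw [e]
    refine (abs_add_le _ _).trans ?_
    rw [abs_mul, abs_mul, abs_of_nonneg tn, abs_of_nonneg a0, abs_of_nonneg (by positivity : (0:ℝ) ≤ t ^ 5), add_mul]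
    have b1 : t ^ 5 * ((k : ℝ) ^ 5 / (1 - (k : ℝ) * t)) ≤ t ^ n * (2 * (k : ℝ) ^ 5) := by gcongr
    have b2 := mul_le_mul_of_nonneg_left (h5 t P hP) tn
    linarith
  | add a b iha ihb =>
    simp [ok] at he
    obtain ⟨A, hA, h1⟩ := iha he.1 n hn
    obtain ⟨B, hB, h2⟩ := ihb he.2 n hn
    refine ⟨A + B, by positivity, fun t P hP => ?_⟩
    have := h1 t P hP
    have := h2 t P hP
    have e : e7 t P (ser n (add a b)) = e7 t P (ser n a) + e7 t P (ser n b) := (hom6 P).evL_add _ _ _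
    rw [e, ev, add_sub_add_comm, add_mul]
    exact (abs_add_le _ _).trans (by linarith)
  | mul a b iha ihb =>
    have he' := he
    simp [ok] at he
    obtain ⟨A, hA, h1⟩ := iha he.1 n hn
    obtain ⟨B, hB, h2⟩ := ihb he.2 n hn
    obtain ⟨A', hA', h3⟩ := bdd a he.1
    obtain ⟨B', hB', h4⟩ := bdd7 (ser n b)
    obtain ⟨D, hD, h5⟩ := bdd7 ((PL.mulL (ser n a) (ser n b)).drop n)
    refine ⟨A' * B + A * B' + D, by positivity, fun t P hP => ?_⟩
    have hm : e7 t P (PL.mulL (ser n a) (ser n b)) = e7 t P (ser n a) * e7 t P (ser n b) := (hom6 P).evL_mul _ _ _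
    have ht : e7 t P (PL.mulL (ser n a) (ser n b)) = e7 t P (ser n (mul a b)) + t ^ n * e7 t P ((PL.mulL (ser n a) (ser n b)).drop n) :=
      evL_take _ _ n _
    have e : ev t P (mul a b) - e7 t P (ser n (mul a b)) =
        ev t P a * (ev t P b - e7 t P (ser n b)) + (ev t P a - e7 t P (ser n a)) * e7 t P (ser n b) +
          t ^ n * e7 t P ((PL.mulL (ser n a) (ser n b)).drop n) := by
      rw [ev]; linear_combination ht - hm
    have t5 : 0 ≤ t ^ n := by have := hP.1; positivity
    rw [e]
    refine (abs_add_le _ _).trans ?_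
    refine (add_le_add_left (abs_add_le _ _) _).trans ?_
    rw [abs_mul, abs_mul, abs_mul, abs_of_nonneg t5]
    have a1 : |ev t P a| * |ev t P b - e7 t P (ser n b)| ≤ A' * (B * t ^ n) :=
      mul_le_mul (h3 t P hP) (h2 t P hP) (abs_nonneg _) hA'
    have a2 : |ev t P a - e7 t P (ser n a)| * |e7 t P (ser n b)| ≤ (A * t ^ n) * B' :=
      mul_le_mul (h1 t P hP) (h4 t P hP) (abs_nonneg _) (by positivity)
    have a3 := mul_le_mul_of_nonneg_left (h5 t P hP) t5
    linarith
  | hm a iha =>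
    simp [ok] at he
    cases n with
    | zero =>
      obtain ⟨A, hA, h1⟩ := bdd (hm a) (by simpa [ok] using he)
      refine ⟨A, hA, fun t P hP => ?_⟩
      simpa [ser, e7, PL.evL] using h1 t P hP
    | succ n =>
      obtain ⟨A, hA, h1⟩ := iha he n (by omega)
      refine ⟨A, hA, fun t P hP => ?_⟩
      have e : ev t P (hm a) - e7 t P (ser (n + 1) (hm a)) = t * (ev t P a - e7 t P (ser n a)) := by
        simp [ev, ser, e7, PL.evL, (hom6 P).zero]; ring
      rw [e, abs_mul, abs_of_pos hP.1]
      have := mul_le_mul_of_nonneg_left (h1 t P hP) hP.1.le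
      calc _ ≤ _ := this
        _ = _ := by ring

def z0 (p : K0) : Bool := p.l.all (fun q => decide (q = 0))
def z1 (p : K1) : Bool := p.l.all z0
def z2 (p : K2) : Bool := p.l.all z1
def z3 (p : K3) : Bool := p.l.all z2
def z4 (p : K4) : Bool := p.l.all z3
def z5 (p : K5) : Bool := p.l.all z4
def z6 (p : K6) : Bool := p.l.all z5
def z7 (p : K7) : Bool := p.all z6

lemma evL_zero {α : Type} (φ : α → ℝ) (z : α → Bool) (hz : ∀ a, z a = true → φ a = 0) (t : ℝ) (l : List α)
    (h : l.all z = true) : PL.evL φ t l = 0 := by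
  induction l with
  | nil => rfl
  | cons x a ih =>
    simp only [List.all_cons, Bool.and_eq_true] at h
    simp [PL.evL, hz x h.1, ih h.2]

lemma e7_zero (t : ℝ) (P : ℕ → ℝ) (l : K7) (h : z7 l = true) : e7 t P l = 0 := by
  refine evL_zero _ z6 (fun a => evL_zero _ z5 (fun a => evL_zero _ z4 (fun a => evL_zero _ z3 (fun a =>
    evL_zero _ z2 (fun a => evL_zero _ z1 (fun a => evL_zero _ z0 (fun a => evL_zero _ (fun q : ℚ => decide (q = 0)) ?_ _ _) _ _) _ _) _ _) _ _) _ _) _ _) _ _ h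
  intro q hq
  simpa using hq

/-- reflection principle -/
theorem reflect (e : Ex) (he : e.ok = true) (hz : z7 (ser 5 e) = true) :
    ∃ K, 0 ≤ K ∧ ∀ t P, Box t P → |e.ev t P| ≤ K * t ^ 5 := by
  obtain ⟨K, hK, h⟩ := ser_spec e he 5 le_rfl
  refine ⟨K, hK, fun t P hP => ?_⟩
  have := h t P hP
  rwa [e7_zero t P _ hz, sub_zero] at this

end Ex

end Part8

section Part9

/-- the expansion polynomial in `h = 1/x` and `Pᵢ = pᵢ/x` -/
def Rg {α : Type} [Add α] [Mul α] (q : ℚ → α) (h : α → α) (P : ℕ → α) : α :=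
  q 1 + h (q (-17/18) + q (-5/18) * P 2 + h (q (613/648) + q (35/27) * P 3 + P 2 * (q (535/324) + q (1225/648) * P 2)
    + h (q (-33713/34992) + q (-385/216) * P 5 + q (-1225/216) * P 4 + P 3 * (q (-3325/1944) + q (-7105/1944) * P 3)
      + P 2 * (q (-25025/11664) + q (-385/54) * P 4 + q (-5495/243) * P 3 + P 2 * (q (595/11664) + q (-4375/243) * P 3
        + P 2 * (q (-657125/34992) + q (-4375/486) * P 2))))))

namespace Ex

/-- `R` at the shifted point `(x - c, p + δ)` -/
def Rx (V : ℕ → Ex) (k : ℕ) (δ : ℕ → ℤ) : Ex :=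
  Rg Ex.c (fun a => hm (geo k * a)) (fun i => (V i + hm (c (δ i))) * geo k)

def sh (δ : ℕ → ℤ) (v w : ℕ) : ℕ → ℤ := fun i => δ i - (if i = v then 1 else 0) + (if i = w then 1 else 0)

def sumx : List Ex → Ex
  | [] => c 0
  | a :: l => a + sumx l

/-- weighted sum over the entries of a list with counts `V + δ h`, total weight `3 - s h`. -/
def wx (V : ℕ → Ex) (δ : ℕ → ℤ) (s : ℤ) (G : ℕ → Ex) (G0 : Ex) : Ex :=
  sumx ([2, 3, 4, 5, 6, 7].map fun i : ℕ => c (2 * i + 1) * (V i + hm (c (δ i))) * (G i + c (-1) * G0)) + (c 3 + hm (c (-s))) * G0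

/-- string: list at `δ`, level of `0::m` is `x - k` -/
def R1x (V : ℕ → Ex) (k : ℕ) (δ : ℕ → ℤ) : Ex :=
  c (1/3) * geo (k + 1) * wx V δ (3 * k + 1) (fun i => if i = 2 then Rx V (k + 2) (sh δ 2 1) else if i = 7 then Rx V (k + 1) δ else Rx V (k + 1) (sh δ i (i - 1))) (Rx V (k + 1) δ)

/-- double string: list at `δ`, level of `0::0::m` is `x - k` -/
def R2x (V : ℕ → Ex) (k : ℕ) (δ : ℕ → ℤ) : Ex :=
  c (1/3) * geo (k + 1) * wx V δ (3 * k + 2) (fun i => if i = 2 then R1x V (k + 2) (sh δ 2 1) else R1x V (k + 1) (sh δ i (i - 1))) (R1x V (k + 1) δ)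

/-- merging part for smallest entry `d` -/
def Mx (V : ℕ → Ex) (d : ℕ) : Ex :=
  c (1/3) * geo 1 * wx V (sh 0 d 0) (2 * d + 1) (fun i => Rx V 1 (sh (sh 0 d 0) i (d + i - 1))) (Rx V 1 (sh 0 d 0))

/-- scaled binomial coefficient -/
def chx (n : Ex) : ℕ → Ex
  | 0 => c 1
  | k + 1 => chx n k * (n + hm (c (-(k : ℚ)))) * c (1 / (k + 1))

/-- base counts -/
def Vd (d : ℕ) (i : ℕ) : Ex := if i < d then c 0 else P i

/-- counts of the remaining list -/
def dr (d : ℕ) : ℕ → ℤ := sh 0 d 0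

def gprod : ℕ → Ex
  | 0 => c 1
  | k + 1 => gprod k * geo (k + 1)

/-- genus two contribution of `a :: σ`, `σ = 2^a2 3^a3 4^a4 5^a5` -/
def tx (d : ℕ) (q : ℚ) (a2 a3 a4 a5 : ℕ) : Ex :=
  hm (hm (hm (hm (c (2 * (Nat.factorial (2 + (a2 + a3 + a4 + a5)) : ℚ) / 6 * q) * gprod (4 + (a2 + a3 + a4 + a5)) *
    (chx (Vd d 2 + hm (c (dr d 2))) a2 * chx (Vd d 3 + hm (c (dr d 3))) a3 * chx (Vd d 4 + hm (c (dr d 4))) a4 *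
      chx (Vd d 5 + hm (c (dr d 5))) a5)))))

def h2x (d : ℕ) : Ex :=
  if d = 2 then tx d (385/1296) 0 0 0 1 + tx d (385/1296) 1 0 1 0 + tx d (7105/23328) 0 2 0 0 + tx d (875/2916) 2 1 0 0 + tx d (875/2916) 4 0 0 0
  else if d = 3 then tx d (385/1296) 0 0 0 1 + tx d (7105/23328) 0 2 0 0 + tx d (35/144) 0 0 1 0
  else if d = 4 then tx d (385/1296) 0 0 0 1 + tx d (35/144) 0 0 1 0
  else if d = 5 then tx d (385/1296) 0 0 0 1
  else tx d (35/144) 0 0 0 0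

def h1x (d : ℕ) : Ex :=
  if d = 2 then c (5/54) * hm (hm (gprod 3 * (Vd 2 2 + hm (c (dr 2 2))) * R1x (Vd 2) 3 (sh (dr 2) 2 0)))
  else c (1/18) * hm (hm (gprod 2 * (if d = 3 then R1x (Vd d) 2 (dr d) else if d = 4 then Rx (Vd d) 3 (dr d) else Rx (Vd d) 2 (sh (dr d) 0 (d - 3)))))

def Splx (d : ℕ) : Ex :=
  if d = 2 then R2x (Vd d) 1 (dr d) else
    c 2 * R1x (Vd d) (if d = 3 then 2 else 1) (sh (dr d) 0 (d - 2)) +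
      sumx ((List.range (d - 3)).map fun a => Rx (Vd d) (1 + (if a = 0 then 1 else 0) + (if a + 4 = d then 1 else 0)) (sh (sh (dr d) 0 (a + 1)) 0 (d - 3 - a)))

def Tx (d : ℕ) : Ex := Mx (Vd d) d + c (2/3) * hm (geo 1 * Splx d)

def resx (d : ℕ) : Ex := Rx (Vd d) 0 0 + c (-1) * (Tx d + h1x d + h2x d)

def VZ : ℕ → Ex := fun _ => c 0

/-- generic large minimal entry, `P 1 = d / x` -/
def resL : Ex := Rx VZ 0 0 + c (-1) * (
  c (1/3) * geo 1 * ((c 3 + c (-2) * P 1 + hm (c (-1))) * Rx VZ 1 0)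
  + c (2/3) * (geo 1 * (hm (c 2 * R1x VZ 1 0 + c 2 * Rx VZ 2 0 + c 2 * sumx ([2, 3, 4, 5].map fun a => Rx VZ 1 (sh 0 0 a)))
     + (P 1 + hm (c (-13))) * Rx VZ 1 0))
  + c (1/18) * hm (hm (gprod 2 * Rx VZ 2 0))
  + hm (hm (hm (hm (c (2 * 2 / 6 * (35/144)) * gprod 4)))))

lemma resL_ok : ok resL = true := by decide +kernel
lemma resL_z : z7 (ser 5 resL) = true := by decide +kernel
lemma resx_ok : ∀ d ∈ Finset.Icc 2 12, ok (resx d) = true := by decide +kernel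
lemma resx_z2 : z7 (ser 5 (resx 2)) = true := by decide +kernel
lemma resx_z3 : ∀ d ∈ Finset.Icc 3 12, z7 (ser 5 (resx d)) = true := by decide +kernel

theorem resL_bound : ∃ K, 0 ≤ K ∧ ∀ t P, Box t P → |resL.ev t P| ≤ K * t ^ 5 := reflect _ resL_ok resL_z

theorem resx_bound : ∃ K, 0 ≤ K ∧ ∀ d ∈ Finset.Icc 2 12, ∀ t P, Box t P → |(resx d).ev t P| ≤ K * t ^ 5 := by
  have h : ∀ d ∈ Finset.Icc 2 12, ∃ K, 0 ≤ K ∧ ∀ t P, Box t P → |(resx d).ev t P| ≤ K * t ^ 5 := by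
    intro d hd
    refine reflect _ (resx_ok d hd) ?_
    rw [Finset.mem_Icc] at hd
    rcases Nat.lt_or_ge d 3 with h | h
    · have : d = 2 := by omega
      subst this; exact resx_z2
    · exact resx_z3 d (Finset.mem_Icc.2 ⟨h, hd.2⟩)
  choose! K hK hb using h
  refine ⟨∑ d ∈ Finset.Icc 2 12, K d, Finset.sum_nonneg hK, fun d hd t P hP => (hb d hd t P hP).trans ?_⟩
  have := Finset.single_le_sum hK hd
  have h0 := hP.1
  gcongr

end Ex

end Part9

section Part10

/-- value of the expansion -/
def Rv (x : ℝ) (p : ℕ → ℝ) : ℝ := Rg (fun q : ℚ => (q : ℝ)) (fun a => 1 / x * a) (fun i => p i / x)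

def R (m : Multiset ℕ) : ℝ := Rv (lv m) (fun i => (m.count i : ℝ))

lemma Rv_congr {x : ℝ} {p p' : ℕ → ℝ} (h : ∀ i, 2 ≤ i → i ≤ 5 → p i = p' i) : Rv x p = Rv x p' := by
  unfold Rv Rg
  beta_reduce
  rw [h 2 (by norm_num) (by norm_num), h 3 (by norm_num) (by norm_num), h 4 (by norm_num) (by norm_num),
    h 5 (by norm_num) (by norm_num)]

open Ex

lemma ev_add (t : ℝ) (P : ℕ → ℝ) (a b : Ex) : ev t P (a + b) = ev t P a + ev t P b := rfl
lemma ev_mul (t : ℝ) (P : ℕ → ℝ) (a b : Ex) : ev t P (a * b) = ev t P a * ev t P b := rfl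
lemma ev_c (t : ℝ) (P : ℕ → ℝ) (q : ℚ) : ev t P (c q) = q := rfl
lemma ev_hm (t : ℝ) (P : ℕ → ℝ) (a : Ex) : ev t P (hm a) = t * ev t P a := rfl
lemma ev_P (t : ℝ) (P : ℕ → ℝ) (i : ℕ) : ev t P (Ex.P i) = P i := rfl
lemma ev_geo (t : ℝ) (P : ℕ → ℝ) (k : ℕ) : ev t P (geo k) = 1 / (1 - k * t) := rfl

lemma geo_mul {x : ℝ} {k : ℕ} (hx : (k : ℝ) < x) : 1 / x * (1 / (1 - (k : ℝ) * (1 / x))) = 1 / (x - k) := by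
  have h0 : 0 < x := lt_of_le_of_lt (Nat.cast_nonneg k) hx
  have h1 : x - k ≠ 0 := by linarith
  have h2 : 1 - (k : ℝ) * (1 / x) ≠ 0 := by
    have : 1 - (k : ℝ) * (1 / x) = (x - k) / x := by field_simp
    rw [this]; exact div_ne_zero h1 h0.ne'
  field_simp
  

/-- the ambient data -/
structure Amb (X : ℕ) (p : ℕ → ℝ) (V : ℕ → Ex) (P : ℕ → ℝ) : Prop where
  hV : ∀ i, 2 ≤ i → i ≤ 7 → ev (1 / (X : ℝ)) P (V i) = p i * (1 / X)
  hX : 40 ≤ X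

variable {X : ℕ} {p : ℕ → ℝ} {V : ℕ → Ex} {P : ℕ → ℝ}

lemma Rg_hom (t : ℝ) (P : ℕ → ℝ) (hf : Ex → Ex) (W : ℕ → Ex) (y : ℝ) (hh : ∀ a, ev t P (hf a) = y * ev t P a) :
    ev t P (Rg Ex.c hf W) = Rg (fun q : ℚ => (q : ℝ)) (fun a => y * a) (fun i => ev t P (W i)) := by
  simp only [Rg, ev_add, hh, ev_mul, ev_c]

lemma Rx_ev (A : Amb X p V P) (k : ℕ) (hk : k ≤ 20) (δ : ℕ → ℤ) :
    ev (1 / (X : ℝ)) P (Rx V k δ) = Rv ((X : ℝ) - k) (fun i => p i + δ i) := by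
  have hX : (k : ℝ) < X := by exact_mod_cast (by have := A.hX; omega : k < X)
  have g := geo_mul hX
  have hP : ∀ i, 2 ≤ i → i ≤ 7 → ev (1 / (X : ℝ)) P ((V i + hm (c (δ i))) * geo k) = (p i + δ i) / ((X : ℝ) - k) := by
    intro i h1 h2
    rw [ev_mul, ev_add, A.hV i h1 h2, ev_hm, ev_c, ev_geo, div_eq_mul_one_div (p i + δ i), ← g]
    push_cast; ring
  have hh : ∀ a, ev (1 / (X : ℝ)) P (hm (geo k * a)) = 1 / ((X : ℝ) - k) * ev (1 / (X : ℝ)) P a := by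
    intro a
    rw [ev_hm, ev_mul, ev_geo, ← mul_assoc, g]
  unfold Rx
  rw [Rg_hom _ _ _ _ _ hh]
  unfold Rv Rg
  beta_reduce
  rw [hP 2 (by norm_num) (by norm_num), hP 3 (by norm_num) (by norm_num), hP 4 (by norm_num) (by norm_num),
    hP 5 (by norm_num) (by norm_num)]

lemma R_at (A : Amb X p V P) {k : ℕ} (hk : k ≤ 20) {δ : ℕ → ℤ} {m : Multiset ℕ}
    (h1 : 2 * m.sum + Multiset.card m + 3 * k = 3 * X)
    (h2 : ∀ i, 2 ≤ i → i ≤ 5 → (m.count i : ℝ) = p i + δ i) : R m = ev (1 / (X : ℝ)) P (Rx V k δ) := by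
  rw [Rx_ev A k hk]
  unfold R
  have : lv m + k = X := by unfold lv; omega
  have h : (lv m : ℝ) = (X : ℝ) - k := by rw [← this]; push_cast; ring
  rw [h]
  exact Rv_congr h2

lemma map_sum_small (r : Multiset ℕ) (ψ : ℕ → ℝ) (hr : Red r) (h : ∀ v ∈ r, 8 ≤ v → ψ v = 0) :
    (r.map ψ).sum = ∑ i ∈ Finset.Icc 2 7, (r.count i : ℝ) * ψ i := by
  induction r using Multiset.induction_on with
  | empty => simp
  | cons a s ih =>
    obtain ⟨ha, hs⟩ := red_cons.1 hr
    rw [Multiset.map_cons, Multiset.sum_cons, ih hs (fun v hv => h v (Multiset.mem_cons_of_mem hv))]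
    have e : ∀ i ∈ Finset.Icc 2 7, (((a ::ₘ s).count i : ℕ) : ℝ) * ψ i = (s.count i : ℝ) * ψ i + (if a = i then ψ i else 0) := by
      intro i _
      rw [Multiset.count_cons]
      by_cases hi : a = i
      · simp [hi]; ring
      · simp [hi, Ne.symm hi]
    rw [Finset.sum_congr rfl e, Finset.sum_add_distrib, Finset.sum_ite_eq]
    by_cases h8 : a ∈ Finset.Icc 2 7
    · rw [if_pos h8]; ring
    · rw [if_neg h8, h a (Multiset.mem_cons_self _ _) (by rw [Finset.mem_Icc] at h8; omega)]; ring

lemma wx_ev (A : Amb X p V P) (r : Multiset ℕ) (hr : Red r) (δ : ℕ → ℤ) (s : ℕ) (hs : 2 * r.sum + Multiset.card r + s = 3 * X)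
    (f : ℕ → ℝ) (G : ℕ → Ex) (G0 : Ex)
    (hc : ∀ i, 2 ≤ i → i ≤ 7 → (r.count i : ℝ) = p i + δ i ∨ ev (1 / (X : ℝ)) P (G i) = ev (1 / (X : ℝ)) P G0)
    (hf : ∀ i ∈ r, i ≤ 7 → f i = ev (1 / (X : ℝ)) P (G i)) (hf8 : ∀ i ∈ r, 8 ≤ i → f i = ev (1 / (X : ℝ)) P G0) :
    1 / (X : ℝ) * (r.map fun v : ℕ => (2 * (v : ℝ) + 1) * f v).sum = ev (1 / (X : ℝ)) P (wx V δ s G G0) := by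
  set t : ℝ := 1 / (X : ℝ) with ht
  set y := ev t P G0 with hy
  have hX0 : (X : ℝ) ≠ 0 := by have := A.hX; positivity
  have e1 : (r.map fun v : ℕ => (2 * (v : ℝ) + 1) * f v).sum =
      (r.map fun v : ℕ => (2 * (v : ℝ) + 1) * (f v - y)).sum + (r.map fun v : ℕ => 2 * (v : ℝ) + 1).sum * y := by
    rw [← Multiset.sum_map_mul_right, ← Multiset.sum_map_add]
    congr 1
    refine Multiset.map_congr rfl fun v _ => ?_
    ring
  have e2 : (r.map fun v : ℕ => 2 * (v : ℝ) + 1).sum = 3 * X - s := by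
    rw [sum_weights]
    have : (2 * (r.sum : ℕ) + (Multiset.card r : ℕ) + s : ℝ) = 3 * X := by exact_mod_cast hs
    linarith
  have e3 : (r.map fun v : ℕ => (2 * (v : ℝ) + 1) * (f v - y)).sum = ∑ i ∈ Finset.Icc 2 7, (r.count i : ℝ) * ((2 * (i : ℝ) + 1) * (f i - y)) := by
    apply map_sum_small r _ hr
    intro v hv h8
    rw [hf8 v hv h8, sub_self, mul_zero]
  have e4 : ∀ i ∈ Finset.Icc 2 7, t * ((r.count i : ℝ) * ((2 * (i : ℝ) + 1) * (f i - y))) =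
      ev t P (c (2 * i + 1) * (V i + hm (c (δ i))) * (G i + c (-1) * G0)) := by
    intro i hi
    rw [Finset.mem_Icc] at hi
    simp only [ev_mul, ev_add, ev_c, ev_hm]
    rw [A.hV i hi.1 hi.2, ← ht, ← hy]
    by_cases h0 : i ∈ r
    · rw [hf i h0 hi.2]
      rcases hc i hi.1 hi.2 with h | h
      · rw [h]; push_cast; ring
      · rw [h]; push_cast; ring
    · have : (r.count i : ℝ) = 0 := by rw [Multiset.count_eq_zero_of_notMem h0]; simp
      rcases hc i hi.1 hi.2 with h | h
      · have h' : p i = - δ i := by linarith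
        rw [this, h']; push_cast; ring
      · rw [this, h]; push_cast; ring
  rw [e1, e2, e3, mul_add, Finset.mul_sum, Finset.sum_congr rfl e4]
  unfold wx
  have e5 : t * ((3 * (X : ℝ) - s) * y) = ev t P ((c 3 + hm (c (-(s : ℤ)))) * G0) := by
    simp only [ev_mul, ev_add, ev_c, ev_hm]
    rw [← hy, ht]; push_cast; field_simp; ring
  rw [e5, ev_add]
  congr 1
  simp [sumx, Finset.sum_Icc_succ_top, ev_add, ev_c]
  ring

lemma count_move {r : Multiset ℕ} {v w i : ℕ} (hv : v ∈ r) (q : ℝ) (δ : ℕ → ℤ) (h : (r.count i : ℝ) = q + δ i) :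
    ((w ::ₘ r.erase v).count i : ℝ) = q + sh δ v w i := by
  obtain ⟨s, rfl⟩ := Multiset.exists_cons_of_mem hv
  rw [Multiset.erase_cons_head]
  rw [Multiset.count_cons] at h ⊢
  unfold sh
  push_cast at h ⊢
  split_ifs at h ⊢ <;> push_cast at h ⊢ <;> linarith

lemma count_del {r : Multiset ℕ} {v w i : ℕ} (hv : v ∈ r) (hw : i ≠ w) (q : ℝ) (δ : ℕ → ℤ) (h : (r.count i : ℝ) = q + δ i) :
    ((r.erase v).count i : ℝ) = q + sh δ v w i := by
  have := count_move (w := w) hv q δ h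
  rwa [Multiset.count_cons_of_ne hw] at this

lemma count_ins {r : Multiset ℕ} {w i : ℕ} (hi : i ≠ 0) (q : ℝ) (δ : ℕ → ℤ) (h : (r.count i : ℝ) = q + δ i) :
    ((w ::ₘ r).count i : ℝ) = q + sh δ 0 w i := by
  rw [Multiset.count_cons]
  unfold sh
  push_cast
  rw [if_neg hi]
  split_ifs <;> linarith

/-- sizes after moving an entry -/
lemma move_size {r : Multiset ℕ} {v : ℕ} (hv : v ∈ r) (w : ℕ) :
    2 * (w ::ₘ r.erase v).sum + Multiset.card (w ::ₘ r.erase v) + 2 * v = 2 * r.sum + Multiset.card r + 2 * w := by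
  have := sum_erase' hv
  have := card_erase' hv
  simp only [Multiset.sum_cons, Multiset.card_cons]; omega

lemma del_size {r : Multiset ℕ} {v : ℕ} (hv : v ∈ r) :
    2 * (r.erase v).sum + Multiset.card (r.erase v) + 2 * v + 1 = 2 * r.sum + Multiset.card r := by
  have := sum_erase' hv
  have := card_erase' hv
  omega

lemma pref_ev (A : Amb X p V P) (k : ℕ) (hk : k ≤ 18) (Y : ℕ) (hY : Y + k = X) (S : ℝ) :
    1 / (3 * ((Y : ℝ) - 1)) * S = ev (1 / (X : ℝ)) P (c (1/3) * geo (k + 1)) * (1 / (X : ℝ) * S) := by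
  have hX : ((k + 1 : ℕ) : ℝ) < X := by exact_mod_cast (by have := A.hX; omega : k + 1 < X)
  have g := geo_mul hX
  have h : (Y : ℝ) - 1 = (X : ℝ) - (k + 1 : ℕ) := by rw [← hY]; push_cast; ring
  rw [ev_mul, ev_c, ev_geo, h]
  rw [show ((1 / 3 : ℚ) : ℝ) * (1 / (1 - ((k + 1 : ℕ) : ℝ) * (1 / X))) * (1 / X * S) = 1 / 3 * S * (1 / (X : ℝ) * (1 / (1 - ((k + 1 : ℕ) : ℝ) * (1 / X)))) by push_cast; ring, g]
  have : (X : ℝ) - ((k + 1 : ℕ) : ℝ) ≠ 0 := by linarith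
  field_simp

lemma sh_far {δ : ℕ → ℤ} {v w i : ℕ} (h1 : i ≠ v) (h2 : i ≠ w) : sh δ v w i = δ i := by
  simp [sh, h1, h2]

lemma H1_at (A : Amb X p V P) {k : ℕ} (hk : k ≤ 18) {δ : ℕ → ℤ} {m : Multiset ℕ}
    (h1 : 2 * (big m).sum + Multiset.card (big m) + 1 + 3 * k = 3 * X)
    (h2 : ∀ i, 2 ≤ i → i ≤ 6 → ((big m).count i : ℝ) = p i + δ i) : H1 R m = ev (1 / (X : ℝ)) P (R1x V k δ) := by
  unfold H1 str
  set r := big m with hr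
  have hred : Red r := big_red m
  have hlv : lv (0 ::ₘ r) + k = X := by unfold lv; simp only [Multiset.sum_cons, Multiset.card_cons]; omega
  rw [pref_ev A k hk _ hlv]
  unfold R1x
  rw [ev_mul]
  congr 1
  have far : ∀ v ∈ r, 7 ≤ v → H0 R ((v - 1) ::ₘ r.erase v) = ev (1 / (X : ℝ)) P (Rx V (k + 1) δ) := by
    intro v hv v7
    have ms := move_size hv (v - 1)
    unfold H0
    rw [big_cons, big_of_red (hred.erase v), if_pos (by omega)]
    apply R_at A (by omega)
    · omega
    · intro i i2 i5
      have := count_move (w := v - 1) hv _ _ (h2 i i2 (by omega))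
      rwa [sh_far (by omega) (by omega)] at this
  have key := wx_ev A r hred δ (3 * k + 1) (by omega) (fun v => H0 R ((v - 1) ::ₘ r.erase v))
    (fun i => if i = 2 then Rx V (k + 2) (sh δ 2 1) else if i = 7 then Rx V (k + 1) δ else Rx V (k + 1) (sh δ i (i - 1)))
    (Rx V (k + 1) δ) ?_ ?_ ?_
  · push_cast at key
    rw [← key]
    congr 2
    refine Multiset.map_congr rfl fun v hv => ?_
    rw [if_pos (by have := hred v hv; omega)]
  · intro i i2 i7
    rcases Nat.lt_or_ge i 7 with h | h
    · left; exact h2 i i2 (by omega)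
    · right
      have : i = 7 := by omega
      subst this; simp
  · intro v hv v7
    have hv2 := hred v hv
    have ms := move_size hv (v - 1)
    have ds := del_size hv
    beta_reduce
    rcases Nat.lt_or_ge v 7 with h7 | h7
    · unfold H0
      rw [big_cons, big_of_red (hred.erase v)]
      by_cases a3 : v = 2
      · subst a3
        rw [if_pos rfl, if_neg (show ¬ 2 ≤ 2 - 1 by norm_num)]
        apply R_at A (by omega)
        · omega
        · intro i i2 i5
          exact count_del hv (by omega) _ _ (h2 i i2 (by omega))
      · rw [if_neg a3, if_neg (show ¬ v = 7 by omega), if_pos (show 2 ≤ v - 1 by omega)]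
        apply R_at A (by omega)
        · omega
        · intro i i2 i5
          exact count_move hv _ _ (h2 i i2 (by omega))
    · rw [if_neg (by omega), if_pos (by omega)]
      exact far v hv h7
  · intro v hv v8
    exact far v hv (by omega)

lemma H2_at (A : Amb X p V P) {k : ℕ} (hk : k ≤ 16) {δ : ℕ → ℤ} {r : Multiset ℕ} (hred : Red r)
    (h1 : 2 * r.sum + Multiset.card r + 2 + 3 * k = 3 * X)
    (h2 : ∀ i, 2 ≤ i → i ≤ 7 → (r.count i : ℝ) = p i + δ i) : H2 R r = ev (1 / (X : ℝ)) P (R2x V k δ) := by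
  unfold H2 str
  have hlv : lv (0 ::ₘ 0 ::ₘ r) + k = X := by unfold lv; simp only [Multiset.sum_cons, Multiset.card_cons]; omega
  rw [pref_ev A k (by omega) _ hlv]
  unfold R2x
  rw [ev_mul]
  congr 1
  have key := wx_ev A r hred δ (3 * k + 2) (by omega) (fun v => H1 R ((v - 1) ::ₘ r.erase v))
    (fun i => if i = 2 then R1x V (k + 2) (sh δ 2 1) else R1x V (k + 1) (sh δ i (i - 1)))
    (R1x V (k + 1) δ) (fun i i2 i7 => Or.inl (h2 i i2 i7)) ?_ ?_
  · push_cast at key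
    rw [← key]
    congr 2
    refine Multiset.map_congr rfl fun v hv => ?_
    rw [if_pos (by have := hred v hv; omega)]
  · intro v hv v7
    have hv2 := hred v hv
    have ms := move_size hv (v - 1)
    have ds := del_size hv
    beta_reduce
    by_cases a3 : v = 2
    · subst a3
      rw [if_pos rfl]
      have hb : big ((2 - 1) ::ₘ r.erase 2) = r.erase 2 := by
        rw [big_cons, big_of_red (hred.erase 2), if_neg (by norm_num)]
      apply H1_at A (by omega)
      · rw [hb]; omega
      · rw [hb]
        intro i i2 i5
        exact count_del hv (by omega) _ _ (h2 i i2 (by omega))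
    · rw [if_neg a3]
      have hb : big ((v - 1) ::ₘ r.erase v) = (v - 1) ::ₘ r.erase v := by
        rw [big_cons, big_of_red (hred.erase v), if_pos (by omega)]
      apply H1_at A (by omega)
      · rw [hb]; omega
      · rw [hb]
        intro i i2 i5
        exact count_move hv _ _ (h2 i i2 (by omega))
  · intro v hv v8
    have ms := move_size hv (v - 1)
    have hb : big ((v - 1) ::ₘ r.erase v) = (v - 1) ::ₘ r.erase v := by
      rw [big_cons, big_of_red (hred.erase v), if_pos (by omega)]
    apply H1_at A (by omega)
    · rw [hb]; omega
    · rw [hb]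
      intro i i2 i5
      have := count_move (w := v - 1) hv _ _ (h2 i i2 (by omega))
      rwa [sh_far (by omega) (by omega)] at this

end Part10

section Part11

open Ex

variable {X : ℕ} {p : ℕ → ℝ} {V : ℕ → Ex} {P : ℕ → ℝ}

lemma ev_sumx (t : ℝ) (P : ℕ → ℝ) (l : List Ex) : ev t P (sumx l) = (l.map (ev t P)).sum := by
  induction l with
  | nil => simp [sumx, ev_c]
  | cons a l ih => simp [sumx, ev_add, ih]

lemma ev_sumx_range (t : ℝ) (P : ℕ → ℝ) (n : ℕ) (f : ℕ → Ex) :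
    ev t P (sumx ((List.range n).map f)) = ∑ a ∈ Finset.range n, ev t P (f a) := by
  rw [ev_sumx, List.map_map]; rfl

lemma H0_at (A : Amb X p V P) {k : ℕ} (hk : k ≤ 20) {δ : ℕ → ℤ} {m : Multiset ℕ}
    (h1 : 2 * (big m).sum + Multiset.card (big m) + 3 * k = 3 * X)
    (h2 : ∀ i, 2 ≤ i → i ≤ 5 → (m.count i : ℝ) = p i + δ i) : H0 R m = ev (1 / (X : ℝ)) P (Rx V k δ) := by
  unfold H0
  apply R_at A hk h1
  intro i i2 i5
  rw [← h2 i i2 i5]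
  unfold big
  rw [Multiset.count_filter_of_pos i2]

lemma big_count {m : Multiset ℕ} {i : ℕ} (h : 2 ≤ i) : (big m).count i = m.count i := by
  unfold big
  rw [Multiset.count_filter_of_pos h]

/-- data for a tuple with minimal entry `d` -/
structure Dat (g d : ℕ) (r : Multiset ℕ) : Prop where
  hg : HasG g (d ::ₘ r)
  red : Red (d ::ₘ r)
  hmin : IsMin d r
  hX : 40 ≤ lv (d ::ₘ r)

def Pd (d : ℕ) (r : Multiset ℕ) (i : ℕ) : ℝ := ((d ::ₘ r).count i : ℝ) / (lv (d ::ₘ r) : ℝ)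

variable {g d : ℕ} {r : Multiset ℕ}

lemma Dat.amb (D : Dat g d r) : Amb (lv (d ::ₘ r)) (fun i => ((d ::ₘ r).count i : ℝ)) (Vd d) (Pd d r) := by
  refine ⟨fun i i2 i7 => ?_, D.hX⟩
  unfold Vd
  split_ifs with h
  · have : i ∉ d ::ₘ r := by
      rw [Multiset.mem_cons]
      rintro (h' | h')
      · omega
      · have := D.hmin i h'; omega
    rw [Multiset.count_eq_zero_of_notMem this]; simp [ev_c]
  · rw [ev_P, Pd, div_eq_mul_one_div]

lemma Dat.size (D : Dat g d r) : 2 * r.sum + Multiset.card r + (2 * d + 1) = 3 * lv (d ::ₘ r) := by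
  have := three_lv D.hg
  simp only [Multiset.sum_cons, Multiset.card_cons] at this
  omega

lemma count_dr (i : ℕ) (i2 : 2 ≤ i) : (r.count i : ℝ) = ((d ::ₘ r).count i : ℝ) + dr d i := by
  rw [Multiset.count_cons]
  unfold dr sh
  push_cast
  rw [if_neg (show ¬ i = 0 by omega)]
  split_ifs <;> simp

lemma Dat.redr (D : Dat g d r) : Red r := (red_cons.1 D.red).2
lemma Dat.hd (D : Dat g d r) : 2 ≤ d := (red_cons.1 D.red).1

lemma M_ev (D : Dat g d r) :
    1 / (3 * ((lv (d ::ₘ r) : ℝ) - 1)) * (r.map fun v : ℕ => (2 * (v : ℝ) + 1) * R ((d + v - 1) ::ₘ r.erase v)).sum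
      = ev (1 / (lv (d ::ₘ r) : ℝ)) (Pd d r) (Mx (Vd d) d) := by
  have A := D.amb
  have hs := D.size
  have hd := D.hd
  rw [pref_ev A 0 (by omega) (lv (d ::ₘ r)) rfl]
  unfold Mx
  rw [ev_mul]
  congr 1
  have key := wx_ev A r D.redr (sh 0 d 0) (2 * d + 1) hs (fun v => R ((d + v - 1) ::ₘ r.erase v))
    (fun i => Rx (Vd d) 1 (sh (sh 0 d 0) i (d + i - 1))) (Rx (Vd d) 1 (sh 0 d 0)) (fun i i2 i7 => Or.inl (count_dr i i2)) ?_ ?_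
  · push_cast at key
    exact key
  · intro v hv v7
    have ms := move_size hv (d + v - 1)
    have hv2 := D.redr v hv
    apply R_at A (by omega)
    · omega
    · intro i i2 i5
      exact count_move hv _ _ (count_dr i i2)
  · intro v hv v7
    have ms := move_size hv (d + v - 1)
    apply R_at A (by omega)
    · omega
    · intro i i2 i5
      have := count_move (w := d + v - 1) hv _ _ (count_dr (d := d) i i2)
      rwa [sh_far (by omega) (by omega)] at this

lemma Spl_ev (D : Dat g d r) : Spl R d r = ev (1 / (lv (d ::ₘ r) : ℝ)) (Pd d r) (Splx d) := by
  have A := D.amb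
  have hs := D.size
  have hd := D.hd
  have hred := D.redr
  unfold Spl Splx
  by_cases h2 : d = 2
  · rw [if_pos h2, if_pos h2]
    apply H2_at A (by omega) hred
    · omega
    · intro i i2 i7
      exact count_dr i i2
  · rw [if_neg h2, if_neg h2, ev_add, ev_mul, ev_c, ev_sumx_range]
    have e1 : H1 R ((d - 2) ::ₘ r) = ev (1 / (lv (d ::ₘ r) : ℝ)) (Pd d r) (R1x (Vd d) (if d = 3 then 2 else 1) (sh (dr d) 0 (d - 2))) := by
      apply H1_at A (by split_ifs <;> omega)
      · rw [big_cons, big_of_red hred]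
        split_ifs <;> (try simp only [Multiset.sum_cons, Multiset.card_cons]) <;> omega
      · intro i i2 i6
        rw [big_count i2]
        exact count_ins (by omega) _ _ (count_dr i i2)
    rw [e1]
    rw [show ((2 : ℚ) : ℝ) = 2 by norm_num]
    congr 1
    · rw [show d - 2 = d - 3 + 1 by omega, Finset.sum_Ico_eq_sum_range]
      refine Finset.sum_congr (by congr 1) fun a ha => ?_
      rw [Finset.mem_range] at ha
      apply H0_at A (by split_ifs <;> omega)
      · rw [big_cons, big_cons, big_of_red hred]
        split_ifs <;> (try simp only [Multiset.sum_cons, Multiset.card_cons]) <;> omega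
      · intro i i2 i5
        rw [Multiset.cons_swap]
        have := count_ins (w := d - 3 - a) (show i ≠ 0 by omega) _ _ (count_ins (w := a + 1) (show i ≠ 0 by omega) _ _ (count_dr (r := r) (d := d) i i2))
        rw [← this, add_comm 1 a, show d - 3 + 1 - (a + 1) = d - 3 - a by omega]

lemma T_ev (D : Dat g d r) : T R d r = ev (1 / (lv (d ::ₘ r) : ℝ)) (Pd d r) (Tx d) := by
  unfold T Tx
  rw [ev_add, M_ev D, Spl_ev D, ev_mul, ev_hm, ev_mul, ev_c, ev_geo]
  congr 1
  have hX : ((1 : ℕ) : ℝ) < (lv (d ::ₘ r) : ℝ) := by exact_mod_cast (by have := D.hX; omega)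
  have gm := geo_mul hX
  rw [← mul_assoc (1 / (lv (d ::ₘ r) : ℝ)), gm]
  push_cast at hX ⊢
  have : (lv (d ::ₘ r) : ℝ) - 1 ≠ 0 := by linarith
  field_simp

lemma R_ev (D : Dat g d r) : R (d ::ₘ r) = ev (1 / (lv (d ::ₘ r) : ℝ)) (Pd d r) (Rx (Vd d) 0 0) := by
  apply R_at D.amb (by omega)
  · have := three_lv D.hg; omega
  · intro i i2 i5; simp

lemma Dat.box (D : Dat g d r) : Box (1 / (lv (d ::ₘ r) : ℝ)) (Pd d r) := by
  have hX : (40 : ℝ) ≤ lv (d ::ₘ r) := by exact_mod_cast D.hX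
  refine ⟨by positivity, ?_, fun i => ?_⟩
  · apply one_div_le_one_div_of_le (by norm_num) hX
  · have h1 : (d ::ₘ r).count i ≤ 2 * lv (d ::ₘ r) := by
      have := Multiset.count_le_card i (d ::ₘ r)
      have := three_lv D.hg
      have := D.red.two_mul_card_le
      omega
    have h1' : ((d ::ₘ r).count i : ℝ) ≤ 2 * lv (d ::ₘ r) := by exact_mod_cast h1
    unfold Pd
    rw [abs_of_nonneg (by positivity), div_le_iff₀ (by linarith)]
    exact h1'

end Part11

section Part12

variable {C : List ℕ → ℚ}

lemma cm_14 (hC : IsNormalizedWitten C) : cm C {1, 4} = 35 / 144 := by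
  have := cm_dil hC {4} (Or.inl (by simp [lv]))
  rw [cm_4 hC] at this; exact this

lemma cm_05 (hC : IsNormalizedWitten C) : cm C {0, 5} = 385 / 1296 := by
  have := cm_str hC {5} ⟨2, by simp [HasG]⟩ (by simp [lv])
  rw [show ({0, 5} : Multiset ℕ) = 0 ::ₘ {5} from rfl, this]
  simp [str, lv]
  rw [cm_4 hC]; norm_num

lemma cm_024 (hC : IsNormalizedWitten C) : cm C {0, 2, 4} = 385 / 1296 := by
  have := cm_str hC {2, 4} ⟨2, by simp [HasG]⟩ (by simp [lv])
  rw [show ({0, 2, 4} : Multiset ℕ) = 0 ::ₘ {2, 4} from rfl, this]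
  have e1 : (2 - 1) ::ₘ (({2, 4} : Multiset ℕ).erase 2) = {1, 4} := by decide
  have e2 : (4 - 1) ::ₘ (({2, 4} : Multiset ℕ).erase 4) = {2, 3} := by decide
  have e3 : lv (0 ::ₘ {2, 4}) = 5 := by simp [lv]
  unfold str
  rw [e3, show ({2, 4} : Multiset ℕ).map (fun v : ℕ => if 1 ≤ v then (2 * (v : ℝ) + 1) * cm C ((v - 1) ::ₘ ({2, 4} : Multiset ℕ).erase v) else 0) =
    {5 * cm C {1, 4}, 9 * cm C {2, 3}} by
      rw [← e1, ← e2]; simp only [Multiset.insert_eq_cons, Multiset.map_cons, Multiset.map_singleton]; norm_num]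
  rw [cm_14 hC, cm_23 hC]
  simp; norm_num

lemma cm_033 (hC : IsNormalizedWitten C) : cm C {0, 3, 3} = 7105 / 23328 := by
  have := cm_str hC {3, 3} ⟨2, by simp [HasG]⟩ (by simp [lv])
  rw [show ({0, 3, 3} : Multiset ℕ) = 0 ::ₘ {3, 3} from rfl, this]
  have e1 : (3 - 1) ::ₘ (({3, 3} : Multiset ℕ).erase 3) = {2, 3} := by decide
  have e3 : lv (0 ::ₘ {3, 3}) = 5 := by simp [lv]
  unfold str
  rw [e3, show ({3, 3} : Multiset ℕ).map (fun v : ℕ => if 1 ≤ v then (2 * (v : ℝ) + 1) * cm C ((v - 1) ::ₘ ({3, 3} : Multiset ℕ).erase v) else 0) =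
    {7 * cm C {2, 3}, 7 * cm C {2, 3}} by
      rw [← e1]; simp only [Multiset.insert_eq_cons, Multiset.map_cons, Multiset.map_singleton]; norm_num]
  rw [cm_23 hC]
  simp; norm_num

lemma cm_0022 (hC : IsNormalizedWitten C) : cm C {0, 0, 2, 2} = 25 / 81 := by
  have := cm_str hC {0, 2, 2} ⟨1, by simp [HasG]⟩ (by simp [lv])
  rw [show ({0, 0, 2, 2} : Multiset ℕ) = 0 ::ₘ {0, 2, 2} from rfl, this]
  have e1 : (2 - 1) ::ₘ (({0, 2, 2} : Multiset ℕ).erase 2) = 1 ::ₘ {0, 2} := by decide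
  have e3 : lv (0 ::ₘ {0, 2, 2}) = 4 := by simp [lv]
  unfold str
  rw [e3, show ({0, 2, 2} : Multiset ℕ).map (fun v : ℕ => if 1 ≤ v then (2 * (v : ℝ) + 1) * cm C ((v - 1) ::ₘ ({0, 2, 2} : Multiset ℕ).erase v) else 0) =
    {0, 5 * cm C (1 ::ₘ {0, 2}), 5 * cm C (1 ::ₘ {0, 2})} by
      rw [← e1]; simp only [Multiset.insert_eq_cons, Multiset.map_cons, Multiset.map_singleton]; norm_num]
  rw [cm_dil hC {0, 2} (Or.inl (by simp [lv])), cm_02 hC]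
  simp; norm_num

lemma cm_222 (hC : IsNormalizedWitten C) : cm C {2, 2, 2} = 175 / 648 := by
  have := dvv_m hC 2 {2, 2} ⟨2, by simp [HasG]⟩ (by simp [lv])
  have h0 : cm C {0} = 0 := cm_vanish hC _ (by simp [HasG]; intro x; omega)
  have h022 : cm C {0, 2, 2} = 0 := cm_vanish hC _ (by simp [HasG]; intro x; omega)
  rw [show ({2, 2, 2} : Multiset ℕ) = 2 ::ₘ {2, 2} from rfl, this]
  have e0022 := cm_0022 hC
  have e02 := cm_02 hC
  have e32 : cm C {3, 2} = 1015 / 3888 := by rw [Multiset.pair_comm, cm_23 hC]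
  simp only [Multiset.insert_eq_cons] at e0022 e02 e32
  have hh : (Multiset.antidiagonal ({2, 2} : Multiset ℕ)) = {(0, {2, 2}), ({2}, {2}), ({2}, {2}), ({2, 2}, 0)} := by
    rw [show ({2, 2} : Multiset ℕ) = 2 ::ₘ 2 ::ₘ 0 from rfl, Multiset.antidiagonal_cons, Multiset.antidiagonal_cons]; simp
    exact Multiset.cons_swap _ _ _
  rw [hh]
  simp only [Multiset.insert_eq_cons] at h022
  simp [lv, h0, h022, e0022, e02, e32]
  norm_num [Nat.factorial]

lemma cm_0223 (hC : IsNormalizedWitten C) : cm C {0, 2, 2, 3} = 875 / 2916 := by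
  have := cm_str hC {2, 2, 3} ⟨2, by simp [HasG]⟩ (by simp [lv])
  rw [show ({0, 2, 2, 3} : Multiset ℕ) = 0 ::ₘ {2, 2, 3} from rfl, this]
  have e1 : (2 - 1) ::ₘ (({2, 2, 3} : Multiset ℕ).erase 2) = 1 ::ₘ {2, 3} := by decide
  have e2 : (3 - 1) ::ₘ (({2, 2, 3} : Multiset ℕ).erase 3) = {2, 2, 2} := by decide
  have e3 : lv (0 ::ₘ {2, 2, 3}) = 6 := by simp [lv]
  unfold str
  rw [e3, show ({2, 2, 3} : Multiset ℕ).map (fun v : ℕ => if 1 ≤ v then (2 * (v : ℝ) + 1) * cm C ((v - 1) ::ₘ ({2, 2, 3} : Multiset ℕ).erase v) else 0) =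
    {5 * cm C (1 ::ₘ {2, 3}), 5 * cm C (1 ::ₘ {2, 3}), 7 * cm C {2, 2, 2}} by
      rw [← e1, ← e2]; simp only [Multiset.insert_eq_cons, Multiset.map_cons, Multiset.map_singleton]; norm_num]
  rw [cm_dil hC {2, 3} (Or.inl (by simp [lv])), cm_23 hC, cm_222 hC]
  simp; norm_num

lemma cm_02222 (hC : IsNormalizedWitten C) : cm C {0, 2, 2, 2, 2} = 875 / 2916 := by
  have := cm_str hC {2, 2, 2, 2} ⟨2, by simp [HasG]⟩ (by simp [lv])
  rw [show ({0, 2, 2, 2, 2} : Multiset ℕ) = 0 ::ₘ {2, 2, 2, 2} from rfl, this]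
  have e1 : (2 - 1) ::ₘ (({2, 2, 2, 2} : Multiset ℕ).erase 2) = 1 ::ₘ {2, 2, 2} := by decide
  have e3 : lv (0 ::ₘ {2, 2, 2, 2}) = 7 := by simp [lv]
  unfold str
  rw [e3, show ({2, 2, 2, 2} : Multiset ℕ).map (fun v : ℕ => if 1 ≤ v then (2 * (v : ℝ) + 1) * cm C ((v - 1) ::ₘ ({2, 2, 2, 2} : Multiset ℕ).erase v) else 0) =
    {5 * cm C (1 ::ₘ {2, 2, 2}), 5 * cm C (1 ::ₘ {2, 2, 2}), 5 * cm C (1 ::ₘ {2, 2, 2}), 5 * cm C (1 ::ₘ {2, 2, 2})} by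
      rw [← e1]; simp only [Multiset.insert_eq_cons, Multiset.map_cons, Multiset.map_singleton]; norm_num]
  rw [cm_dil hC {2, 2, 2} (Or.inl (by simp [lv])), cm_222 hC]
  simp; norm_num

/-- number of sub-multisets -/
lemma count_powerset (I : Finset ℕ) (r : Multiset ℕ) : ∀ σ : Multiset ℕ, (∀ i ∈ σ, i ∈ I) →
    r.powerset.count σ = ∏ i ∈ I, (r.count i).choose (σ.count i) := by
  induction r using Multiset.induction_on with
  | empty =>
    intro σ hσ
    rw [Multiset.powerset_zero, Multiset.count_singleton]
    by_cases h : σ = 0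
    · subst h; simp
    · obtain ⟨i, hi⟩ := Multiset.exists_mem_of_ne_zero h
      rw [if_neg h, eq_comm]
      apply Finset.prod_eq_zero (hσ i hi)
      have := Multiset.one_le_count_iff_mem.2 hi
      rw [Multiset.count_zero]
      exact Nat.choose_eq_zero_of_lt (by omega)
  | cons a s ih =>
    intro σ hσ
    rw [Multiset.powerset_cons, Multiset.count_add, ih σ hσ]
    by_cases ha : a ∈ σ
    · obtain ⟨τ, rfl⟩ := Multiset.exists_cons_of_mem ha
      rw [Multiset.count_map_eq_count' _ _ (fun x y h => (Multiset.cons_inj_right a).1 h), ih τ (fun i hi => hσ i (Multiset.mem_cons_of_mem hi))]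
      have haI := hσ a ha
      rw [← Finset.mul_prod_erase I _ haI, ← Finset.mul_prod_erase I _ haI, ← Finset.mul_prod_erase I _ haI]
      have e : ∀ i ∈ I.erase a, ((a ::ₘ s).count i).choose ((a ::ₘ τ).count i) = (s.count i).choose (τ.count i) := by
        intro i hi
        have := Finset.ne_of_mem_erase hi
        rw [Multiset.count_cons_of_ne this, Multiset.count_cons_of_ne this]
      have e' : ∀ i ∈ I.erase a, (s.count i).choose ((a ::ₘ τ).count i) = (s.count i).choose (τ.count i) := by
        intro i hi
        have := Finset.ne_of_mem_erase hi
        rw [Multiset.count_cons_of_ne this]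
      rw [Finset.prod_congr rfl e, Finset.prod_congr rfl e', Multiset.count_cons_self, Multiset.count_cons_self, Nat.choose_succ_succ]
      ring
    · have h0 : (Multiset.map (Multiset.cons a) s.powerset).count σ = 0 := by
        rw [Multiset.count_eq_zero]
        intro h
        obtain ⟨τ, _, rfl⟩ := Multiset.mem_map.1 h
        exact ha (Multiset.mem_cons_self _ _)
      rw [h0, add_zero]
      refine Finset.prod_congr rfl fun i hi => ?_
      by_cases hi' : i = a
      · subst hi'
        rw [Multiset.count_eq_zero_of_notMem ha]; simp
      · rw [Multiset.count_cons_of_ne hi']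

lemma antidiag_single (r σ : Multiset ℕ) (F : Multiset ℕ → Multiset ℕ → ℝ) :
    (r.antidiagonal.map fun p => if p.1 = σ then F p.1 p.2 else 0).sum = (r.powerset.count σ : ℝ) * F σ (r - σ) := by
  rw [← Multiset.antidiagonal_map_fst]
  have : r.antidiagonal.map (fun p => if p.1 = σ then F p.1 p.2 else 0) = (r.antidiagonal.map Prod.fst).map (fun s => if s = σ then F σ (r - σ) else 0) := by
    rw [Multiset.map_map]
    refine Multiset.map_congr rfl fun p hp => ?_
    rw [Multiset.mem_antidiagonal] at hp
    simp only [Function.comp]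
    split_ifs with h
    · rw [← h, ← hp, add_tsub_cancel_left]
    · rfl
  rw [this]
  generalize r.antidiagonal.map Prod.fst = M
  induction M using Multiset.induction_on with
  | empty => simp
  | cons a s ih =>
    rw [Multiset.map_cons, Multiset.sum_cons, ih, Multiset.count_cons]
    by_cases h : a = σ
    · simp [h]; ring
    · simp [h, Ne.symm h]

lemma Wh_enum {g h d : ℕ} {r : Multiset ℕ} (f : ℕ → Multiset ℕ → Multiset ℕ → ℝ) (S : ℕ → Finset (Multiset ℕ))
    (hS : ∀ a < d - 1, ∀ s ≤ r, HasG h (a ::ₘ s) ↔ s ∈ S a) :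
    Wh g h d r f = ∑ a ∈ Finset.range (d - 1), ∑ σ ∈ S a,
      (r.powerset.count σ : ℝ) * (tau g h (Multiset.card r) (Multiset.card σ) * f a σ (r - σ)) := by
  unfold Wh
  refine Finset.sum_congr rfl fun a ha => ?_
  rw [Finset.mem_range] at ha
  rw [Finset.sum_congr rfl fun σ _ => (antidiag_single r σ (fun s t => tau g h (Multiset.card r) (Multiset.card s) * f a s t)).symm]
  rw [← Multiset.sum_map_sum]
  congr 1
  refine Multiset.map_congr rfl fun p hp => ?_
  rw [Multiset.mem_antidiagonal] at hp
  rw [Finset.sum_ite_eq]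
  have hle : p.1 ≤ r := by rw [← hp]; exact Multiset.le_add_right _ _
  by_cases hh : HasG h (a ::ₘ p.1)
  · rw [if_pos hh, if_pos ((hS a ha _ hle).1 hh)]
  · rw [if_neg hh, if_neg (fun h' => hh ((hS a ha _ hle).2 h'))]

end Part12

section Part13

variable {C : List ℕ → ℚ}
open Ex

lemma peel {s : Multiset ℕ} {n : ℕ} (hs : Red s) (h : s.sum = n + Multiset.card s) :
    (s = 0 ∧ n = 0) ∨ ∃ v t, s = v ::ₘ t ∧ 2 ≤ v ∧ v ≤ n + 1 ∧ Red t ∧ t.sum = (n + 1 - v) + Multiset.card t := by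
  by_cases h0 : s = 0
  · left; subst h0; simp at h; exact ⟨rfl, h.symm⟩
  · right
    obtain ⟨v, hv⟩ := Multiset.exists_mem_of_ne_zero h0
    obtain ⟨t, rfl⟩ := Multiset.exists_cons_of_mem hv
    obtain ⟨h1, h2⟩ := red_cons.1 hs
    have := h2.two_mul_card_le
    simp only [Multiset.sum_cons, Multiset.card_cons] at h
    exact ⟨v, t, rfl, h1, by omega, h2, by omega⟩

lemma parts0 {s : Multiset ℕ} (hs : Red s) (h : s.sum = 0 + Multiset.card s) : s = 0 := by
  rcases peel hs h with h | ⟨v, t, rfl, h1, h2, -⟩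
  · exact h.1
  · omega

lemma parts1 {s : Multiset ℕ} (hs : Red s) (h : s.sum = 1 + Multiset.card s) : s = {2} := by
  rcases peel hs h with h | ⟨v, t, rfl, h1, h2, h3, h4⟩
  · omega
  · have : v = 2 := by omega
    subst this
    rw [parts0 h3 h4]; rfl

lemma parts2 {s : Multiset ℕ} (hs : Red s) (h : s.sum = 2 + Multiset.card s) : s = {3} ∨ s = {2, 2} := by
  rcases peel hs h with h | ⟨v, t, rfl, h1, h2, h3, h4⟩
  · omega
  · have : v = 2 ∨ v = 3 := by omega
    rcases this with rfl | rfl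
    · rw [parts1 h3 h4]; decide
    · rw [parts0 h3 h4]; decide

lemma parts3 {s : Multiset ℕ} (hs : Red s) (h : s.sum = 3 + Multiset.card s) : s = {4} ∨ s = {2, 3} ∨ s = {2, 2, 2} := by
  rcases peel hs h with h | ⟨v, t, rfl, h1, h2, h3, h4⟩
  · omega
  · have : v = 2 ∨ v = 3 ∨ v = 4 := by omega
    rcases this with rfl | rfl | rfl
    · rcases parts2 h3 h4 with h | h <;> rw [h] <;> decide
    · rw [parts1 h3 h4]; decide
    · rw [parts0 h3 h4]; decide

lemma parts4 {s : Multiset ℕ} (hs : Red s) (h : s.sum = 4 + Multiset.card s) :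
    s = {5} ∨ s = {2, 4} ∨ s = {3, 3} ∨ s = {2, 2, 3} ∨ s = {2, 2, 2, 2} := by
  rcases peel hs h with h | ⟨v, t, rfl, h1, h2, h3, h4⟩
  · omega
  · have : v = 2 ∨ v = 3 ∨ v = 4 ∨ v = 5 := by omega
    rcases this with rfl | rfl | rfl | rfl
    · rcases parts3 h3 h4 with h | h | h <;> rw [h] <;> decide
    · rcases parts2 h3 h4 with h | h <;> rw [h] <;> decide
    · rw [parts1 h3 h4]; decide
    · rw [parts0 h3 h4]; decide

def S1 (a : ℕ) : Finset (Multiset ℕ) := if a = 0 then {{2}} else if a = 1 then {0} else ∅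

def S2 (a : ℕ) : Finset (Multiset ℕ) :=
  if a = 0 then {{5}, {2, 4}, {3, 3}, {2, 2, 3}, {2, 2, 2, 2}} else if a = 1 then {{4}, {2, 3}, {2, 2, 2}}
  else if a = 2 then {{3}, {2, 2}} else if a = 3 then {{2}} else if a = 4 then {0} else ∅

lemma S1_spec {a : ℕ} {s : Multiset ℕ} (hs : Red s) : HasG 1 (a ::ₘ s) ↔ s ∈ S1 a := by
  have := hs.two_mul_card_le
  unfold S1
  constructor
  · intro h
    simp only [HasG, Multiset.sum_cons, Multiset.card_cons] at h
    have : a = 0 ∨ a = 1 := by omega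
    rcases this with rfl | rfl
    · simpa using parts1 hs (by omega)
    · simpa using parts0 hs (by omega)
  · intro h
    split_ifs at h with h0 h1
    · subst h0; simp at h; subst h; simp [HasG]
    · subst h1; simp at h; subst h; simp [HasG]
    · simp at h

lemma S2_spec {a : ℕ} {s : Multiset ℕ} (hs : Red s) : HasG 2 (a ::ₘ s) ↔ s ∈ S2 a := by
  have := hs.two_mul_card_le
  unfold S2
  constructor
  · intro h
    simp only [HasG, Multiset.sum_cons, Multiset.card_cons] at h
    have : a = 0 ∨ a = 1 ∨ a = 2 ∨ a = 3 ∨ a = 4 := by omega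
    rcases this with rfl | rfl | rfl | rfl | rfl
    · simpa using parts4 hs (by omega)
    · simpa using parts3 hs (by omega)
    · simpa using parts2 hs (by omega)
    · simpa using parts1 hs (by omega)
    · simpa using parts0 hs (by omega)
  · intro h
    split_ifs at h with h0 h1 h2 h3 h4
    · subst h0; simp at h; rcases h with rfl | rfl | rfl | rfl | rfl <;> simp [HasG]
    · subst h1; simp at h; rcases h with rfl | rfl | rfl <;> simp [HasG]
    · subst h2; simp at h; rcases h with rfl | rfl <;> simp [HasG]
    · subst h3; simp at h; subst h; simp [HasG]
    · subst h4; simp at h; subst h; simp [HasG]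
    · simp at h

lemma red_le {r s : Multiset ℕ} (hr : Red r) (h : s ≤ r) : Red s := fun v hv => hr v (Multiset.mem_of_le h hv)

lemma chx_ev {t : ℝ} {P : ℕ → ℝ} {n : Ex} {N : ℕ} (h : ev t P n = N * t) (k : ℕ) : ev t P (chx n k) = t ^ k * (N.choose k : ℝ) := by
  induction k with
  | zero => simp [chx, ev_c]
  | succ k ih =>
    simp only [chx, ev_mul, ev_add, ev_hm, ev_c, ih, h]
    have e : (N.choose (k + 1) : ℝ) * (k + 1) = N.choose k * (N - k) := by
      by_cases hk : k ≤ N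
      · have := Nat.choose_succ_right_eq N k
        rw [← Nat.cast_sub hk]; exact_mod_cast this
      · rw [Nat.choose_eq_zero_of_lt (by omega), Nat.choose_eq_zero_of_lt (by omega)]; simp
    have hk0 : (k + 1 : ℝ) ≠ 0 := by positivity
    have e' : (N.choose (k + 1) : ℝ) = N.choose k * (N - k) / (k + 1) := by rw [eq_div_iff hk0, e]
    rw [e']; push_cast; field_simp; ring

lemma gprod_ev (P : ℕ → ℝ) {X : ℕ} (k : ℕ) (hk : k < X) :
    (1 / (X : ℝ)) ^ k * ev (1 / (X : ℝ)) P (gprod k) = ((X - 1 - k).factorial : ℝ) / ((X - 1).factorial : ℝ) := by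
  induction k with
  | zero =>
    simp [gprod, ev_c]
    rw [div_self (by positivity)]
  | succ k ih =>
    have := ih (by omega)
    have hX : ((k + 1 : ℕ) : ℝ) < X := by exact_mod_cast hk
    have gm := geo_mul hX
    rw [gprod, ev_mul, ev_geo, pow_succ]
    rw [show (1 / (X : ℝ)) ^ k * (1 / (X : ℝ)) * (ev (1 / (X : ℝ)) P (gprod k) * (1 / (1 - ((k + 1 : ℕ) : ℝ) * (1 / (X : ℝ)))))
      = ((1 / (X : ℝ)) ^ k * ev (1 / (X : ℝ)) P (gprod k)) * ((1 / (X : ℝ)) * (1 / (1 - ((k + 1 : ℕ) : ℝ) * (1 / (X : ℝ))))) by ring, gm, this]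
    have e : X - 1 - k = (X - 1 - (k + 1)) + 1 := by omega
    have e2 : (X : ℝ) - ((k + 1 : ℕ) : ℝ) = ((X - 1 - (k + 1) : ℕ) : ℝ) + 1 := by
      have : X = (X - 1 - (k + 1)) + 1 + (k + 1) := by omega
      rw [eq_comm, eq_sub_iff_add_eq]; exact_mod_cast this.symm
    rw [e, Nat.factorial_succ, e2]
    push_cast
    have : ((X - 1 - (k + 1) : ℕ) : ℝ) + 1 ≠ 0 := by positivity
    field_simp

variable {g d : ℕ} {r : Multiset ℕ}

lemma tau_ev (D : Dat g d r) (P : ℕ → ℝ) {h i : ℕ} (h1 : 1 ≤ h) (hh : h + 1 ≤ g) (hi : i ≤ Multiset.card r) :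
    tau g h (Multiset.card r) i = ((2 * h - 2 + i).factorial : ℝ) / 6 * ((1 / (lv (d ::ₘ r) : ℝ)) ^ (2 * h + i) * ev (1 / (lv (d ::ₘ r) : ℝ)) P (gprod (2 * h + i))) := by
  have hl := lv_lower D.hg
  simp only [Multiset.card_cons] at hl
  rw [gprod_ev P _ (by omega)]
  unfold tau
  rw [show 2 * (g - h) - 2 + (Multiset.card r - i) = lv (d ::ₘ r) - 1 - (2 * h + i) by omega,
    show 2 * g - 2 + Multiset.card r = lv (d ::ₘ r) - 1 by omega]
  have : ((lv (d ::ₘ r) - 1).factorial : ℝ) ≠ 0 := by positivity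
  field_simp

/-- genus two term -/
lemma tx_ev (D : Dat g d r) (hg : 3 ≤ g) (q : ℚ) (σ : Multiset ℕ) (hσ : ∀ i ∈ σ, i ∈ ({2, 3, 4, 5} : Finset ℕ)) (a2 a3 a4 a5 : ℕ)
    (e2 : σ.count 2 = a2) (e3 : σ.count 3 = a3) (e4 : σ.count 4 = a4) (e5 : σ.count 5 = a5) (ec : Multiset.card σ = a2 + a3 + a4 + a5) :
    2 * ((r.powerset.count σ : ℝ) * (tau g 2 (Multiset.card r) (Multiset.card σ) * q)) =
      ev (1 / (lv (d ::ₘ r) : ℝ)) (Pd d r) (tx d q a2 a3 a4 a5) := by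
  have hc : ∀ i, 2 ≤ i → i ≤ 5 → ev (1 / (lv (d ::ₘ r) : ℝ)) (Pd d r) (Vd d i + hm (Ex.c (dr d i))) = (r.count i : ℝ) * (1 / (lv (d ::ₘ r) : ℝ)) := by
    intro i i2 i5
    rw [ev_add, D.amb.hV i i2 (by omega), ev_hm, ev_c, count_dr (r := r) (d := d) i i2]
    push_cast; ring
  have c2 := chx_ev (hc 2 (by norm_num) (by norm_num)) a2
  have c3 := chx_ev (hc 3 (by norm_num) (by norm_num)) a3
  have c4 := chx_ev (hc 4 (by norm_num) (by norm_num)) a4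
  have c5 := chx_ev (hc 5 (by norm_num) (by norm_num)) a5
  unfold tx
  simp only [ev_hm, ev_mul, ev_c] at *
  rw [c2, c3, c4, c5, count_powerset {2, 3, 4, 5} r σ hσ]
  rw [Finset.prod_insert (by decide), Finset.prod_insert (by decide), Finset.prod_insert (by decide), Finset.prod_singleton, e2, e3, e4, e5, ← ec]
  by_cases hle : Multiset.card σ ≤ Multiset.card r
  · rw [tau_ev D (Pd d r) (by norm_num) (by omega) hle]
    rw [show 2 * 2 - 2 + Multiset.card σ = 2 + Multiset.card σ by omega, show 2 * 2 + Multiset.card σ = 4 + Multiset.card σ by omega]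
    generalize ev (1 / (lv (d ::ₘ r) : ℝ)) (Pd d r) (gprod (4 + Multiset.card σ)) = G
    push_cast
    rw [pow_add, ec, pow_add, pow_add, pow_add]
    ring
  · have h0 : ((r.count 2).choose a2 : ℝ) * (((r.count 3).choose a3 : ℝ) * (((r.count 4).choose a4 : ℝ) * ((r.count 5).choose a5 : ℝ))) = 0 := by
      have := count_powerset {2, 3, 4, 5} r σ hσ
      rw [Multiset.count_eq_zero_of_notMem (by
        rw [Multiset.mem_powerset]; intro h; exact hle (Multiset.card_le_card h)),
        Finset.prod_insert (by decide), Finset.prod_insert (by decide), Finset.prod_insert (by decide), Finset.prod_singleton, e2, e3, e4, e5] at this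
      exact_mod_cast this.symm
    push_cast
    rw [h0]
    linear_combination (-(1 / (lv (d ::ₘ r) : ℝ)) ^ (4 + a2 + a3 + a4 + a5) * (2 * ((2 + Multiset.card σ).factorial : ℝ) / 6 * q) * ev (1 / (lv (d ::ₘ r) : ℝ)) (Pd d r) (gprod (4 + Multiset.card σ))) * h0

end Part13

section Part14

variable {C : List ℕ → ℚ}
open Ex

variable {g d : ℕ} {r : Multiset ℕ}

def Hb (F : Multiset ℕ → ℝ) (b : ℕ) (t : Multiset ℕ) : ℝ := if b = 0 then H1 F t else H0 F (b ::ₘ t)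

lemma cz (hmin : IsMin d r) {σ : Multiset ℕ} (v : ℕ) (hv : v ∈ σ) (hd : v < d) : (r.powerset.count σ : ℝ) = 0 := by
  rw [Multiset.count_eq_zero_of_notMem, Nat.cast_zero]
  rw [Multiset.mem_powerset]
  intro h
  have := hmin v (Multiset.mem_of_le h hv)
  omega

lemma W2_ev (hC : IsNormalizedWitten C) (D : Dat g d r) (hg : 3 ≤ g) :
    2 * Wh g 2 d r (fun a s _ => cm C (a ::ₘ s)) = ev (1 / (lv (d ::ₘ r) : ℝ)) (Pd d r) (h2x d) := by
  rw [Wh_enum _ S2 (fun a _ s hs => S2_spec (red_le D.redr hs))]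
  have hd := D.hd
  have hm := D.hmin
  have v1 : cm C (0 ::ₘ {5}) = ((385/1296 : ℚ) : ℝ) := by push_cast; exact cm_05 hC
  have v2 : cm C (0 ::ₘ {2, 4}) = ((385/1296 : ℚ) : ℝ) := by push_cast; exact cm_024 hC
  have v3 : cm C (0 ::ₘ {3, 3}) = ((7105/23328 : ℚ) : ℝ) := by push_cast; exact cm_033 hC
  have v4 : cm C (0 ::ₘ {2, 2, 3}) = ((875/2916 : ℚ) : ℝ) := by push_cast; exact cm_0223 hC
  have v5 : cm C (0 ::ₘ {2, 2, 2, 2}) = ((875/2916 : ℚ) : ℝ) := by push_cast; exact cm_02222 hC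
  have v6 : cm C (1 ::ₘ {4}) = ((35/144 : ℚ) : ℝ) := by push_cast; exact cm_14 hC
  have v7 : cm C (4 ::ₘ 0) = ((35/144 : ℚ) : ℝ) := by push_cast; exact cm_4 hC
  have t1 := tx_ev D hg (385/1296) {5} (by decide) 0 0 0 1 (by decide) (by decide) (by decide) (by decide) (by decide)
  have t2 := tx_ev D hg (385/1296) {2, 4} (by decide) 1 0 1 0 (by decide) (by decide) (by decide) (by decide) (by decide)
  have t3 := tx_ev D hg (7105/23328) {3, 3} (by decide) 0 2 0 0 (by decide) (by decide) (by decide) (by decide) (by decide)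
  have t4 := tx_ev D hg (875/2916) {2, 2, 3} (by decide) 2 1 0 0 (by decide) (by decide) (by decide) (by decide) (by decide)
  have t5 := tx_ev D hg (875/2916) {2, 2, 2, 2} (by decide) 4 0 0 0 (by decide) (by decide) (by decide) (by decide) (by decide)
  have t6 := tx_ev D hg (35/144) {4} (by decide) 0 0 1 0 (by decide) (by decide) (by decide) (by decide) (by decide)
  have t7 := tx_ev D hg (35/144) 0 (by decide) 0 0 0 0 (by decide) (by decide) (by decide) (by decide) (by decide)
  have s0 : ∀ f : Multiset ℕ → ℝ, ∑ σ ∈ S2 0, f σ = f {5} + (f {2, 4} + (f {3, 3} + (f {2, 2, 3} + f {2, 2, 2, 2}))) := by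
    intro f
    rw [show S2 0 = {{5}, {2, 4}, {3, 3}, {2, 2, 3}, {2, 2, 2, 2}} from rfl, Finset.sum_insert (by decide), Finset.sum_insert (by decide),
      Finset.sum_insert (by decide), Finset.sum_insert (by decide), Finset.sum_singleton]
  have s1 : ∀ f : Multiset ℕ → ℝ, ∑ σ ∈ S2 1, f σ = f {4} + (f {2, 3} + f {2, 2, 2}) := by
    intro f
    rw [show S2 1 = {{4}, {2, 3}, {2, 2, 2}} from rfl, Finset.sum_insert (by decide), Finset.sum_insert (by decide), Finset.sum_singleton]
  have s2 : ∀ f : Multiset ℕ → ℝ, ∑ σ ∈ S2 2, f σ = f {3} + f {2, 2} := by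
    intro f
    rw [show S2 2 = {{3}, {2, 2}} from rfl, Finset.sum_insert (by decide), Finset.sum_singleton]
  have s3 : ∀ f : Multiset ℕ → ℝ, ∑ σ ∈ S2 3, f σ = f {2} := by
    intro f
    rw [show S2 3 = {{2}} from rfl, Finset.sum_singleton]
  have s4 : ∀ f : Multiset ℕ → ℝ, ∑ σ ∈ S2 4, f σ = f 0 := by
    intro f
    rw [show S2 4 = {0} from rfl, Finset.sum_singleton]
  rcases Nat.lt_or_ge d 6 with h6 | h6
  · have : d = 2 ∨ d = 3 ∨ d = 4 ∨ d = 5 := by omega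
    rcases this with rfl | rfl | rfl | rfl
    · rw [show 2 - 1 = 1 from rfl, Finset.sum_range_one, s0, v1, v2, v3, v4, v5]
      simp only [h2x, if_true, ev_add]
      linear_combination t1 + t2 + t3 + t4 + t5
    · rw [show 3 - 1 = 2 from rfl, Finset.sum_range_succ, Finset.sum_range_one, s0, s1, v1, v3, v6]
      rw [cz hm 2 (show 2 ∈ {2, 4} by decide) (by norm_num), cz hm 2 (show 2 ∈ {2, 2, 3} by decide) (by norm_num),
        cz hm 2 (show 2 ∈ {2, 2, 2, 2} by decide) (by norm_num), cz hm 2 (show 2 ∈ {2, 3} by decide) (by norm_num),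
        cz hm 2 (show 2 ∈ {2, 2, 2} by decide) (by norm_num)]
      rw [show h2x 3 = tx 3 (385/1296) 0 0 0 1 + tx 3 (7105/23328) 0 2 0 0 + tx 3 (35/144) 0 0 1 0 from rfl]
      simp only [ev_add]
      linear_combination t1 + t3 + t6
    · rw [show 4 - 1 = 3 from rfl, Finset.sum_range_succ, Finset.sum_range_succ, Finset.sum_range_one, s0, s1, s2, v1, v6]
      rw [cz hm 2 (show 2 ∈ {2, 4} by decide) (by norm_num), cz hm 2 (show 2 ∈ {2, 2, 3} by decide) (by norm_num),
        cz hm 2 (show 2 ∈ {2, 2, 2, 2} by decide) (by norm_num), cz hm 2 (show 2 ∈ {2, 3} by decide) (by norm_num),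
        cz hm 2 (show 2 ∈ {2, 2, 2} by decide) (by norm_num), cz hm 3 (show 3 ∈ {3, 3} by decide) (by norm_num),
        cz hm 3 (show 3 ∈ {3} by decide) (by norm_num), cz hm 2 (show 2 ∈ {2, 2} by decide) (by norm_num)]
      rw [show h2x 4 = tx 4 (385/1296) 0 0 0 1 + tx 4 (35/144) 0 0 1 0 from rfl]
      simp only [ev_add]
      linear_combination t1 + t6
    · rw [show 5 - 1 = 4 from rfl, Finset.sum_range_succ, Finset.sum_range_succ, Finset.sum_range_succ, Finset.sum_range_one, s0, s1, s2, s3, v1]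
      rw [cz hm 2 (show 2 ∈ {2, 4} by decide) (by norm_num), cz hm 2 (show 2 ∈ {2, 2, 3} by decide) (by norm_num),
        cz hm 2 (show 2 ∈ {2, 2, 2, 2} by decide) (by norm_num), cz hm 2 (show 2 ∈ {2, 3} by decide) (by norm_num),
        cz hm 2 (show 2 ∈ {2, 2, 2} by decide) (by norm_num), cz hm 3 (show 3 ∈ {3, 3} by decide) (by norm_num),
        cz hm 3 (show 3 ∈ {3} by decide) (by norm_num), cz hm 2 (show 2 ∈ {2, 2} by decide) (by norm_num),
        cz hm 4 (show 4 ∈ {4} by decide) (by norm_num), cz hm 2 (show 2 ∈ {2} by decide) (by norm_num)]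
      rw [show h2x 5 = tx 5 (385/1296) 0 0 0 1 from rfl]
      linear_combination t1
  · have e : h2x d = tx d (35/144) 0 0 0 0 := by
      unfold h2x
      rw [if_neg (by omega), if_neg (by omega), if_neg (by omega), if_neg (by omega)]
    rw [e, Finset.sum_eq_single 4, s4, v7, t7]
    · intro a ha ha4
      refine Finset.sum_eq_zero fun σ hσ => ?_
      have : ∃ v ∈ σ, v < 6 := by
        unfold S2 at hσ
        split_ifs at hσ
        · simp at hσ; rcases hσ with rfl | rfl | rfl | rfl | rfl <;> simp
        · simp at hσ; rcases hσ with rfl | rfl | rfl <;> simp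
        · simp at hσ; rcases hσ with rfl | rfl <;> simp
        · simp at hσ; subst hσ; simp
        · simp at hσ
      obtain ⟨v, hv, h6'⟩ := this
      rw [cz hm v hv (by omega), zero_mul]
    · intro h
      exact absurd (Finset.mem_range.2 (by omega)) h

lemma W1_enum (hC : IsNormalizedWitten C) (D : Dat g d r) (hg : 2 ≤ g) (f : ℕ → Multiset ℕ → ℝ) :
    2 * Wh g 1 d r (fun a s t => cm C (a ::ₘ s) * f (d - 2 - a) t) =
      if d = 2 then 5 / 54 * ((1 / (lv (d ::ₘ r) : ℝ)) ^ 3 * ev (1 / (lv (d ::ₘ r) : ℝ)) (Pd d r) (gprod 3)) * ((r.count 2 : ℝ) * f 0 (r.erase 2))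
      else 1 / 18 * ((1 / (lv (d ::ₘ r) : ℝ)) ^ 2 * ev (1 / (lv (d ::ₘ r) : ℝ)) (Pd d r) (gprod 2)) * f (d - 3) r := by
  rw [Wh_enum _ S1 (fun a _ s hs => S1_spec (red_le D.redr hs))]
  have hd := D.hd
  have hm := D.hmin
  have v1 : cm C (0 ::ₘ {2}) = 5 / 18 := cm_02 hC
  have v2 : cm C (1 ::ₘ 0) = 1 / 6 := cm_one hC
  have s0 : ∀ f : Multiset ℕ → ℝ, ∑ σ ∈ S1 0, f σ = f {2} := by
    intro f
    rw [show S1 0 = {{2}} from rfl, Finset.sum_singleton]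
  have s1 : ∀ f : Multiset ℕ → ℝ, ∑ σ ∈ S1 1, f σ = f 0 := by
    intro f
    rw [show S1 1 = {0} from rfl, Finset.sum_singleton]
  by_cases h2 : d = 2
  · subst h2
    rw [if_pos rfl, show 2 - 1 = 1 from rfl, Finset.sum_range_one, s0, v1]
    have hc : r.powerset.count {2} = r.count 2 := by
      rw [count_powerset {2} r {2} (by decide)]; simp
    rw [hc]
    have hsub : r - {2} = r.erase 2 := by rw [Multiset.sub_singleton]
    rw [hsub]
    by_cases h0 : 1 ≤ Multiset.card r
    · rw [tau_ev D (Pd 2 r) (by norm_num) (by omega) (by simpa using h0)]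
      simp
      ring
    · have : r = 0 := by rw [← Multiset.card_eq_zero]; omega
      subst this; simp
  · rw [if_neg h2, Finset.sum_eq_single 1, s1, v2]
    · rw [tau_ev D (Pd d r) (by norm_num) (by omega) (by simp)]
      have : d - 2 - 1 = d - 3 := by omega
      have hc : r.powerset.count 0 = 1 := by
        rw [count_powerset ∅ r 0 (by simp)]; simp
      rw [hc, this]
      simp
      ring
    · intro a ha ha4
      refine Finset.sum_eq_zero fun σ hσ => ?_
      have : ∃ v ∈ σ, v < 3 := by
        unfold S1 at hσ
        split_ifs at hσ
        · simp at hσ; subst hσ; simp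
        · simp at hσ
      obtain ⟨v, hv, h6'⟩ := this
      rw [cz hm v hv (by omega), zero_mul]
    · intro h
      exact absurd (Finset.mem_range.2 (by omega)) h

lemma W1_ev (hC : IsNormalizedWitten C) (D : Dat g d r) (hg : 2 ≤ g) :
    2 * Wh g 1 d r (fun a s t => cm C (a ::ₘ s) * Hb R (d - 2 - a) t) = ev (1 / (lv (d ::ₘ r) : ℝ)) (Pd d r) (h1x d) := by
  rw [W1_enum hC D hg]
  have A := D.amb
  have hs := D.size
  have hd := D.hd
  have hred := D.redr
  unfold h1x Hb
  by_cases h2 : d = 2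
  · subst h2
    rw [if_pos rfl, if_pos rfl, if_pos rfl]
    simp only [ev_hm, ev_mul, ev_c, ev_add]
    have e0 : ev (1 / (lv (2 ::ₘ r) : ℝ)) (Pd 2 r) (Vd 2 2) + 1 / (lv (2 ::ₘ r) : ℝ) * ((dr 2 2 : ℚ) : ℝ) = (r.count 2 : ℝ) * (1 / (lv (2 ::ₘ r) : ℝ)) := by
      rw [A.hV 2 (by norm_num) (by norm_num), count_dr (r := r) (d := 2) 2 (by norm_num)]
      push_cast; ring
    rw [e0]
    by_cases h0 : 2 ∈ r
    · have ds := del_size h0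
      have e1 : H1 R (r.erase 2) = ev (1 / (lv (2 ::ₘ r) : ℝ)) (Pd 2 r) (R1x (Vd 2) 3 (sh (dr 2) 2 0)) := by
        apply H1_at A (by omega)
        · rw [big_of_red (hred.erase 2)]; omega
        · intro i i2 i6
          rw [big_of_red (hred.erase 2)]
          exact count_del h0 (by omega) _ _ (count_dr i i2)
      rw [e1]; push_cast; ring
    · rw [Multiset.count_eq_zero_of_notMem h0]; simp
  · rw [if_neg h2, if_neg h2]
    simp only [ev_hm, ev_mul, ev_c]
    have e1 : (if d - 3 = 0 then H1 R r else H0 R ((d - 3) ::ₘ r)) = ev (1 / (lv (d ::ₘ r) : ℝ)) (Pd d r)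
        (if d = 3 then R1x (Vd d) 2 (dr d) else if d = 4 then Rx (Vd d) 3 (dr d) else Rx (Vd d) 2 (sh (dr d) 0 (d - 3))) := by
      by_cases h3 : d = 3
      · subst h3
        rw [if_pos rfl, if_pos rfl]
        apply H1_at A (by omega)
        · rw [big_of_red hred]; omega
        · intro i i2 i6
          rw [big_of_red hred]
          exact count_dr i i2
      · rw [if_neg (by omega), if_neg h3]
        by_cases h4 : d = 4
        · subst h4
          rw [if_pos rfl]
          apply H0_at A (by omega)
          · rw [big_cons, big_of_red hred, if_neg (by norm_num)]; omega
          · intro i i2 i6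
            rw [Multiset.count_cons_of_ne (by omega)]
            exact count_dr i i2
        · rw [if_neg h4]
          apply H0_at A (by omega)
          · rw [big_cons, big_of_red hred, if_pos (by omega)]
            simp only [Multiset.sum_cons, Multiset.card_cons]; omega
          · intro i i2 i6
            exact count_ins (by omega) _ _ (count_dr i i2)
    rw [e1]; push_cast; ring

end Part14

section Part15

variable {C : List ℕ → ℚ}
open Ex

variable {g d : ℕ} {r : Multiset ℕ}

/-- main product contributions applied to the expansion -/
def PR (C : List ℕ → ℚ) (g d : ℕ) (r : Multiset ℕ) : ℝ :=
  2 * Wh g 1 d r (fun a s t => cm C (a ::ₘ s) * Hb R (d - 2 - a) t) + 2 * Wh g 2 d r (fun a s _ => cm C (a ::ₘ s))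

lemma gprod_indep (t : ℝ) (P P' : ℕ → ℝ) (k : ℕ) : ev t P (gprod k) = ev t P' (gprod k) := by
  induction k with
  | zero => rfl
  | succ k ih => simp only [gprod, ev_mul, ih, ev_geo]

def PLd (d : ℕ) (r : Multiset ℕ) (i : ℕ) : ℝ := if i = 1 then (d : ℝ) / (lv (d ::ₘ r) : ℝ) else 0

lemma Dat.ambL (D : Dat g d r) : Amb (lv (d ::ₘ r)) (fun _ => 0) VZ (PLd d r) := by
  refine ⟨fun i i2 i7 => ?_, D.hX⟩
  simp [VZ, ev_c]

lemma Dat.cr (D : Dat g d r) (hd : 13 ≤ d) {i : ℕ} (h : i ≤ 12) : (r.count i : ℝ) = 0 + (0 : ℕ → ℤ) i := by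
  rw [Multiset.count_eq_zero_of_notMem]
  · simp
  · intro h'; have := D.hmin i h'; omega

lemma Dat.boxL (D : Dat g d r) : Box (1 / (lv (d ::ₘ r) : ℝ)) (PLd d r) := by
  have hb := D.box
  refine ⟨hb.1, hb.2.1, fun i => ?_⟩
  have hX : (40 : ℝ) ≤ lv (d ::ₘ r) := by exact_mod_cast D.hX
  unfold PLd
  split_ifs
  · have h1 : d ≤ 2 * lv (d ::ₘ r) := by have := D.size; omega
    have h1' : (d : ℝ) ≤ 2 * lv (d ::ₘ r) := by exact_mod_cast h1
    rw [abs_of_nonneg (by positivity), div_le_iff₀ (by linarith)]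
    exact h1'
  · simp

lemma sum_small (φ : ℕ → ℝ) (n : ℕ) (hn : 6 ≤ n) (h : ∀ a, 6 ≤ a → φ a = 0) :
    ∑ a ∈ Finset.Ico 1 n, φ a = φ 1 + φ 2 + φ 3 + φ 4 + φ 5 := by
  rw [← Finset.sum_Ico_consecutive φ (show 1 ≤ 6 by norm_num) hn, Finset.sum_eq_zero (s := Finset.Ico 6 n)]
  · simp [Finset.sum_Ico_eq_sum_range, Finset.sum_range_succ]
  · intro a ha
    rw [Finset.mem_Ico] at ha
    exact h a ha.1

lemma sum_sym (φ : ℕ → ℝ) (n : ℕ) : ∑ a ∈ Finset.Ico 1 n, φ (n - a) = ∑ a ∈ Finset.Ico 1 n, φ a := by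
  apply Finset.sum_bij' (fun a _ => n - a) (fun a _ => n - a)
  all_goals intro a ha; simp only [Finset.mem_Ico] at *
  all_goals omega

lemma SplL (D : Dat g d r) (hd : 13 ≤ d) :
    Spl R d r = 2 * ev (1 / (lv (d ::ₘ r) : ℝ)) (PLd d r) (R1x VZ 1 0) + 2 * ev (1 / (lv (d ::ₘ r) : ℝ)) (PLd d r) (Rx VZ 2 0)
      + 2 * ev (1 / (lv (d ::ₘ r) : ℝ)) (PLd d r) (sumx ([2, 3, 4, 5].map fun a => Rx VZ 1 (sh 0 0 a)))
      + ((d : ℝ) - 13) * ev (1 / (lv (d ::ₘ r) : ℝ)) (PLd d r) (Rx VZ 1 0) := by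
  have A := D.ambL
  have hs := D.size
  have hred := D.redr
  unfold Spl
  rw [if_neg (by omega)]
  have e1 : H1 R ((d - 2) ::ₘ r) = ev (1 / (lv (d ::ₘ r) : ℝ)) (PLd d r) (R1x VZ 1 0) := by
    apply H1_at A (by omega)
    · rw [big_cons, big_of_red hred, if_pos (by omega)]
      simp only [Multiset.sum_cons, Multiset.card_cons]; omega
    · intro i i2 i6
      rw [big_count i2, Multiset.count_cons_of_ne (by omega)]
      exact D.cr hd (by omega)
  rw [e1]
  set y := ev (1 / (lv (d ::ₘ r) : ℝ)) (PLd d r) (Rx VZ 1 0) with hy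
  set u : ℕ → ℝ := fun a => if a = 1 then ev (1 / (lv (d ::ₘ r) : ℝ)) (PLd d r) (Rx VZ 2 0) - y else
    if a ≤ 5 then ev (1 / (lv (d ::ₘ r) : ℝ)) (PLd d r) (Rx VZ 1 (sh 0 0 a)) - y else 0 with hu
  have main : ∀ a b, a + b = d - 2 → 1 ≤ a → a ≤ b → H0 R (a ::ₘ b ::ₘ r) = y + u a := by
    intro a b hab ha hle
    simp only [hu]
    have hb6 : 6 ≤ b := by omega
    by_cases a1 : a = 1
    · subst a1
      rw [if_pos rfl, add_sub_cancel]
      apply H0_at A (by omega)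
      · rw [big_cons, big_cons, big_of_red hred, if_neg (by norm_num), if_pos (by omega)]
        simp only [Multiset.sum_cons, Multiset.card_cons]; omega
      · intro i i2 i5
        rw [Multiset.count_cons_of_ne (by omega), Multiset.count_cons_of_ne (by omega)]
        exact D.cr hd (by omega)
    · rw [if_neg a1]
      by_cases a5 : a ≤ 5
      · rw [if_pos a5, add_sub_cancel]
        apply H0_at A (by omega)
        · rw [big_cons, big_cons, big_of_red hred, if_pos (by omega), if_pos (by omega)]
          simp only [Multiset.sum_cons, Multiset.card_cons]; omega
        · intro i i2 i5
          apply count_ins (by omega)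
          rw [Multiset.count_cons_of_ne (by omega)]
          exact D.cr hd (by omega)
      · rw [if_neg a5, add_zero]
        apply H0_at A (by omega)
        · rw [big_cons, big_cons, big_of_red hred, if_pos (by omega), if_pos (by omega)]
          simp only [Multiset.sum_cons, Multiset.card_cons]; omega
        · intro i i2 i5
          rw [Multiset.count_cons_of_ne (by omega), Multiset.count_cons_of_ne (by omega)]
          exact D.cr hd (by omega)
  have u6 : ∀ a, 6 ≤ a → u a = 0 := by
    intro a ha
    simp only [hu]
    rw [if_neg (by omega), if_neg (by omega)]
  have all : ∀ a ∈ Finset.Ico 1 (d - 2), H0 R (a ::ₘ (d - 2 - a) ::ₘ r) = y + (u a + u (d - 2 - a)) := by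
    intro a ha
    rw [Finset.mem_Ico] at ha
    rcases Nat.le_total a (d - 2 - a) with h | h
    · rw [main a _ (by omega) ha.1 h, u6 (d - 2 - a) (by omega), add_zero]
    · rw [Multiset.cons_swap, main (d - 2 - a) a (by omega) (by omega) h, u6 a (by omega), zero_add]
  rw [Finset.sum_congr rfl all, Finset.sum_add_distrib, Finset.sum_add_distrib, sum_sym u (d - 2), sum_small u (d - 2) (by omega) u6]
  simp only [Finset.sum_const, Nat.card_Ico, nsmul_eq_mul]
  have hc : ((d - 2 - 1 : ℕ) : ℝ) = (d : ℝ) - 3 := by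
    rw [eq_sub_iff_add_eq]; exact_mod_cast (by omega : d - 2 - 1 + 3 = d)
  rw [hc]
  simp [hu, sumx, ev_add, ev_c]
  ring

lemma resL_ev (hC : IsNormalizedWitten C) (D : Dat g d r) (hd : 13 ≤ d) (hg : 3 ≤ g) :
    R (d ::ₘ r) - T R d r - PR C g d r = ev (1 / (lv (d ::ₘ r) : ℝ)) (PLd d r) resL := by
  have A := D.ambL
  have hs := D.size
  have hred := D.redr
  have e0 : R (d ::ₘ r) = ev (1 / (lv (d ::ₘ r) : ℝ)) (PLd d r) (Rx VZ 0 0) := by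
    apply R_at A (by omega)
    · simp only [Multiset.sum_cons, Multiset.card_cons]; omega
    · intro i i2 i5
      rw [Multiset.count_cons_of_ne (by omega)]
      exact D.cr hd (by omega)
  have e1 : (r.map fun v : ℕ => (2 * (v : ℝ) + 1) * R ((d + v - 1) ::ₘ r.erase v)).sum =
      (3 * (lv (d ::ₘ r) : ℝ) - (2 * d + 1)) * ev (1 / (lv (d ::ₘ r) : ℝ)) (PLd d r) (Rx VZ 1 0) := by
    rw [show (r.map fun v : ℕ => (2 * (v : ℝ) + 1) * R ((d + v - 1) ::ₘ r.erase v)) =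
      (r.map fun v : ℕ => (2 * (v : ℝ) + 1) * ev (1 / (lv (d ::ₘ r) : ℝ)) (PLd d r) (Rx VZ 1 0)) from
      Multiset.map_congr rfl fun v hv => by
        have ms := move_size hv (d + v - 1)
        have hv' := D.hmin v hv
        congr 1
        apply R_at A (by omega)
        · omega
        · intro i i2 i5
          rw [Multiset.count_cons_of_ne (by omega), Multiset.count_erase_of_ne (by omega)]
          exact D.cr hd (by omega)]
    rw [Multiset.sum_map_mul_right, sum_weights]
    congr 1
    rw [eq_sub_iff_add_eq]
    exact_mod_cast hs
  have w2 := W2_ev hC D hg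
  rw [show h2x d = tx d (35/144) 0 0 0 0 by
      unfold h2x
      rw [if_neg (by omega), if_neg (by omega), if_neg (by omega), if_neg (by omega)]] at w2
  have w1 := W1_enum hC D (by omega) (Hb R)
  rw [if_neg (by omega)] at w1
  have e3 : Hb R (d - 3) r = ev (1 / (lv (d ::ₘ r) : ℝ)) (PLd d r) (Rx VZ 2 0) := by
    unfold Hb
    rw [if_neg (by omega)]
    apply H0_at A (by omega)
    · rw [big_cons, big_of_red hred, if_pos (by omega)]
      simp only [Multiset.sum_cons, Multiset.card_cons]; omega
    · intro i i2 i5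
      rw [Multiset.count_cons_of_ne (by omega)]
      exact D.cr hd (by omega)
  unfold PR T
  rw [w1, w2, e3, e0, e1, SplL D hd]
  have hX : ((1 : ℕ) : ℝ) < (lv (d ::ₘ r) : ℝ) := by exact_mod_cast (by have := D.hX; omega)
  have gm := geo_mul hX
  have hX1 : (lv (d ::ₘ r) : ℝ) - 1 ≠ 0 := by push_cast at hX; linarith
  have hX0 : (lv (d ::ₘ r) : ℝ) ≠ 0 := by push_cast at hX; linarith
  have p1 : 1 / (3 * ((lv (d ::ₘ r) : ℝ) - 1)) = 1 / 3 * (1 / (lv (d ::ₘ r) : ℝ) * ev (1 / (lv (d ::ₘ r) : ℝ)) (PLd d r) (geo 1)) := by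
    rw [ev_geo, gm]; push_cast; field_simp
  have p2 : 2 / (3 * ((lv (d ::ₘ r) : ℝ) - 1)) = 2 / 3 * (1 / (lv (d ::ₘ r) : ℝ) * ev (1 / (lv (d ::ₘ r) : ℝ)) (PLd d r) (geo 1)) := by
    rw [ev_geo, gm]; push_cast; field_simp
  rw [p1, p2]
  have hP1 : PLd d r 1 = (d : ℝ) * (1 / (lv (d ::ₘ r) : ℝ)) := by simp [PLd]; ring
  unfold resL tx
  simp only [chx, ev_add, ev_mul, ev_c, ev_hm, ev_P, hP1]
  rw [gprod_indep _ (Pd d r) (PLd d r) 2, gprod_indep _ (Pd d r) (PLd d r) (4 + (0 + 0 + 0 + 0))]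
  have hi : (lv (d ::ₘ r) : ℝ) * (1 / (lv (d ::ₘ r) : ℝ)) = 1 := by field_simp
  generalize ev (1 / (lv (d ::ₘ r) : ℝ)) (PLd d r) (Rx VZ 0 0) = a0
  generalize ev (1 / (lv (d ::ₘ r) : ℝ)) (PLd d r) (Rx VZ 1 0) = a1
  generalize ev (1 / (lv (d ::ₘ r) : ℝ)) (PLd d r) (Rx VZ 2 0) = a2
  generalize ev (1 / (lv (d ::ₘ r) : ℝ)) (PLd d r) (R1x VZ 1 0) = a3
  generalize ev (1 / (lv (d ::ₘ r) : ℝ)) (PLd d r) (sumx ([2, 3, 4, 5].map fun a => Rx VZ 1 (sh 0 0 a))) = a4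
  generalize ev (1 / (lv (d ::ₘ r) : ℝ)) (PLd d r) (geo 1) = a5
  generalize ev (1 / (lv (d ::ₘ r) : ℝ)) (PLd d r) (gprod 2) = a6
  generalize ev (1 / (lv (d ::ₘ r) : ℝ)) (PLd d r) (gprod 4) = a7
  generalize (lv (d ::ₘ r) : ℝ) = x at *
  generalize 1 / x = t at *
  norm_num [Nat.factorial]
  linear_combination (- a5 * a1) * hi

theorem residual (hC : IsNormalizedWitten C) : ∃ K, 0 ≤ K ∧ ∀ g d r, 3 ≤ g → Dat g d r →
    |R (d ::ₘ r) - T R d r - PR C g d r| ≤ K / (lv (d ::ₘ r) : ℝ) ^ 5 := by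
  obtain ⟨K1, h1, b1⟩ := resx_bound
  obtain ⟨K2, h2, b2⟩ := resL_bound
  refine ⟨K1 + K2, by positivity, fun g d r hg D => ?_⟩
  have hp := D.box.1
  have e : (K1 + K2) / (lv (d ::ₘ r) : ℝ) ^ 5 = (K1 + K2) * (1 / (lv (d ::ₘ r) : ℝ)) ^ 5 := by
    rw [one_div, inv_pow]; rfl
  rw [e, add_mul]
  rcases Nat.lt_or_ge d 13 with hd | hd
  · have : R (d ::ₘ r) - T R d r - PR C g d r = ev (1 / (lv (d ::ₘ r) : ℝ)) (Pd d r) (resx d) := by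
      unfold PR resx
      rw [R_ev D, T_ev D, W1_ev hC D (by omega), W2_ev hC D hg]
      simp only [ev_add, ev_mul, ev_c]
      push_cast; ring
    rw [this]
    have := b1 d (Finset.mem_Icc.2 ⟨D.hd, by omega⟩) _ _ D.box
    have : 0 ≤ K2 * (1 / (lv (d ::ₘ r) : ℝ)) ^ 5 := by positivity
    linarith
  · rw [resL_ev hC D hd hg]
    have := b2 _ _ D.boxL
    have : 0 ≤ K1 * (1 / (lv (d ::ₘ r) : ℝ)) ^ 5 := by positivity
    linarith

end Part15

section Part16

variable {C : List ℕ → ℚ}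
open Ex

lemma Rv_bound : ∃ K : ℝ, 0 ≤ K ∧ ∀ x : ℝ, 1 ≤ x → ∀ p : ℕ → ℝ, (∀ i, |p i / x| ≤ 2) → |Rv x p - 1| ≤ K / x := by
  let φ : ℝ × ℝ × ℝ × ℝ × ℝ → ℝ := fun z =>
    ((-17/18 : ℝ)) + ((-5/18 : ℝ)) * z.2.1 + z.1 * (((613/648 : ℝ)) + ((35/27 : ℝ)) * z.2.2.1 + z.2.1 * (((535/324 : ℝ)) + ((1225/648 : ℝ)) * z.2.1)
    + z.1 * (((-33713/34992 : ℝ)) + ((-385/216 : ℝ)) * z.2.2.2.2 + ((-1225/216 : ℝ)) * z.2.2.2.1 + z.2.2.1 * (((-3325/1944 : ℝ)) + ((-7105/1944 : ℝ)) * z.2.2.1)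
      + z.2.1 * (((-25025/11664 : ℝ)) + ((-385/54 : ℝ)) * z.2.2.2.1 + ((-5495/243 : ℝ)) * z.2.2.1 + z.2.1 * (((595/11664 : ℝ)) + ((-4375/243 : ℝ)) * z.2.2.1
        + z.2.1 * (((-657125/34992 : ℝ)) + ((-4375/486 : ℝ)) * z.2.1)))))
  have hc : Continuous φ := by fun_prop
  have I : IsCompact (Set.Icc (-2 : ℝ) 2) := isCompact_Icc
  obtain ⟨K, hK⟩ := (I.prod (I.prod (I.prod (I.prod I)))).exists_bound_of_continuousOn hc.continuousOn
  refine ⟨|K|, abs_nonneg _, fun x hx p hp => ?_⟩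
  have e : Rv x p - 1 = 1 / x * φ (1 / x, p 2 / x, p 3 / x, p 4 / x, p 5 / x) := by
    unfold Rv Rg
    simp only [φ]
    push_cast
    ring
  have hx1 : (1 / x) ≤ 1 := by rw [div_le_one (by linarith)]; exact hx
  have hx0 : 0 ≤ 1 / x := by positivity
  rw [e, abs_mul, abs_of_nonneg hx0, div_eq_mul_one_div |K|, mul_comm |K|]
  refine mul_le_mul_of_nonneg_left ((hK _ ?_).trans (le_abs_self _)) hx0
  simp only [Set.mem_prod, Set.mem_Icc]
  exact ⟨⟨by linarith, by linarith⟩, abs_le.1 (hp 2), abs_le.1 (hp 3), abs_le.1 (hp 4), abs_le.1 (hp 5)⟩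

lemma lv_ge {g : ℕ} {m : Multiset ℕ} (hg : HasG g m) (h0 : m ≠ 0) : 2 * g ≤ lv m + 1 := by
  have := lv_lower hg
  have := Multiset.card_pos.2 h0
  omega

lemma R_near : ∃ K : ℝ, 0 ≤ K ∧ ∀ g m, 1 ≤ g → Red m → HasG g m → |R m - 1| ≤ K / (g : ℝ) := by
  obtain ⟨K, h0, hK⟩ := Rv_bound
  refine ⟨K, h0, fun g m hg hr hm => ?_⟩
  by_cases hm0 : m = 0
  · subst hm0
    have : R 0 = 1 := by simp [R, lv, Rv, Rg]
    rw [this, sub_self, abs_zero]; positivity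
  · have hX := lv_ge hm hm0
    have hX1 : g ≤ lv m := by omega
    have h1 : (1 : ℝ) ≤ lv m := by exact_mod_cast (by omega : 1 ≤ lv m)
    have hg' : (0 : ℝ) < g := by exact_mod_cast hg
    refine (hK _ h1 _ ?_).trans ?_
    · intro i
      rw [abs_of_nonneg (by positivity), div_le_iff₀ (by linarith)]
      have a1 := Multiset.count_le_card i m
      have a2 := hr.two_mul_card_le
      have a3 : m.count i ≤ 2 * lv m := by unfold lv; omega
      exact_mod_cast a3
    · gcongr


lemma msum_lin (r : Multiset ℕ) (f g k : ℕ → ℝ) (L : ℝ) (h : ∀ v ∈ r, k v = f v - L * g v) :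
    (r.map k).sum = (r.map f).sum - L * (r.map g).sum := by
  rw [Multiset.map_congr rfl h, Multiset.sum_map_sub, Multiset.sum_map_mul_left]

lemma str_lin (F G : Multiset ℕ → ℝ) (L : ℝ) (X : ℕ) (r : Multiset ℕ) :
    str (fun m => F m - L * G m) X r = str F X r - L * str G X r := by
  unfold str
  rw [msum_lin r _ _ _ L fun v _ => ?_]
  rotate_right 3
  · exact fun v : ℕ => if 1 ≤ v then (2 * (v : ℝ) + 1) * F ((v - 1) ::ₘ r.erase v) else 0
  · exact fun v : ℕ => if 1 ≤ v then (2 * (v : ℝ) + 1) * G ((v - 1) ::ₘ r.erase v) else 0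
  · split_ifs <;> ring
  · ring

lemma H1_lin (F G : Multiset ℕ → ℝ) (L : ℝ) (m : Multiset ℕ) :
    H1 (fun m => F m - L * G m) m = H1 F m - L * H1 G m := by
  unfold H1
  exact str_lin (H0 F) (H0 G) L _ _

lemma H2_lin (F G : Multiset ℕ → ℝ) (L : ℝ) (m : Multiset ℕ) :
    H2 (fun m => F m - L * G m) m = H2 F m - L * H2 G m := by
  unfold H2
  rw [← str_lin]
  congr 1
  funext m
  exact H1_lin F G L m

lemma Spl_lin (F G : Multiset ℕ → ℝ) (L : ℝ) (d : ℕ) (m : Multiset ℕ) :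
    Spl (fun m => F m - L * G m) d m = Spl F d m - L * Spl G d m := by
  unfold Spl
  split_ifs
  · exact H2_lin F G L m
  · rw [H1_lin]
    simp only [H0, Finset.sum_sub_distrib, ← Finset.mul_sum]
    ring

lemma T_lin (F G : Multiset ℕ → ℝ) (L : ℝ) (d : ℕ) (r : Multiset ℕ) :
    T (fun m => F m - L * G m) d r = T F d r - L * T G d r := by
  unfold T
  rw [Spl_lin, msum_lin r _ _ _ L fun v _ => ?_]
  rotate_right 3
  · exact fun v : ℕ => (2 * (v : ℝ) + 1) * F ((d + v - 1) ::ₘ r.erase v)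
  · exact fun v : ℕ => (2 * (v : ℝ) + 1) * G ((d + v - 1) ::ₘ r.erase v)
  · ring
  · ring

lemma Hb_lin (F G : Multiset ℕ → ℝ) (L : ℝ) (b : ℕ) (t : Multiset ℕ) :
    Hb (fun m => F m - L * G m) b t = Hb F b t - L * Hb G b t := by
  unfold Hb
  split_ifs
  · exact H1_lin F G L t
  · rfl

lemma pos_cons {b : ℕ} {t : Multiset ℕ} (hb : b ≠ 0) (ht : Red t) : ∀ v ∈ b ::ₘ t, 1 ≤ v := by
  intro v hv
  rcases Multiset.mem_cons.1 hv with h | h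
  · omega
  · have := ht v h; omega

lemma Hb_cm (hC : IsNormalizedWitten C) {γ b : ℕ} {t : Multiset ℕ} (ht : Red t) (hg : HasG γ (b ::ₘ t)) :
    cm C (b ::ₘ t) = Hb (cm C) b t := by
  unfold Hb
  split_ifs with hb
  · subst hb
    apply cm_H1 hC _ ⟨γ, hg⟩
    · rw [big_of_red ht]; rintro rfl; simp [HasG] at hg; omega
    · intro v hv; have := ht v hv; omega
  · exact cm_H0 hC _ (pos_cons hb ht)

lemma Hb_bound {F : Multiset ℕ → ℝ} {γ b : ℕ} {t : Multiset ℕ} {c B : ℝ} (hγ : 1 ≤ γ) (ht : Red t) (hg : HasG γ (b ::ₘ t)) 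
    (hF : ∀ m, Red m → HasG γ m → |F m - c| ≤ B) : |Hb F b t - c| ≤ B + 1 / γ * (|c| + B) := by
  have hγ' : (1 : ℝ) ≤ γ := by exact_mod_cast hγ
  unfold Hb
  split_ifs with hb
  · subst hb
    have t0 : t ≠ 0 := by rintro rfl; simp [HasG] at hg; omega
    have hbt := big_of_red ht
    refine H1_bound F γ (Multiset.card t) t c B (1 / γ) ?_ ?_ hg (by rw [hbt]) (fun m h1 h2 _ => hF m h1 h2) ?_
    · rwa [hbt]
    · intro v hv; have := ht v hv; omega
    · rw [hbt]
      have := lv_lower hg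
      have hc := Multiset.card_pos.2 t0
      rw [Multiset.card_cons] at this
      have hX : (2 * γ : ℝ) ≤ lv (0 ::ₘ t) := by exact_mod_cast (by omega : 2 * γ ≤ lv (0 ::ₘ t))
      rw [div_le_div_iff₀ (by linarith) (by linarith)]
      linarith
  · have h1 : HasG γ (big (b ::ₘ t)) := by
      rw [big_cons, big_of_red ht]
      split_ifs with h
      · exact hg
      · have : b = 1 := by omega
        subst this
        simp [HasG] at *; omega
    have h2 := hF _ (big_red _) h1
    have : 0 ≤ B := (abs_nonneg _).trans h2
    unfold H0
    have : 0 ≤ 1 / (γ : ℝ) * (|c| + B) := by positivity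
    linarith

lemma den_bound {g : ℝ} {ρ : ℝ} (hg : 3 ≤ g) (hρ : 0 ≤ ρ) : g ^ 2 ≤ 2 * ((2 * g - 2 + ρ) * (2 * g - 3 + ρ)) := by
  have : (2 * g - 2) * (2 * g - 3) ≤ (2 * g - 2 + ρ) * (2 * g - 3 + ρ) := by
    apply mul_le_mul <;> nlinarith
  nlinarith

lemma den_bound' {g ρ M : ℝ} (hg : 3 ≤ g) (hρ : 0 ≤ ρ) (hM : 0 ≤ M) :
    M / (6 * ((2 * g - 2 + ρ) * (2 * g - 3 + ρ))) ≤ M / (3 * g ^ 2) := by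
  apply div_le_div_of_nonneg_left hM (by positivity)
  have := den_bound hg hρ
  linarith

lemma W1_bound {g d : ℕ} {r : Multiset ℕ} {f : ℕ → Multiset ℕ → Multiset ℕ → ℝ} {M : ℝ}
    (hg : HasG g (d ::ₘ r)) (hred : Red r) (hg9 : 9 ≤ g) (hM : 0 ≤ M)
    (H : ∀ a ∈ Finset.range (d - 1), ∀ s t, s + t = r → HasG 1 (a ::ₘ s) → |f a s t| ≤ M) :
    |Wh g 1 d r f| ≤ M / (g : ℝ) ^ 2 := by
  have hg9' : (9 : ℝ) ≤ g := by exact_mod_cast hg9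
  refine (Wh_bound' hg hred le_rfl (by omega) hM 2 (Or.inl rfl) 2 (by norm_num) H).trans ?_
  have := den_bound' (g := g) (ρ := Multiset.card r) (by linarith) (by positivity) hM
  have h2 : M / (3 * (g : ℝ) ^ 2) = M / (g : ℝ) ^ 2 / 3 := by field_simp
  have h3 : 0 ≤ M / (g : ℝ) ^ 2 := by positivity
  linarith

lemma choose_two_ge {g : ℕ} (hg : 9 ≤ g) : g ^ 2 ≤ (2 * g - 4).choose 2 := by
  obtain ⟨k, rfl⟩ := Nat.exists_eq_add_of_le hg
  rw [Nat.choose_two_right, show 2 * (9 + k) - 4 = 2 * (7 + k) by omega, show 2 * (7 + k) - 1 = 13 + 2 * k by omega,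
    mul_assoc, Nat.mul_div_cancel_left _ (by norm_num)]
  nlinarith

lemma W2_bound {g d : ℕ} {r : Multiset ℕ} {f : ℕ → Multiset ℕ → Multiset ℕ → ℝ} {M : ℝ}
    (hg : HasG g (d ::ₘ r)) (hred : Red r) (hg9 : 9 ≤ g) (hM : 0 ≤ M)
    (H : ∀ a ∈ Finset.range (d - 1), ∀ s t, s + t = r → HasG 2 (a ::ₘ s) → |f a s t| ≤ M) :
    |Wh g 2 d r f| ≤ 2 * M / (g : ℝ) ^ 4 := by
  have hg9' : (9 : ℝ) ≤ g := by exact_mod_cast hg9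
  have hc : (g : ℝ) ^ 2 ≤ ((2 * g - 4).choose 2 : ℝ) := by exact_mod_cast choose_two_ge hg9
  refine (Wh_bound' hg hred (by norm_num) (by omega) hM 5 (Or.inl rfl) (5 / (g : ℝ) ^ 2) ?_ H).trans ?_
  · rw [div_mul_eq_mul_div, le_div_iff₀ (by positivity)]
    push_cast
    norm_num
    exact hc
  have := den_bound' (g := g) (ρ := Multiset.card r) (by linarith) (by positivity) hM
  calc _ ≤ 5 / (g : ℝ) ^ 2 * (M / (3 * (g : ℝ) ^ 2)) := by gcongr
    _ = 5 / 3 * M / (g : ℝ) ^ 4 := by field_simp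
    _ ≤ _ := by gcongr; norm_num

end Part16

section Part17

variable {C : List ℕ → ℚ}
open Ex

lemma hasG_one_pos {g d : ℕ} {r : Multiset ℕ} (hg : HasG g (d ::ₘ r)) (h : Red (d ::ₘ r)) : 1 ≤ g := by
  have := h.two_mul_card_le
  unfold HasG at hg; omega

theorem pass0 (hC : IsNormalizedWitten C) : ∃ L K, ∀ g m, 1 ≤ g → Red m → HasG g m → |cm C m - L| ≤ K / (g : ℝ) := by
  have := stab (D := cm C) (M := 1) (K := 2) (g₁ := 3) (j := 0) ?_ ?_
  · simpa using this
  · intro g m _ hr _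
    simpa using cm_le_one hC hr
  · intro g d r hg hr hG _
    have hg' : (3 : ℝ) ≤ g := by exact_mod_cast hg
    have hrr := (red_cons.1 hr).2
    rw [cm_T hC d r ⟨g, hG⟩ hr, add_sub_cancel_left, Prd_eq hC hG hrr]
    refine (sum_Wh_bound hG hrr zero_le_one (f := fun _ a s t => cm C (a ::ₘ s) * cm C ((d - 2 - a) ::ₘ t)) ?_).trans ?_
    · intro h a ha s t hst hh
      have hs : Red s := fun v hv => hrr v (by rw [← hst]; exact Multiset.mem_add.2 (Or.inl hv))
      have ht : Red t := fun v hv => hrr v (by rw [← hst]; exact Multiset.mem_add.2 (Or.inr hv))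
      rw [abs_mul]
      exact mul_le_one₀ (cm_cons_le_one hC hs) (abs_nonneg _) (cm_cons_le_one hC ht)
    · have := den_bound' (g := g) (ρ := Multiset.card r) (M := 1) hg' (by positivity) zero_le_one
      have h2 : 1 / (3 * (g : ℝ) ^ 2) = 1 / (g : ℝ) ^ 2 / 3 := by field_simp
      have h3 : 0 ≤ 1 / (g : ℝ) ^ 2 := by positivity
      have h4 : 2 / (g : ℝ) ^ (0 + 2) = 2 * (1 / (g : ℝ) ^ 2) := by ring
      rw [h4]; linarith

lemma Ico_split (φ : ℕ → ℝ) {g : ℕ} (hg : 9 ≤ g) :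
    ∑ h ∈ Finset.Ico 1 g, φ h = φ 1 + φ 2 + ∑ h ∈ Finset.Ico 3 (g - 2), φ h + φ (g - 2) + φ (g - 1) := by
  obtain ⟨k, rfl⟩ := Nat.exists_eq_add_of_le hg
  rw [show 9 + k - 2 = 7 + k by omega, show 9 + k - 1 = 8 + k by omega,
    show 9 + k = (7 + k) + 1 + 1 by omega, Finset.sum_Ico_succ_top (by omega), Finset.sum_Ico_succ_top (by omega),
    Finset.sum_eq_sum_Ico_succ_bot (by omega), Finset.sum_eq_sum_Ico_succ_bot (by omega), show 8 + k = 7 + k + 1 by omega]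
  ring

lemma Prd_split {g d : ℕ} {r : Multiset ℕ} (hC : IsNormalizedWitten C) (hg : HasG g (d ::ₘ r)) (hred : Red r) (hg9 : 9 ≤ g) :
    Prd C d r = 2 * Wh g 1 d r (fun a s t => cm C (a ::ₘ s) * cm C ((d - 2 - a) ::ₘ t))
      + 2 * Wh g 2 d r (fun a s t => cm C (a ::ₘ s) * cm C ((d - 2 - a) ::ₘ t))
      + ∑ h ∈ Finset.Ico 3 (g - 2), Wh g h d r (fun a s t => cm C (a ::ₘ s) * cm C ((d - 2 - a) ::ₘ t)) := by
  have sy : ∀ h, 1 ≤ h → h + 1 ≤ g → Wh g (g - h) d r (fun a s t => cm C (a ::ₘ s) * cm C ((d - 2 - a) ::ₘ t)) =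
      Wh g h d r (fun a s t => cm C (a ::ₘ s) * cm C ((d - 2 - a) ::ₘ t)) := by
    intro h h1 h2
    rw [Wh_symm hg hred h1 h2]
    apply Wh_congr
    intro a ha s t _ _
    rw [Finset.mem_range] at ha
    rw [show d - 2 - (d - 2 - a) = a by omega, mul_comm]
  rw [Prd_eq hC hg hred, Ico_split _ hg9, sy 1 (by omega) (by omega), sy 2 (by omega) (by omega)]
  ring

lemma Wh_smul (g h d : ℕ) (r : Multiset ℕ) (f : ℕ → Multiset ℕ → Multiset ℕ → ℝ) (L : ℝ) :
    L * Wh g h d r f = Wh g h d r (fun a s t => L * f a s t) := by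
  unfold Wh
  rw [Finset.mul_sum]
  refine Finset.sum_congr rfl fun a ha => ?_
  rw [← Multiset.sum_map_mul_left]
  congr 1
  refine Multiset.map_congr rfl fun p hp => ?_
  split_ifs <;> ring

lemma div_pow_shift {g k j : ℕ} {M : ℝ} (hM : 0 ≤ M) (hg : 9 ≤ g) (hk : k ≤ 2) : M / ((g - k : ℕ) : ℝ) ^ j ≤ 2 ^ j * M / (g : ℝ) ^ j := by
  have h1 : (g : ℝ) ≤ 2 * ((g - k : ℕ) : ℝ) := by exact_mod_cast (by omega : g ≤ 2 * (g - k))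
  have h0 : (0 : ℝ) < g := by exact_mod_cast (by omega : 0 < g)
  have h2 : (0 : ℝ) < ((g - k : ℕ) : ℝ) := by linarith
  rw [div_le_div_iff₀ (by positivity) (by positivity)]
  have := pow_le_pow_left₀ h0.le h1 j
  rw [mul_pow] at this
  nlinarith

theorem pass_step (hC : IsNormalizedWitten C) {L K0 M : ℝ} {j : ℕ} (hj1 : 1 ≤ j) (hj3 : j ≤ 3)
    (h0 : ∀ g m, 1 ≤ g → Red m → HasG g m → |cm C m - L| ≤ K0 / (g : ℝ))
    (h1 : ∀ g m, 1 ≤ g → Red m → HasG g m → |cm C m - L * R m| ≤ M / (g : ℝ) ^ j) :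
    ∃ M', ∀ g m, 1 ≤ g → Red m → HasG g m → |cm C m - L * R m| ≤ M' / (g : ℝ) ^ (j + 1) := by
  obtain ⟨Kr, hKr, res⟩ := residual hC
  have hK0 : 0 ≤ K0 := by
    have := (abs_nonneg _).trans (h0 1 0 le_rfl (by simp [Red]) (by simp [HasG]))
    simpa using this
  have hM : 0 ≤ M := by
    have := (abs_nonneg _).trans (h1 1 0 le_rfl (by simp [Red]) (by simp [HasG]))
    simpa using this
  have key := stab (D := fun m => cm C m - L * R m) (M := M)
    (K := 2 * (2 ^ (j + 1) * M) + 4 * (6 * K0 + 2 * |L|) + 32 + |L| * Kr) (g₁ := 40) (j := j) h1 ?_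
  · obtain ⟨L', K', hL⟩ := key
    have hL' : L' = 0 := by
      by_contra hne
      have hp : 0 < |L'| := abs_pos.2 hne
      obtain ⟨n, hn⟩ := exists_nat_gt ((|M| + |K'|) / |L'|)
      have a1 := h1 (n + 2) ((3 * (n + 2) - 2) ::ₘ 0) (by omega) (by intro v hv; simp at hv; omega) (by simp [HasG]; omega)
      have a2 := hL (n + 2) ((3 * (n + 2) - 2) ::ₘ 0) (by omega) (by intro v hv; simp at hv; omega) (by simp [HasG]; omega)
      set y := cm C ((3 * (n + 2) - 2) ::ₘ 0) - L * R ((3 * (n + 2) - 2) ::ₘ 0) with hy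
      have hn2 : (1 : ℝ) ≤ ((n + 2 : ℕ) : ℝ) := by push_cast; linarith [(Nat.cast_nonneg n : (0 : ℝ) ≤ n)]
      have b1 : M / ((n + 2 : ℕ) : ℝ) ^ j ≤ |M| / ((n + 2 : ℕ) : ℝ) := by
        apply div_le_div₀ (abs_nonneg _) (le_abs_self _) (by linarith)
        exact le_self_pow₀ hn2 (by omega)
      have b2 : K' / ((n + 2 : ℕ) : ℝ) ^ (j + 1) ≤ |K'| / ((n + 2 : ℕ) : ℝ) := by
        apply div_le_div₀ (abs_nonneg _) (le_abs_self _) (by linarith)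
        exact le_self_pow₀ hn2 (by omega)
      have c1 : |L'| ≤ |y| + |y - L'| := by
        have := abs_sub_abs_le_abs_sub y (y - L')
        have := abs_sub y (y - L')
        rw [show L' = y - (y - L') by ring]
        simpa using this
      have c2 : |L'| ≤ (|M| + |K'|) / ((n + 2 : ℕ) : ℝ) := by rw [add_div]; linarith
      rw [le_div_iff₀ (by linarith)] at c2
      rw [div_lt_iff₀ hp] at hn
      push_cast at c2
      nlinarith
    refine ⟨K', fun g m hg hr hG => ?_⟩
    simpa [hL'] using hL g m hg hr hG
  · intro g d r hg hr hG hmin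
    have hrr := (red_cons.1 hr).2
    have hg' : (40 : ℝ) ≤ g := by exact_mod_cast hg
    have hX : 2 * g ≤ lv (d ::ₘ r) + 1 := lv_ge hG (by simp)
    have D : Dat g d r := ⟨hG, hr, hmin, by omega⟩
    have hres := res g d r (by omega) D
    have hres' : |R (d ::ₘ r) - T R d r - PR C g d r| ≤ Kr / (g : ℝ) ^ 5 := by
      refine hres.trans ?_
      have : (g : ℝ) ≤ lv (d ::ₘ r) := by exact_mod_cast (by omega : g ≤ lv (d ::ₘ r))
      gcongr
    have sub : ∀ s t : Multiset ℕ, s + t = r → Red s ∧ Red t := fun s t hst =>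
      ⟨fun v hv => hrr v (by rw [← hst]; exact Multiset.mem_add.2 (Or.inl hv)),
        fun v hv => hrr v (by rw [← hst]; exact Multiset.mem_add.2 (Or.inr hv))⟩
    rw [T_lin, cm_T hC d r ⟨g, hG⟩ hr, Prd_split hC hG hrr (by omega)]
    -- first product term
    have w1 := W1_bound (f := fun a s t => cm C (a ::ₘ s) * cm C ((d - 2 - a) ::ₘ t) - L * (cm C (a ::ₘ s) * Hb R (d - 2 - a) t))
      (M := 2 ^ (j + 1) * M / (g : ℝ) ^ j) hG hrr (by omega) (by positivity) ?_
    swap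
    · intro a ha s t hst hh
      obtain ⟨hs, ht⟩ := sub s t hst
      obtain ⟨_, _, hγ, _⟩ := split_genus hG hrr ha hst hh
      have e : cm C (a ::ₘ s) * cm C ((d - 2 - a) ::ₘ t) - L * (cm C (a ::ₘ s) * Hb R (d - 2 - a) t) =
          cm C (a ::ₘ s) * Hb (fun m => cm C m - L * R m) (d - 2 - a) t := by
        rw [Hb_lin, Hb_cm hC ht hγ]; ring
      rw [e, abs_mul]
      have hb := Hb_bound (F := fun m => cm C m - L * R m) (c := 0) (B := M / ((g - 1 : ℕ) : ℝ) ^ j) (show 1 ≤ g - 1 by omega) ht hγ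
        (fun m h2 h3 => by simpa using h1 (g - 1) m (by omega) h2 h3)
      rw [sub_zero, abs_zero, zero_add] at hb
      have hsh := div_pow_shift (j := j) hM (show 9 ≤ g by omega) (show 1 ≤ 2 by norm_num)
      have hg1 : (1 : ℝ) ≤ ((g - 1 : ℕ) : ℝ) := by exact_mod_cast (by omega : 1 ≤ g - 1)
      have hle : 1 / ((g - 1 : ℕ) : ℝ) ≤ 1 := by rw [div_le_one (by linarith)]; exact hg1
      have hB : 0 ≤ M / ((g - 1 : ℕ) : ℝ) ^ j := by positivity
      calc _ ≤ 1 * |Hb (fun m => cm C m - L * R m) (d - 2 - a) t| := mul_le_mul_of_nonneg_right (cm_cons_le_one hC hs) (abs_nonneg _)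
        _ ≤ M / ((g - 1 : ℕ) : ℝ) ^ j + 1 * (M / ((g - 1 : ℕ) : ℝ) ^ j) := by
            rw [one_mul]; exact hb.trans (by gcongr)
        _ ≤ 2 * (2 ^ j * M / (g : ℝ) ^ j) := by linarith
        _ = _ := by ring
    have w2 := W2_bound (f := fun a s t => cm C (a ::ₘ s) * cm C ((d - 2 - a) ::ₘ t) - L * cm C (a ::ₘ s))
      (M := (6 * K0 + 2 * |L|) / (g : ℝ)) hG hrr (by omega) (by positivity) ?_
    swap
    · intro a ha s t hst hh
      obtain ⟨hs, ht⟩ := sub s t hst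
      obtain ⟨_, _, hγ, _⟩ := split_genus hG hrr ha hst hh
      have e : cm C (a ::ₘ s) * cm C ((d - 2 - a) ::ₘ t) - L * cm C (a ::ₘ s) =
          cm C (a ::ₘ s) * (Hb (cm C) (d - 2 - a) t - L) := by
        rw [Hb_cm hC ht hγ]; ring
      rw [e, abs_mul]
      have hb := Hb_bound (F := cm C) (c := L) (B := K0 / ((g - 2 : ℕ) : ℝ)) (show 1 ≤ g - 2 by omega) ht hγ
        (fun m h2 h3 => h0 (g - 2) m (by omega) h2 h3)
      have hsh := div_pow_shift (j := 1) hK0 (show 9 ≤ g by omega) (show 2 ≤ 2 by norm_num)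
      have hsh1 := div_pow_shift (j := 1) (abs_nonneg L) (show 9 ≤ g by omega) (show 2 ≤ 2 by norm_num)
      rw [pow_one, pow_one, pow_one] at hsh hsh1
      have hg1 : (1 : ℝ) ≤ ((g - 2 : ℕ) : ℝ) := by exact_mod_cast (by omega : 1 ≤ g - 2)
      have hle : 1 / ((g - 2 : ℕ) : ℝ) ≤ 1 := by rw [div_le_one (by linarith)]; exact hg1
      have hB : 0 ≤ K0 / ((g - 2 : ℕ) : ℝ) := by positivity
      have hfin : K0 / ((g - 2 : ℕ) : ℝ) + (|L| / ((g - 2 : ℕ) : ℝ) + 1 * (K0 / ((g - 2 : ℕ) : ℝ))) ≤ (6 * K0 + 2 * |L|) / (g : ℝ) := by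
        have e1 : (6 * K0 + 2 * |L|) / (g : ℝ) = 2 * K0 / (g : ℝ) + 2 * K0 / (g : ℝ) + 2 * K0 / (g : ℝ) + 2 * |L| / (g : ℝ) := by ring
        have : 0 ≤ 2 * K0 / (g : ℝ) := by positivity
        linarith
      calc _ ≤ 1 * |Hb (cm C) (d - 2 - a) t - L| := mul_le_mul_of_nonneg_right (cm_cons_le_one hC hs) (abs_nonneg _)
        _ ≤ K0 / ((g - 2 : ℕ) : ℝ) + 1 / ((g - 2 : ℕ) : ℝ) * (|L| + K0 / ((g - 2 : ℕ) : ℝ)) := by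
            rw [one_mul]; exact hb
        _ = K0 / ((g - 2 : ℕ) : ℝ) + (|L| / ((g - 2 : ℕ) : ℝ) + 1 / ((g - 2 : ℕ) : ℝ) * (K0 / ((g - 2 : ℕ) : ℝ))) := by ring
        _ ≤ K0 / ((g - 2 : ℕ) : ℝ) + (|L| / ((g - 2 : ℕ) : ℝ) + 1 * (K0 / ((g - 2 : ℕ) : ℝ))) := by gcongr
        _ ≤ _ := hfin
    have w3 := tail_Wh_bound (f := fun _ a s t => cm C (a ::ₘ s) * cm C ((d - 2 - a) ::ₘ t)) hG hrr zero_le_one (by omega) (by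
      intro h a ha s t hst hh
      obtain ⟨hs, ht⟩ := sub s t hst
      rw [abs_mul]
      exact mul_le_one₀ (cm_cons_le_one hC hs) (abs_nonneg _) (cm_cons_le_one hC ht))
    rw [← Wh_sub, ← Wh_smul] at w1 w2
    unfold PR at hres'
    set A1 := Wh g 1 d r (fun a s t => cm C (a ::ₘ s) * cm C ((d - 2 - a) ::ₘ t))
    set A2 := Wh g 2 d r (fun a s t => cm C (a ::ₘ s) * cm C ((d - 2 - a) ::ₘ t))
    set B1 := Wh g 1 d r (fun a s t => cm C (a ::ₘ s) * Hb R (d - 2 - a) t)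
    set B2 := Wh g 2 d r (fun a s _ => cm C (a ::ₘ s))
    set S := ∑ h ∈ Finset.Ico 3 (g - 2), Wh g h d r (fun a s t => cm C (a ::ₘ s) * cm C ((d - 2 - a) ::ₘ t))
    set ρ := R (d ::ₘ r) - T R d r - (2 * B1 + 2 * B2) with hρ
    have e : T (cm C) d r + (2 * A1 + 2 * A2 + S) - L * R (d ::ₘ r) - (T (cm C) d r - L * T R d r) =
        2 * (A1 - L * B1) + 2 * (A2 - L * B2) + S - L * ρ := by rw [hρ]; ring
    rw [e]
    have pw : ∀ k, j + 2 ≤ k → (g : ℝ) ^ (j + 2) ≤ (g : ℝ) ^ k := fun k hk => pow_le_pow_right₀ (by linarith) hk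
    have f1 : |2 * (A1 - L * B1)| ≤ 2 * (2 ^ (j + 1) * M) / (g : ℝ) ^ (j + 2) := by
      rw [abs_mul, abs_two]
      calc _ ≤ 2 * (2 ^ (j + 1) * M / (g : ℝ) ^ j / (g : ℝ) ^ 2) := by linarith
        _ = _ := by rw [pow_add (g : ℝ) j 2]; field_simp
    have f2 : |2 * (A2 - L * B2)| ≤ 4 * (6 * K0 + 2 * |L|) / (g : ℝ) ^ (j + 2) := by
      rw [abs_mul, abs_two]
      calc _ ≤ 2 * (2 * ((6 * K0 + 2 * |L|) / (g : ℝ)) / (g : ℝ) ^ 4) := by linarith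
        _ = 4 * (6 * K0 + 2 * |L|) / (g : ℝ) ^ 5 := by field_simp; ring
        _ ≤ _ := by
          have := pw 5 (by omega)
          gcongr
    have f3 : |S| ≤ 32 / (g : ℝ) ^ (j + 2) := by
      have := pw 5 (by omega)
      refine w3.trans ?_
      rw [mul_one]
      gcongr
    have f4 : |L * ρ| ≤ |L| * Kr / (g : ℝ) ^ (j + 2) := by
      have := pw 5 (by omega)
      rw [abs_mul, mul_div_assoc]
      refine mul_le_mul_of_nonneg_left (hres'.trans ?_) (abs_nonneg _)
      gcongr
    have t1 := abs_sub (2 * (A1 - L * B1) + 2 * (A2 - L * B2) + S) (L * ρ)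
    have t2 := abs_add_three (2 * (A1 - L * B1)) (2 * (A2 - L * B2)) S
    rw [add_div, add_div, add_div]
    linarith

theorem main_exp (hC : IsNormalizedWitten C) : ∃ L K0 K : ℝ, (∀ g m, 1 ≤ g → Red m → HasG g m → |cm C m - L| ≤ K0 / (g : ℝ)) ∧
    ∀ g m, 1 ≤ g → Red m → HasG g m → |cm C m - L * R m| ≤ K / (g : ℝ) ^ 4 := by
  obtain ⟨L, K0, h0⟩ := pass0 hC
  obtain ⟨KR, hKR, hR⟩ := R_near
  have h1 : ∀ g m, 1 ≤ g → Red m → HasG g m → |cm C m - L * R m| ≤ (K0 + |L| * KR) / (g : ℝ) ^ 1 := by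
    intro g m hg hr hG
    have e : cm C m - L * R m = (cm C m - L) - L * (R m - 1) := by ring
    rw [e, pow_one, add_div]
    refine (abs_sub _ _).trans ?_
    rw [abs_mul, mul_div_assoc]
    gcongr
    · exact h0 g m hg hr hG
    · exact hR g m hg hr hG
  obtain ⟨M2, h2⟩ := pass_step hC le_rfl (by norm_num) h0 h1
  obtain ⟨M3, h3⟩ := pass_step hC (by norm_num) (by norm_num) h0 h2
  obtain ⟨M4, h4⟩ := pass_step hC (by norm_num) (by norm_num) h0 h3
  exact ⟨L, K0, M4, h0, h4⟩

end Part17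

section Part18

variable {C : List ℕ → ℚ}

/-- insertion of an entry -/
def insx (e : ℕ) (F : Multiset ℕ → ℝ) : Multiset ℕ → ℝ := fun r => F (e ::ₘ r)

/-- weighted sum of `F` over all multisets of total weight `S` -/
def EW : ℕ → (Multiset ℕ → ℝ) → ℝ
  | 0, F => F 0
  | S + 1, F => 2 / ((S : ℝ) + 1) * ∑ e ∈ Finset.range (S + 1), if 2 * e ≤ S then EW (S - 2 * e) (insx e F) else 0
termination_by S => S
decreasing_by omega

/-- generating series -/
def EE (F : Multiset ℕ → ℝ) : PowerSeries ℝ := PowerSeries.mk fun S => EW S F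

def wt (m : Multiset ℕ) : ℕ := 2 * m.sum + Multiset.card m

lemma wt_cons (e : ℕ) (m : Multiset ℕ) : wt (e ::ₘ m) = 2 * e + 1 + wt m := by
  simp [wt]; ring

open PowerSeries in
lemma EW_shift (S k : ℕ) (F : Multiset ℕ → ℝ) : coeff S (X ^ k * EE F) = if k ≤ S then EW (S - k) F else 0 := by
  rw [coeff_X_pow_mul']
  simp [EE]

open PowerSeries in
lemma EW_rec {S N : ℕ} (F : Multiset ℕ → ℝ) (hN : S ≤ N) :
    (S : ℝ) * EW S F = 2 * ∑ e ∈ Finset.range N, coeff S (X ^ (2 * e + 1) * EE (insx e F)) := by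
  cases S with
  | zero =>
    rw [Finset.sum_eq_zero]
    · simp
    · intro e _
      rw [EW_shift, if_neg (by omega)]
  | succ S =>
    rw [EW]
    have hp : ((S : ℝ) + 1) ≠ 0 := by positivity
    push_cast
    rw [← mul_assoc, mul_div_cancel₀ _ hp]
    congr 1
    rw [← Finset.sum_subset (Finset.range_subset_range.2 hN)]
    · apply Finset.sum_congr rfl
      intro e _
      rw [EW_shift]
      by_cases h : 2 * e ≤ S
      · rw [if_pos h, if_pos (by omega)]
        congr 1; omega
      · rw [if_neg h, if_neg (by omega)]
    · intro e _ he
      rw [Finset.mem_range] at he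
      rw [EW_shift, if_neg (by omega)]

open PowerSeries in
lemma EW_rec' {S N : ℕ} (k : ℕ) (F : Multiset ℕ → ℝ) (hN : S ≤ N) :
    ((S : ℝ) - k) * coeff S (X ^ k * EE F) = 2 * ∑ e ∈ Finset.range N, coeff S (X ^ (k + (2 * e + 1)) * EE (insx e F)) := by
  by_cases h : k ≤ S
  · have := EW_rec (S := S - k) F (N := N) (by omega)
    rw [Nat.cast_sub h] at this
    rw [EW_shift, if_pos h, this]
    congr 1
    apply Finset.sum_congr rfl
    intro e _
    rw [EW_shift, EW_shift]
    by_cases h2 : k + (2 * e + 1) ≤ S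
    · rw [if_pos h2, if_pos (by omega)]
      congr 1; omega
    · rw [if_neg h2, if_neg (by omega)]
  · rw [EW_shift, if_neg h, mul_zero, Finset.sum_eq_zero, mul_zero]
    intro e _
    rw [EW_shift, if_neg (by omega)]

lemma EW_zero (F : Multiset ℕ → ℝ) : EW 0 F = F 0 := by rw [EW]

lemma EW_succ (S : ℕ) (F : Multiset ℕ → ℝ) :
    EW (S + 1) F = 2 / ((S : ℝ) + 1) * ∑ e ∈ Finset.range (S + 1), if 2 * e ≤ S then EW (S - 2 * e) (insx e F) else 0 := by rw [EW]

lemma wt_eq_zero {m : Multiset ℕ} (h : wt m = 0) : m = 0 := by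
  unfold wt at h
  exact Multiset.card_eq_zero.1 (by omega)

lemma EW_mono (S : ℕ) : ∀ (F G : Multiset ℕ → ℝ), (∀ m, wt m = S → |F m| ≤ G m) → |EW S F| ≤ EW S G := by
  induction S using Nat.strong_induction_on with
  | _ S ih =>
    intro F G h
    cases S with
    | zero => rw [EW_zero, EW_zero]; exact h 0 (by simp [wt])
    | succ S =>
      rw [EW_succ, EW_succ, abs_mul, abs_of_nonneg (by positivity)]
      apply mul_le_mul_of_nonneg_left _ (by positivity)
      refine (Finset.abs_sum_le_sum_abs _ _).trans (Finset.sum_le_sum fun e _ => ?_)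
      split_ifs with he
      · apply ih _ (by omega)
        intro m hm
        exact h _ (by rw [wt_cons]; omega)
      · simp

lemma EW_lin (S : ℕ) : ∀ (F G : Multiset ℕ → ℝ) (a b : ℝ), EW S (fun m => a * F m + b * G m) = a * EW S F + b * EW S G := by
  induction S using Nat.strong_induction_on with
  | _ S ih =>
    intro F G a b
    cases S with
    | zero => simp [EW_zero]
    | succ S =>
      simp only [EW_succ]
      have : ∀ e ∈ Finset.range (S + 1), (if 2 * e ≤ S then EW (S - 2 * e) (insx e fun m => a * F m + b * G m) else 0) =
          a * (if 2 * e ≤ S then EW (S - 2 * e) (insx e F) else 0) + b * (if 2 * e ≤ S then EW (S - 2 * e) (insx e G) else 0) := by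
        intro e _
        split_ifs with he
        · exact ih _ (by omega) (insx e F) (insx e G) a b
        · simp
      rw [Finset.sum_congr rfl this, Finset.sum_add_distrib, ← Finset.mul_sum, ← Finset.mul_sum]
      ring

lemma EW_congr {S : ℕ} {F G : Multiset ℕ → ℝ} (h : ∀ m, wt m = S → F m = G m) : EW S F = EW S G := by
  have h0 : EW S (fun m => F m - G m) = EW S F - EW S G := by
    have := EW_lin S F G 1 (-1)
    rw [show (fun m => F m - G m) = fun m => 1 * F m + -1 * G m by funext m; ring, this]; ring
  have h1 := EW_mono S (fun m => F m - G m) (fun _ => 0) (fun m hm => by simp [h m hm])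
  have h2 : EW S (fun _ => 0) = 0 := by
    have := EW_lin S F G 0 0
    simpa using this
  rw [h2] at h1
  have := abs_nonpos_iff.1 h1
  rw [h0] at this
  linarith

lemma EW_add (S : ℕ) (F G : Multiset ℕ → ℝ) : EW S (fun m => F m + G m) = EW S F + EW S G := by
  have := EW_lin S F G 1 1
  simpa using this

lemma EW_smul (S : ℕ) (F : Multiset ℕ → ℝ) (a : ℝ) : EW S (fun m => a * F m) = a * EW S F := by
  have := EW_lin S F F a 0
  simpa using this

lemma EW_sum (S : ℕ) {ι : Type} (s : Finset ι) (F : ι → Multiset ℕ → ℝ) : EW S (fun m => ∑ i ∈ s, F i m) = ∑ i ∈ s, EW S (F i) := by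
  classical
  induction s using Finset.induction_on with
  | empty => simpa using EW_smul S (fun _ => 0) 0
  | insert a s ha ih =>
    simp only [Finset.sum_insert ha]
    rw [EW_add, ih]

/-- marking -/
def Mk (φ : ℕ → Multiset ℕ → ℝ) (r : Multiset ℕ) : ℝ := (r.map fun v : ℕ => (2 * (v : ℝ) + 1) * φ v (r.erase v)).sum

lemma insx_Mk (e : ℕ) (φ : ℕ → Multiset ℕ → ℝ) : insx e (Mk φ) = fun r => (2 * (e : ℝ) + 1) * φ e r + Mk (fun v => insx e (φ v)) r := by
  funext r
  unfold insx Mk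
  rw [Multiset.map_cons, Multiset.sum_cons, Multiset.erase_cons_head]
  congr 2
  apply Multiset.map_congr rfl
  intro v hv
  by_cases h : v = e
  · subst h
    rw [Multiset.erase_cons_head]; beta_reduce; rw [Multiset.cons_erase hv]
  · rw [Multiset.erase_cons_tail_of_mem hv]

open PowerSeries in
lemma EW_Mk (N S : ℕ) : ∀ (φ : ℕ → Multiset ℕ → ℝ), S ≤ N → EW S (Mk φ) = 2 * ∑ v ∈ Finset.range N, coeff S (X ^ (2 * v + 1) * EE (φ v)) := by
  induction S using Nat.strong_induction_on with
  | _ S ih =>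
    intro φ hN
    by_cases hS : S = 0
    · subst hS
      rw [EW_zero, Finset.sum_eq_zero]
      · simp [Mk]
      · intro e _
        rw [EW_shift, if_neg (by omega)]
    have hS' : (S : ℝ) ≠ 0 := by exact_mod_cast hS
    apply mul_left_cancel₀ hS'
    rw [EW_rec _ hN]
    have e1 : ∀ e ∈ Finset.range N, coeff S (X ^ (2 * e + 1) * EE (insx e (Mk φ))) =
        (2 * (e : ℝ) + 1) * coeff S (X ^ (2 * e + 1) * EE (φ e)) +
          2 * ∑ v ∈ Finset.range N, coeff S (X ^ (2 * v + 1 + (2 * e + 1)) * EE (insx e (φ v))) := by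
      intro e _
      simp only [EW_shift]
      by_cases he : 2 * e + 1 ≤ S
      · rw [if_pos he, if_pos he, insx_Mk, EW_add, EW_smul, ih (S - (2 * e + 1)) (by omega) _ (by omega)]
        congr 2
        apply Finset.sum_congr rfl
        intro v _
        rw [EW_shift]
        by_cases h2 : 2 * v + 1 + (2 * e + 1) ≤ S
        · rw [if_pos h2, if_pos (by omega)]
          congr 1; omega
        · rw [if_neg h2, if_neg (by omega)]
      · rw [if_neg he, if_neg he, Finset.sum_eq_zero]
        · simp
        · intro v _
          rw [if_neg (by omega)]
    rw [Finset.sum_congr rfl e1, Finset.sum_add_distrib, ← Finset.mul_sum, Finset.sum_comm, Finset.mul_sum (a := (2 : ℝ)),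
      Finset.sum_congr rfl (fun v _ => (EW_rec' (2 * v + 1) (φ v) hN).symm), ← Finset.sum_add_distrib, mul_left_comm, Finset.mul_sum (a := (S : ℝ))]
    congr 1
    apply Finset.sum_congr rfl
    intro v _
    push_cast
    ring

/-- product -/
def Pm (F G : Multiset ℕ → ℝ) (r : Multiset ℕ) : ℝ := (r.antidiagonal.map fun p => F p.1 * G p.2).sum

lemma insx_Pm (e : ℕ) (F G : Multiset ℕ → ℝ) : insx e (Pm F G) = fun r => Pm (insx e F) G r + Pm F (insx e G) r := by
  funext r
  unfold insx Pm
  rw [Multiset.antidiagonal_cons, Multiset.map_add, Multiset.sum_add, Multiset.map_map, Multiset.map_map, add_comm]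
  rfl

open PowerSeries in
lemma EE_mul_rec {S N : ℕ} (F G : Multiset ℕ → ℝ) (hN : S ≤ N) :
    ∑ p ∈ Finset.HasAntidiagonal.antidiagonal S, ((p.1 : ℝ) * EW p.1 F) * EW p.2 G =
      2 * ∑ e ∈ Finset.range N, coeff S (X ^ (2 * e + 1) * (EE (insx e F) * EE G)) := by
  have : ∀ e ∈ Finset.range N, coeff S (X ^ (2 * e + 1) * (EE (insx e F) * EE G)) =
      ∑ p ∈ Finset.HasAntidiagonal.antidiagonal S, coeff p.1 (X ^ (2 * e + 1) * EE (insx e F)) * EW p.2 G := by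
    intro e _
    rw [← mul_assoc, coeff_mul]
    simp [EE]
  rw [Finset.sum_congr rfl this, Finset.sum_comm, Finset.mul_sum]
  apply Finset.sum_congr rfl
  intro p hp
  rw [Finset.HasAntidiagonal.mem_antidiagonal] at hp
  rw [EW_rec F (show p.1 ≤ N by omega), ← Finset.sum_mul, mul_assoc]

open PowerSeries in
lemma EW_Pm (S : ℕ) : ∀ (F G : Multiset ℕ → ℝ), EW S (Pm F G) = coeff S (EE F * EE G) := by
  induction S using Nat.strong_induction_on with
  | _ S ih =>
    intro F G
    by_cases hS : S = 0
    · subst hS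
      simp [EW_zero, Pm, EE]
    have hS' : (S : ℝ) ≠ 0 := by exact_mod_cast hS
    apply mul_left_cancel₀ hS'
    rw [EW_rec _ le_rfl]
    have e1 : ∀ e ∈ Finset.range S, coeff S (X ^ (2 * e + 1) * EE (insx e (Pm F G))) =
        coeff S (X ^ (2 * e + 1) * (EE (insx e F) * EE G)) + coeff S (X ^ (2 * e + 1) * (EE (insx e G) * EE F)) := by
      intro e _
      rw [EW_shift, coeff_X_pow_mul', coeff_X_pow_mul']
      split_ifs with he
      · rw [insx_Pm, EW_add, ih _ (by omega), ih _ (by omega), mul_comm (EE F)]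
      · simp
    have sw : ∑ p ∈ Finset.HasAntidiagonal.antidiagonal S, ((p.1 : ℝ) * EW p.1 G) * EW p.2 F =
        ∑ p ∈ Finset.HasAntidiagonal.antidiagonal S, ((p.2 : ℝ) * EW p.2 G) * EW p.1 F := by
      rw [← Finset.Nat.sum_antidiagonal_swap]; rfl
    rw [Finset.sum_congr rfl e1, Finset.sum_add_distrib, mul_add, ← EE_mul_rec F G le_rfl, ← EE_mul_rec G F le_rfl, sw, ← Finset.sum_add_distrib, coeff_mul, Finset.mul_sum]
    apply Finset.sum_congr rfl
    intro p hp
    rw [Finset.HasAntidiagonal.mem_antidiagonal] at hp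
    have : (S : ℝ) = p.1 + p.2 := by rw [← hp]; push_cast; ring
    rw [this]
    simp [EE]
    ring

lemma EW_one (S : ℕ) : EW (S + 1) (fun _ => 1) = 2 := by
  induction S using Nat.strong_induction_on with
  | _ S ih =>
    have hs : ∀ e, insx e (fun _ => (1 : ℝ)) = fun _ => 1 := fun e => rfl
    match S with
    | 0 => rw [EW_succ]; simp [EW_zero, insx]
    | 1 =>
      have := ih 0 (by norm_num)
      rw [EW_succ]
      norm_num [Finset.sum_range_succ, hs]
      exact this
    | S + 2 =>
      have a1 := ih (S + 1) (by omega)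
      have a2 := ih S (by omega)
      rw [EW_succ] at a2 ⊢
      rw [Finset.sum_range_succ'] 
      have : ∑ k ∈ Finset.range (S + 2), (if 2 * (k + 1) ≤ S + 2 then EW (S + 2 - 2 * (k + 1)) (insx (k + 1) fun _ => 1) else 0) =
          ∑ e ∈ Finset.range (S + 1), if 2 * e ≤ S then EW (S - 2 * e) (insx e fun _ => 1) else 0 := by
        rw [Finset.sum_range_succ, if_neg (by omega), add_zero]
        apply Finset.sum_congr rfl
        intro e _
        by_cases h : 2 * e ≤ S
        · rw [if_pos h, if_pos (by omega), hs, hs]; congr 1; omega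
        · rw [if_neg h, if_neg (by omega)]
      rw [this]
      simp only [mul_zero, zero_le, if_true, hs, Nat.sub_zero] at *
      rw [a1]
      have hp : (S : ℝ) + 1 ≠ 0 := by positivity
      have hp' : (S : ℝ) + 2 + 1 ≠ 0 := by positivity
      rw [div_mul_eq_mul_div, div_eq_iff hp] at a2
      push_cast
      rw [div_mul_eq_mul_div, div_eq_iff hp']
      linarith

lemma EW_two (S : ℕ) : EW (S + 1) (fun m => (2 : ℝ) ^ Multiset.card m) = 4 * (S + 1) := by
  have : (fun m : Multiset ℕ => (2 : ℝ) ^ Multiset.card m) = Pm (fun _ => 1) (fun _ => 1) := by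
    funext m
    simp [Pm, Multiset.card_antidiagonal]
  rw [this, EW_Pm, PowerSeries.coeff_mul, Finset.Nat.sum_antidiagonal_succ, Finset.Nat.sum_antidiagonal_eq_sum_range_succ_mk,
    Finset.sum_range_succ]
  have h : ∀ k ∈ Finset.range S, (PowerSeries.coeff (k + 1)) (EE fun _ => 1) * (PowerSeries.coeff (S - k)) (EE fun _ => 1) = 4 := by
    intro k hk
    rw [Finset.mem_range] at hk
    obtain ⟨j, hj⟩ : ∃ j, S - k = j + 1 := ⟨S - k - 1, by omega⟩
    rw [hj]
    simp only [EE, PowerSeries.coeff_mk, EW_one]; norm_num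
  rw [Finset.sum_congr rfl h]
  simp [EE, EW_one, EW_zero]
  ring

end Part18

section Part19

variable {C : List ℕ → ℚ}

def bm (C : List ℕ → ℚ) (m : Multiset ℕ) : ℝ := cm C m * ((lv m - 1).factorial : ℝ) / 4

/-- shifted term in the join part -/
def jn (C : List ℕ → ℚ) (d v : ℕ) : Multiset ℕ → ℝ := if 1 ≤ d + v then insx (d + v - 1) (bm C) else fun _ => 0

lemma lv_of_wt {m : Multiset ℕ} {X : ℕ} (h : wt m = 3 * X) : lv m = X := by
  unfold wt lv at *; omega

lemma wt_move {d v : ℕ} {r : Multiset ℕ} (hv : v ∈ r) (h : 1 ≤ d + v) : wt ((d + v - 1) ::ₘ r.erase v) + 3 = wt (d ::ₘ r) := by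
  have h1 := wt_cons v (r.erase v)
  rw [Multiset.cons_erase hv] at h1
  rw [wt_cons, wt_cons]; omega

lemma bm_dvv (hC : IsNormalizedWitten C) {d X : ℕ} {r : Multiset ℕ} (hw : wt (d ::ₘ r) = 3 * X) (hX : 2 ≤ X) :
    bm C (d ::ₘ r) = 1 / 3 * Mk (jn C d) r + ∑ a ∈ Finset.range (d - 1),
      (2 / 3 * insx (d - 2 - a) (insx a (bm C)) r + 2 / 3 * Pm (insx a (bm C)) (insx (d - 2 - a) (bm C)) r) := by
  have hl := lv_of_wt hw
  have hw' := hw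
  rw [wt_cons] at hw'
  have hX' : (2 : ℝ) ≤ X := by exact_mod_cast hX
  have hX1 : (X : ℝ) - 1 ≠ 0 := by linarith
  have hf : ((X - 1).factorial : ℝ) = ((X : ℝ) - 1) * ((X - 2).factorial : ℝ) := by
    obtain ⟨k, rfl⟩ := Nat.exists_eq_add_of_le hX
    rw [show 2 + k - 1 = k + 1 by omega, show 2 + k - 2 = k by omega, Nat.factorial_succ]
    push_cast; ring
  have hfp : ((X - 2).factorial : ℝ) ≠ 0 := by positivity
  have l1 : ∀ v ∈ r, 1 ≤ d + v → lv ((d + v - 1) ::ₘ r.erase v) - 1 = X - 2 := by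
    intro v hv h
    have := wt_move hv h
    have := lv_of_wt (X := X - 1) (m := (d + v - 1) ::ₘ r.erase v) (by omega)
    omega
  have l2 : ∀ a ∈ Finset.range (d - 1), lv (a ::ₘ (d - 2 - a) ::ₘ r) - 1 = X - 2 := by
    intro a ha
    rw [Finset.mem_range] at ha
    have := lv_of_wt (X := X - 1) (m := a ::ₘ (d - 2 - a) ::ₘ r) (by rw [wt_cons, wt_cons]; omega)
    omega
  by_cases hg : ∃ g, HasG g (d ::ₘ r)
  · have key := dvv_m hC d r hg (by omega)
    rw [hl] at key
    unfold bm at *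
    rw [key, hl, add_mul, add_div, Finset.sum_mul, Finset.sum_div]
    congr 1
    · rw [show Mk (jn C d) r = (r.map fun v : ℕ => ((X - 2).factorial : ℝ) / 4 * (if 1 ≤ d + v then (2 * (v : ℝ) + 1) * cm C ((d + v - 1) ::ₘ r.erase v) else 0)).sum by
        unfold Mk
        congr 1
        apply Multiset.map_congr rfl
        intro v hv
        unfold jn
        split_ifs with h
        · simp only [insx, bm]
          rw [l1 v hv h]; ring
        · simp]
      rw [Multiset.sum_map_mul_left, hf]
      field_simp
    · apply Finset.sum_congr rfl
      intro a ha
      rw [add_mul, add_div]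
      congr 1
      · simp only [insx, bm]
        rw [l2 a ha, hf]
        field_simp
      · have hq : ((X - 1).factorial : ℝ) ≠ 0 := by positivity
        rw [show (Multiset.map (fun p : Multiset ℕ × Multiset ℕ => ((lv (a ::ₘ p.1) - 1).factorial : ℝ) * ((lv ((d - 2 - a) ::ₘ p.2) - 1).factorial : ℝ) / (6 * ((X - 1).factorial : ℝ)) *
                  cm C (a ::ₘ p.1) * cm C ((d - 2 - a) ::ₘ p.2)) r.antidiagonal).sum = 16 / (6 * ((X - 1).factorial : ℝ)) * Pm (insx a (bm C)) (insx (d - 2 - a) (bm C)) r by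
          unfold Pm
          rw [← Multiset.sum_map_mul_left]
          congr 1
          apply Multiset.map_congr rfl
          intro p hp
          simp only [insx, bm]
          field_simp
          norm_num]
        change _ = 2 / 3 * Pm (insx a (bm C)) (insx (d - 2 - a) (bm C)) r
        field_simp
        ring
  · have z : cm C (d ::ₘ r) = 0 := cm_vanish hC _ hg
    have e1 : Mk (jn C d) r = 0 := by
      unfold Mk
      apply Multiset.sum_eq_zero
      intro x hx
      obtain ⟨v, hv, rfl⟩ := Multiset.mem_map.1 hx
      unfold jn
      split_ifs with h
      · simp only [insx, bm]
        rw [cm_vanish hC]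
        · simp
        · rintro ⟨γ, hγ⟩
          apply hg
          refine ⟨γ, ?_⟩
          have h1 := sum_erase' hv
          have h2 := card_erase' hv
          simp [HasG] at *
          omega
      · simp
    have e2 : ∀ a ∈ Finset.range (d - 1),
        (2 / 3 * insx (d - 2 - a) (insx a (bm C)) r + 2 / 3 * Pm (insx a (bm C)) (insx (d - 2 - a) (bm C)) r) = 0 := by
      intro a ha
      rw [Finset.mem_range] at ha
      have f1 : insx (d - 2 - a) (insx a (bm C)) r = 0 := by
        simp only [insx, bm]
        rw [cm_vanish hC]
        · simp
        · rintro ⟨γ, hγ⟩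
          apply hg
          refine ⟨γ + 1, ?_⟩
          simp [HasG] at *
          omega
      have f2 : Pm (insx a (bm C)) (insx (d - 2 - a) (bm C)) r = 0 := by
        unfold Pm
        apply Multiset.sum_eq_zero
        intro x hx
        obtain ⟨p, hp, rfl⟩ := Multiset.mem_map.1 hx
        rw [Multiset.mem_antidiagonal] at hp
        simp only [insx, bm]
        by_cases h1 : ∃ γ, HasG γ (a ::ₘ p.1)
        · by_cases h2 : ∃ γ, HasG γ ((d - 2 - a) ::ₘ p.2)
          · exfalso
            obtain ⟨γ, hγ⟩ := h1
            obtain ⟨δ, hδ⟩ := h2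
            apply hg
            refine ⟨γ + δ, ?_⟩
            rw [← hp]
            simp [HasG] at hγ hδ ⊢
            omega
          · rw [cm_vanish hC _ h2]; simp
        · rw [cm_vanish hC _ h1]; simp
      rw [f1, f2]; ring
    rw [e1, Finset.sum_eq_zero e2]
    simp [bm, z]

end Part19

section Part20

variable {C : List ℕ → ℚ}

lemma tri_sum (M : ℕ) (h : ℕ → ℕ → ℝ) (hz : ∀ a b, M ≤ a + b → h a b = 0) :
    ∑ d ∈ Finset.range M, ∑ v ∈ Finset.range M, h d v = ∑ s ∈ Finset.range M, ∑ a ∈ Finset.range (s + 1), h a (s - a) := by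
  rw [Finset.sum_range_diag_flip]
  apply Finset.sum_congr rfl
  intro d hd
  rw [Finset.mem_range] at hd
  symm
  apply Finset.sum_subset (Finset.range_subset_range.2 (by omega))
  intro v _ hv
  rw [Finset.mem_range] at hv
  exact hz _ _ (by omega)

lemma tri_sum2 (M : ℕ) (h : ℕ → ℕ → ℝ) (hz : ∀ a b, M ≤ a + b → h a b = 0) :
    ∑ d ∈ Finset.range (M + 2), ∑ a ∈ Finset.range (d - 1), h a (d - 2 - a) = ∑ d ∈ Finset.range M, ∑ v ∈ Finset.range M, h d v := by
  rw [tri_sum M h hz, Finset.sum_range_succ', Finset.sum_range_succ']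
  simp

open PowerSeries

lemma sum_jn (S M : ℕ) (hM : S ≤ M) :
    ∑ d ∈ Finset.range (M + 2), ∑ v ∈ Finset.range (M + 2), coeff S (X ^ (2 * d + 1 + (2 * v + 1)) * EE (jn C d v)) =
      ∑ w ∈ Finset.range M, ((w : ℝ) + 2) * coeff S (X ^ (2 * w + 4) * EE (insx w (bm C))) := by
  rw [tri_sum]
  · rw [Finset.sum_range_succ', Finset.sum_range_succ]
    have h0 : ∑ a ∈ Finset.range (0 + 1), coeff S (X ^ (2 * a + 1 + (2 * (0 - a) + 1)) * EE (jn C a (0 - a))) = 0 := by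
      simp only [zero_add, Finset.sum_range_one]
      rw [EW_shift]
      have : jn C 0 (0 - 0) = fun _ => 0 * 0 := by simp [jn]
      rw [this, EW_smul]
      simp
    have h1 : ∑ a ∈ Finset.range (M + 1 + 1), coeff S (X ^ (2 * a + 1 + (2 * (M + 1 - a) + 1)) * EE (jn C a (M + 1 - a))) = 0 := by
      apply Finset.sum_eq_zero
      intro a ha
      rw [Finset.mem_range] at ha
      rw [EW_shift, if_neg (by omega)]
    rw [h0, h1, add_zero, add_zero]
    apply Finset.sum_congr rfl
    intro w _
    rw [Finset.sum_congr rfl (g := fun _ => coeff S (X ^ (2 * w + 4) * EE (insx w (bm C))))]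
    · simp; left; ring
    · intro a ha
      rw [Finset.mem_range] at ha
      have : jn C a (w + 1 - a) = insx w (bm C) := by
        unfold jn
        rw [if_pos (by omega)]
        congr 1; omega
      rw [this, show 2 * a + 1 + (2 * (w + 1 - a) + 1) = 2 * w + 4 by omega]
  · intro a b hab
    rw [EW_shift, if_neg (by omega)]

lemma bm_step (hC : IsNormalizedWitten C) {x : ℕ} (hx : 2 ≤ x) (N d : ℕ) (hN : 3 * x ≤ N) :
    coeff (3 * x) (X ^ (2 * d + 1) * EE (insx d (bm C))) =
      2 / 3 * ∑ v ∈ Finset.range N, coeff (3 * x) (X ^ (2 * d + 1 + (2 * v + 1)) * EE (jn C d v)) +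
      ∑ a ∈ Finset.range (d - 1), (2 / 3 * coeff (3 * x) (X ^ (2 * (a + (d - 2 - a)) + 5) * EE (insx (d - 2 - a) (insx a (bm C)))) +
        2 / 3 * coeff (3 * x) (X ^ (2 * (a + (d - 2 - a)) + 5) * (EE (insx a (bm C)) * EE (insx (d - 2 - a) (bm C))))) := by
  have hd : ∀ a ∈ Finset.range (d - 1), 2 * (a + (d - 2 - a)) + 5 = 2 * d + 1 := by
    intro a ha
    rw [Finset.mem_range] at ha; omega
  by_cases h : 2 * d + 1 ≤ 3 * x
  · rw [EW_shift, if_pos h, EW_congr (G := fun r => 1 / 3 * Mk (jn C d) r + 1 * ∑ a ∈ Finset.range (d - 1),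
      (2 / 3 * insx (d - 2 - a) (insx a (bm C)) r + 2 / 3 * Pm (insx a (bm C)) (insx (d - 2 - a) (bm C)) r)), EW_lin, EW_sum, EW_Mk N _ _ (by omega)]
    · rw [one_mul]
      congr 1
      · rw [← mul_assoc, Finset.mul_sum, Finset.mul_sum]
        apply Finset.sum_congr rfl
        intro v _
        rw [EW_shift, EW_shift]
        by_cases h2 : 2 * v + 1 ≤ 3 * x - (2 * d + 1)
        · rw [if_pos h2, if_pos (by omega), show 3 * x - (2 * d + 1) - (2 * v + 1) = 3 * x - (2 * d + 1 + (2 * v + 1)) by omega]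
          ring
        · rw [if_neg h2, if_neg (by omega)]; ring
      · apply Finset.sum_congr rfl
        intro a ha
        rw [EW_lin, EW_Pm, hd a ha, EW_shift, if_pos h, coeff_X_pow_mul', if_pos h]
    · intro r hr
      have := bm_dvv hC (d := d) (X := x) (r := r) (by rw [wt_cons]; omega) hx
      rw [one_mul]
      exact this
  · rw [EW_shift, if_neg h, Finset.sum_eq_zero, Finset.sum_eq_zero]
    · simp
    · intro a ha
      rw [hd a ha, EW_shift, if_neg h, coeff_X_pow_mul', if_neg h]; simp
    · intro v _
      rw [EW_shift, if_neg (by omega)]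

lemma EW_bm_rec (hC : IsNormalizedWitten C) {x : ℕ} (hx : 2 ≤ x) :
    (3 * x : ℝ) / 2 * EW (3 * x) (bm C) = (x : ℝ) * ((3 * x - 3) / 2) * EW (3 * x - 3) (bm C) +
      2 / 3 * ∑ p ∈ Finset.HasAntidiagonal.antidiagonal (3 * x - 3), ((p.1 : ℝ) / 2 * EW p.1 (bm C)) * ((p.2 : ℝ) / 2 * EW p.2 (bm C)) := by
  set M := 3 * x with hM
  have e0 := EW_rec (S := M) (bm C) (N := M + 2) (by omega)
  have e1 : ∑ d ∈ Finset.range (M + 2), coeff M (X ^ (2 * d + 1) * EE (insx d (bm C))) = _ :=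
    Finset.sum_congr rfl fun d _ => bm_step hC hx (M + 2) d (by omega)
  rw [Finset.sum_add_distrib, ← Finset.mul_sum, ← hM, sum_jn M M le_rfl,
    tri_sum2 M (fun a b => 2 / 3 * coeff M (X ^ (2 * (a + b) + 5) * EE (insx b (insx a (bm C)))) +
        2 / 3 * coeff M (X ^ (2 * (a + b) + 5) * (EE (insx a (bm C)) * EE (insx b (bm C)))))] at e1
  swap
  · intro a b hab
    rw [EW_shift, if_neg (by omega), coeff_X_pow_mul', if_neg (by omega)]; simp
  simp only [Finset.sum_add_distrib, ← Finset.mul_sum] at e1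
  have e2 : ∑ a ∈ Finset.range M, ∑ b ∈ Finset.range M, coeff M (X ^ (2 * (a + b) + 5) * EE (insx b (insx a (bm C)))) =
      ∑ a ∈ Finset.range M, ((M : ℝ) - (2 * a + 4)) / 2 * coeff M (X ^ (2 * a + 4) * EE (insx a (bm C))) := by
    apply Finset.sum_congr rfl
    intro a _
    have := EW_rec' (S := M) (N := M) (2 * a + 4) (insx a (bm C)) le_rfl
    push_cast at this
    rw [div_mul_eq_mul_div, this, mul_div_cancel_left₀ _ (two_ne_zero)]
    apply Finset.sum_congr rfl
    intro b _
    rw [show 2 * (a + b) + 5 = 2 * a + 4 + (2 * b + 1) by ring]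
  have e3 : ∑ a ∈ Finset.range M, coeff M (X ^ (2 * a + 4) * EE (insx a (bm C))) = ((M : ℝ) - 3) / 2 * EW (M - 3) (bm C) := by
    have := EW_rec' (S := M) (N := M) 3 (bm C) le_rfl
    rw [EW_shift, if_pos (by omega)] at this
    push_cast at this
    rw [div_mul_eq_mul_div, this, mul_div_cancel_left₀ _ (two_ne_zero)]
    apply Finset.sum_congr rfl
    intro b _
    rw [show 2 * b + 4 = 3 + (2 * b + 1) by ring]
  set P : PowerSeries ℝ := ∑ a ∈ Finset.range M, X ^ (2 * a + 1) * EE (insx a (bm C)) with hP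
  have e4 : ∑ a ∈ Finset.range M, ∑ b ∈ Finset.range M, coeff M (X ^ (2 * (a + b) + 5) * (EE (insx a (bm C)) * EE (insx b (bm C)))) =
      coeff (M - 3) (P * P) := by
    have : coeff M (X ^ 3 * (P * P)) = coeff (M - 3) (P * P) := by rw [coeff_X_pow_mul', if_pos (by omega)]
    rw [← this, hP, Finset.sum_mul_sum, Finset.mul_sum, map_sum]
    apply Finset.sum_congr rfl
    intro a _
    rw [Finset.mul_sum, map_sum]
    apply Finset.sum_congr rfl
    intro b _
    congr 1
    ring
  have e5 : ∀ k ≤ M, coeff k P = (k : ℝ) / 2 * EW k (bm C) := by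
    intro k hk
    rw [hP, map_sum]
    have := EW_rec (S := k) (N := M) (bm C) hk
    rw [div_mul_eq_mul_div, this, mul_div_cancel_left₀ _ (two_ne_zero)]
  have e7 : ∀ p ∈ Finset.HasAntidiagonal.antidiagonal (M - 3), coeff p.1 P * coeff p.2 P =
      ((p.1 : ℝ) / 2 * EW p.1 (bm C)) * ((p.2 : ℝ) / 2 * EW p.2 (bm C)) := by
    intro p hp
    rw [Finset.HasAntidiagonal.mem_antidiagonal] at hp
    rw [e5 p.1 (by omega), e5 p.2 (by omega)]
  rw [coeff_mul, Finset.sum_congr rfl e7] at e4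
  rw [e2, e4] at e1
  rw [e1] at e0
  have e6 : ∑ w ∈ Finset.range M, ((w : ℝ) + 2) * coeff M (X ^ (2 * w + 4) * EE (insx w (bm C))) +
     ∑ a ∈ Finset.range M, ((M : ℝ) - (2 * a + 4)) / 2 * coeff M (X ^ (2 * a + 4) * EE (insx a (bm C))) = (M : ℝ) / 2 * (((M : ℝ) - 3) / 2 * EW (M - 3) (bm C)) := by
    rw [← e3, ← Finset.sum_add_distrib, Finset.mul_sum]
    apply Finset.sum_congr rfl
    intro a _
    ring
  have hMr : (M : ℝ) = 3 * x := by rw [hM]; push_cast; ring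
  rw [hMr] at e0 e6
  linear_combination e0 / 2 + 2 / 3 * e6


lemma EW_bm_zero (hC : IsNormalizedWitten C) {S : ℕ} (hS : ¬ 3 ∣ S) : EW S (bm C) = 0 := by
  rw [EW_congr (G := fun _ => 0 * 0), EW_smul]
  · simp
  · intro m hm
    unfold bm
    rw [cm_vanish hC]
    · simp
    · rintro ⟨g, hg⟩
      unfold HasG at hg
      unfold wt at hm
      omega

def yy (C : List ℕ → ℚ) (x : ℕ) : ℝ := (x : ℝ) * EW (3 * x) (bm C)

lemma yy_zero : yy C 0 = 0 := by simp [yy]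

lemma yy_one (hC : IsNormalizedWitten C) : yy C 1 = 5 / 36 := by
  have h1 : bm C {1} = 1 / 24 := by
    unfold bm
    rw [cm_one hC, show lv {1} = 1 by decide]
    norm_num
  have h3 : bm C {0, 0, 0} = 1 / 12 := by
    unfold bm
    rw [cm_three hC, show lv {0, 0, 0} = 1 by decide]
    norm_num
  unfold yy
  simp only [mul_one, Nat.cast_one, one_mul]
  have e3 := EW_succ 2 (bm C)
  have e2 := EW_succ 1 (insx 0 (bm C))
  have e1 := EW_succ 0 (insx 0 (insx 0 (bm C)))
  simp only [Finset.sum_range_succ, Finset.sum_range_zero] at e1 e2 e3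
  norm_num at e1 e2 e3
  rw [EW_zero] at e1 e3
  rw [e3, e2, e1]
  have a1 : insx 1 (bm C) 0 = 1 / 24 := h1
  have a2 : insx 0 (insx 0 (insx 0 (bm C))) 0 = 1 / 12 := h3
  rw [a1, a2]
  norm_num

lemma sum_antidiag_three (n : ℕ) (f : ℕ → ℕ → ℝ) (hf : ∀ i j, ¬ 3 ∣ i → f i j = 0) :
    ∑ p ∈ Finset.HasAntidiagonal.antidiagonal (3 * n), f p.1 p.2 = ∑ p ∈ Finset.HasAntidiagonal.antidiagonal n, f (3 * p.1) (3 * p.2) := by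
  symm
  have := Finset.sum_image (s := Finset.HasAntidiagonal.antidiagonal n) (f := fun p : ℕ × ℕ => f p.1 p.2) (g := fun p : ℕ × ℕ => (3 * p.1, 3 * p.2))
    (by rintro ⟨a, b⟩ _ ⟨c, d⟩ _ h; simp at h ⊢; omega)
  simp only at this
  rw [← this]
  apply Finset.sum_subset
  · rintro ⟨a, b⟩ h
    simp only [Finset.mem_image, Finset.HasAntidiagonal.mem_antidiagonal, Prod.exists, Prod.mk.injEq] at h ⊢
    omega
  · rintro ⟨a, b⟩ h1 h2
    apply hf
    rintro ⟨k, rfl⟩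
    apply h2
    simp only [Finset.mem_image, Finset.HasAntidiagonal.mem_antidiagonal, Prod.exists, Prod.mk.injEq] at h1 ⊢
    exact ⟨k, n - k, by omega, by omega, by omega⟩

lemma yy_rec (hC : IsNormalizedWitten C) (n : ℕ) (hn : 1 ≤ n) :
    yy C (n + 1) = ((n : ℝ) + 1) * yy C n + ∑ p ∈ Finset.HasAntidiagonal.antidiagonal n, yy C p.1 * yy C p.2 := by
  have h := EW_bm_rec hC (x := n + 1) (by omega)
  rw [show 3 * (n + 1) - 3 = 3 * n by omega, sum_antidiag_three n (fun i j => ((i : ℝ) / 2 * EW i (bm C)) * ((j : ℝ) / 2 * EW j (bm C)))] at h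
  · have e : ∑ p ∈ Finset.HasAntidiagonal.antidiagonal n, (((3 * p.1 : ℕ) : ℝ) / 2 * EW (3 * p.1) (bm C)) * (((3 * p.2 : ℕ) : ℝ) / 2 * EW (3 * p.2) (bm C)) =
        9 / 4 * ∑ p ∈ Finset.HasAntidiagonal.antidiagonal n, yy C p.1 * yy C p.2 := by
      rw [Finset.mul_sum]
      apply Finset.sum_congr rfl
      intro p _
      unfold yy
      push_cast
      ring
    rw [e] at h
    have : yy C (n + 1) = ((n : ℝ) + 1) * EW (3 * (n + 1)) (bm C) := by unfold yy; push_cast; ring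
    rw [this, show yy C n = n * EW (3 * n) (bm C) from rfl]
    push_cast at h
    linear_combination 2 / 3 * h
  · intro i j hi
    rw [EW_bm_zero hC hi]; ring

end Part20

section Part21

variable {C : List ℕ → ℚ}

lemma wsum0_bound (r : Multiset ℕ) (f : ℕ → ℝ) (c B : ℝ) (hB : 0 ≤ B) (h : ∀ v ∈ r, 1 ≤ v → |f v - c| ≤ B) :
    |(r.map fun v : ℕ => if 1 ≤ v then (2 * (v : ℝ) + 1) * f v else 0).sum - ((wt r : ℝ) - (r.count 0 : ℝ)) * c| ≤ (wt r : ℝ) * B := by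
  induction r using Multiset.induction_on with
  | empty => simp [wt]
  | cons a s ih =>
    have ih := ih (fun v hv => h v (Multiset.mem_cons_of_mem hv))
    have ha := h a (Multiset.mem_cons_self a s)
    rw [Multiset.map_cons, Multiset.sum_cons, wt_cons]
    push_cast
    by_cases h1 : 1 ≤ a
    · have ha := ha h1
      rw [if_pos h1, Multiset.count_cons_of_ne (by omega)]
      have e : |(2 * (a : ℝ) + 1) * (f a - c)| ≤ (2 * (a : ℝ) + 1) * B := by
        rw [abs_mul, abs_of_nonneg (by positivity)]
        exact mul_le_mul_of_nonneg_left ha (by positivity)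
      rw [abs_le] at *
      constructor <;> nlinarith
    · have : a = 0 := by omega
      subst this
      rw [if_neg h1, Multiset.count_cons_self]
      push_cast
      rw [abs_le] at *
      constructor <;> nlinarith

lemma red_or (m : Multiset ℕ) : Red m ∨ (∃ r, m = 1 ::ₘ r) ∨ ∃ r, m = 0 ::ₘ r := by
  by_cases h : Red m
  · exact Or.inl h
  right
  unfold Red at h
  push Not at h
  obtain ⟨v, hv, hlt⟩ := h
  obtain ⟨r, rfl⟩ := Multiset.exists_cons_of_mem hv
  have : v = 0 ∨ v = 1 := by omega
  rcases this with rfl | rfl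
  · exact Or.inr ⟨r, rfl⟩
  · exact Or.inl ⟨r, rfl⟩

lemma cm_crude (hC : IsNormalizedWitten C) (x : ℕ) : ∀ m, wt m = 3 * x → |cm C m| ≤ 2 ^ x := by
  induction x with
  | zero =>
    intro m hm
    rw [wt_eq_zero (by omega : wt m = 0), cm_zero]
    norm_num [abs_of_pos]
  | succ x ih =>
    intro m hm
    have hp : (1 : ℝ) ≤ 2 ^ x := one_le_pow₀ (by norm_num)
    rcases red_or m with h | ⟨r, rfl⟩ | ⟨r, rfl⟩
    · refine (cm_le_one hC h).trans ?_
      rw [pow_succ]; linarith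
    · rw [wt_cons] at hm
      rw [cm_dil hC]
      · refine (ih r (by omega)).trans ?_
        rw [pow_succ]; linarith
      · have := lv_of_wt (m := r) (X := x) (by omega)
        rcases Nat.eq_zero_or_pos x with h0 | h0
        · right; exact wt_eq_zero (by omega)
        · left; omega
    · by_cases hg : ∃ g, HasG g (0 ::ₘ r)
      swap
      · rw [cm_vanish hC _ hg]; simp
      have hl := lv_of_wt hm
      have hm' := hm
      rw [wt_cons] at hm'
      rcases Nat.eq_zero_or_pos x with h0 | h0
      · subst h0
        have : r = {0, 0} := by
          have hc : Multiset.card r = 2 := by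
            have h00 : Multiset.card r = 0 → r.sum = 0 := fun h => by rw [Multiset.card_eq_zero.1 h]; rfl
            unfold wt at hm'
            omega
          have hs : r.sum = 0 := by unfold wt at hm'; omega
          obtain ⟨a, b, rfl⟩ := Multiset.card_eq_two.1 hc
          simp at hs
          rw [hs.1, hs.2]
        subst this
        have := cm_three hC
        rw [show (0 ::ₘ ({0, 0} : Multiset ℕ)) = {0, 0, 0} from rfl, this]
        norm_num [abs_of_pos]
      · rw [cm_str hC r hg (by omega), hl]
        unfold str
        have hb := wsum0_bound r (fun v => cm C ((v - 1) ::ₘ r.erase v)) 0 (2 ^ x) (by positivity) (by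
          intro v hv h1
          rw [sub_zero]
          apply ih
          have := wt_move (d := 0) hv (by omega)
          rw [zero_add] at this
          omega)
        rw [mul_zero, sub_zero] at hb
        have hx : (1 : ℝ) ≤ x := by exact_mod_cast h0
        have hw : (wt r : ℝ) = 3 * x + 2 := by
          have : wt r = 3 * x + 2 := by omega
          rw [this]; push_cast; ring
        rw [abs_mul, abs_of_nonneg (by push_cast; rw [add_sub_cancel_right]; positivity)]
        push_cast
        rw [add_sub_cancel_right, one_div_mul_eq_div, div_le_iff₀ (by positivity)]
        refine hb.trans ?_
        rw [hw, pow_succ]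
        nlinarith

lemma cm_all (hC : IsNormalizedWitten C) {L K0 : ℝ} (h0 : ∀ g m, 1 ≤ g → Red m → HasG g m → |cm C m - L| ≤ K0 / (g : ℝ)) :
    ∃ K : ℝ, 0 ≤ K ∧ ∀ x m, wt m = 3 * x → |cm C m - L| ≤ K * (3 / 2) ^ (Multiset.card m) / ((x : ℝ) + 20) := by
  refine ⟨20 * |K0| + 30 * (1024 + |L|), by positivity, ?_⟩
  set K := 20 * |K0| + 30 * (1024 + |L|) with hK
  have hK0 : 0 ≤ K := by positivity
  have a0 := abs_nonneg K0
  have aL := abs_nonneg L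
  have bern : ∀ n : ℕ, 1 + (n : ℝ) / 2 ≤ (3 / 2 : ℝ) ^ n := by
    intro n
    have := one_add_mul_le_pow (a := (1 / 2 : ℝ)) (by norm_num) n
    norm_num at this
    linarith
  intro x
  induction x with
  | zero =>
    intro m hm
    have h1 := cm_crude hC 0 m hm
    rw [wt_eq_zero (by omega : wt m = 0)] at *
    rw [Multiset.card_zero, pow_zero, mul_one, le_div_iff₀ (by positivity)]
    have := abs_sub (cm C 0) L
    norm_num at h1 ⊢
    linarith
  | succ x ih =>
    intro m hm
    have hbm := bern (Multiset.card m)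
    set n := Multiset.card m with hn
    have hpos : (0 : ℝ) < (3 / 2 : ℝ) ^ n := by positivity
    have hn0 : (0 : ℝ) ≤ n := by positivity
    by_cases hx : x < 9
    · have h1 := cm_crude hC _ m hm
      have h2 : (2 : ℝ) ^ (x + 1) ≤ 1024 := by
        have : (2 : ℝ) ^ (x + 1) ≤ 2 ^ 10 := pow_le_pow_right₀ (by norm_num) (by omega)
        norm_num at this ⊢; linarith
      have h3 := abs_sub (cm C m) L
      have hx' : (x : ℝ) ≤ 9 := by exact_mod_cast hx.le
      rw [le_div_iff₀ (by positivity)]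
      have h4 : |cm C m - L| * (((x + 1 : ℕ) : ℝ) + 20) ≤ (1024 + |L|) * 30 := by
        push_cast
        apply mul_le_mul _ (by linarith) (by positivity) (by positivity)
        linarith
      have h5 : K * 1 ≤ K * (3 / 2) ^ n := mul_le_mul_of_nonneg_left (by linarith) hK0
      linarith
    by_cases hg : ∃ g, HasG g m
    swap
    · rw [cm_vanish hC m hg, zero_sub, abs_neg, le_div_iff₀ (by positivity)]
      have hxn : x + 1 ≤ n := by
        by_contra hlt
        apply hg
        unfold wt at hm
        refine ⟨(m.sum + 3 - n) / 3, ?_⟩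
        unfold HasG
        omega
      have hxn' : ((x + 1 : ℕ) : ℝ) ≤ n := by exact_mod_cast hxn
      have h5 : K * (1 + (n : ℝ) / 2) ≤ K * (3 / 2) ^ n := mul_le_mul_of_nonneg_left hbm hK0
      have h6 : |L| * (((x + 1 : ℕ) : ℝ) + 20) ≤ |L| * (n + 20) := mul_le_mul_of_nonneg_left (by linarith) aL
      have h7 : 20 * |L| * (1 + (n : ℝ) / 2) ≤ K * (1 + (n : ℝ) / 2) := mul_le_mul_of_nonneg_right (by linarith) (by positivity)
      nlinarith
    have hxr : (9 : ℝ) ≤ x := by exact_mod_cast (not_lt.1 hx)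
    rcases red_or m with h | ⟨r, rfl⟩ | ⟨r, rfl⟩
    · obtain ⟨g, hg⟩ := hg
      have hr := h.two_mul_card_le
      have hg1 : 1 ≤ g := by unfold HasG at hg; omega
      have hl := lv_lower hg
      rw [lv_of_wt hm] at hl
      have hlr : ((x + 1 : ℕ) : ℝ) + 2 = 2 * g + n := by exact_mod_cast hl
      have hgr : (1 : ℝ) ≤ g := by exact_mod_cast hg1
      refine (h0 g m hg1 h hg).trans ?_
      rw [div_le_div_iff₀ (by linarith) (by positivity)]
      have h1 : K0 * (((x + 1 : ℕ) : ℝ) + 20) ≤ |K0| * (20 * g + n) := by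
        apply mul_le_mul (le_abs_self _) (by linarith) (by positivity) a0
      have h2 : |K0| * (20 * g + n) ≤ |K0| * (20 * (g * (1 + (n : ℝ) / 2))) := by
        apply mul_le_mul_of_nonneg_left _ a0
        nlinarith
      have h3 : (20 * |K0|) * (1 + (n : ℝ) / 2) ≤ K * (3 / 2) ^ n := by
        apply mul_le_mul _ hbm (by positivity) hK0
        linarith
      have h4 := mul_le_mul_of_nonneg_right h3 (by linarith : (0 : ℝ) ≤ g)
      linarith
    · have hm' := hm
      rw [wt_cons] at hm'
      rw [cm_dil hC]
      · refine (ih r (by omega)).trans ?_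
        rw [hn, Multiset.card_cons, div_le_div_iff₀ (by positivity) (by positivity), pow_succ]
        push_cast
        have : 0 ≤ K * (3 / 2) ^ (Multiset.card r) := by positivity
        have h2 : ((x : ℝ) + 1 + 20) ≤ 3 / 2 * (x + 20) := by linarith
        nlinarith
      · have := lv_of_wt (m := r) (X := x) (by omega)
        left; omega
    · have hl := lv_of_wt hm
      have hm' := hm
      rw [wt_cons] at hm'
      rw [cm_str hC r hg (by omega), hl]
      unfold str
      have hcn : n = Multiset.card r + 1 := by rw [hn, Multiset.card_cons]
      set k := Multiset.card r with hk
      have hb := wsum0_bound r (fun v => cm C ((v - 1) ::ₘ r.erase v)) L (K * (3 / 2) ^ k / ((x : ℝ) + 20)) (by positivity) (by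
        intro v hv h1
        have h2 := wt_move (d := 0) hv (by omega)
        rw [zero_add] at h2
        have := ih ((v - 1) ::ₘ r.erase v) (by omega)
        rwa [Multiset.card_cons, card_erase' hv] at this)
      have hw : (wt r : ℝ) = 3 * x + 2 := by
        have : wt r = 3 * x + 2 := by omega
        rw [this]; push_cast; ring
      have hz : (r.count 0 : ℝ) ≤ k := by exact_mod_cast Multiset.count_le_card 0 r
      have hz0 : (0 : ℝ) ≤ (r.count 0 : ℝ) := by positivity
      set T := (r.map fun v : ℕ => if 1 ≤ v then (2 * (v : ℝ) + 1) * cm C ((v - 1) ::ₘ r.erase v) else 0).sum with hT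
      rw [hw] at hb
      set z : ℝ := (r.count 0 : ℝ)
      have hx0 : (0 : ℝ) < 3 * x := by linarith
      have e : 1 / (3 * (((x + 1 : ℕ) : ℝ) - 1)) * T - L = ((T - (3 * x + 2 - z) * L) + (2 - z) * L) / (3 * x) := by
        push_cast
        rw [add_sub_cancel_right]
        field_simp
        ring
      rw [e, abs_div, abs_of_pos hx0, div_le_div_iff₀ hx0 (by positivity)]
      have h1 : |(T - (3 * x + 2 - z) * L) + (2 - z) * L| ≤ (3 * x + 2) * (K * (3 / 2) ^ k / ((x : ℝ) + 20)) + (k + 2) * |L| := by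
        refine (abs_add_le _ _).trans (add_le_add hb ?_)
        rw [abs_mul]
        apply mul_le_mul_of_nonneg_right _ aL
        rw [abs_le]; constructor <;> linarith
      refine (mul_le_mul_of_nonneg_right h1 (by positivity)).trans ?_
      have hbk := bern k
      have hkr : (0 : ℝ) ≤ k := by positivity
      set Q : ℝ := (3 / 2) ^ k with hQ
      have hQ1 : (0 : ℝ) < Q := by positivity
      have hnQ : (3 / 2 : ℝ) ^ n = 3 / 2 * Q := by rw [hcn, pow_succ]; ring
      rw [hnQ]
      push_cast
      have hy : (0 : ℝ) < x + 20 := by linarith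
      have t1 : (3 * (x : ℝ) + 2) * (K * Q / ((x : ℝ) + 20)) * (x + 1 + 20) ≤ K * Q * (10 / 3 * x) := by
        have : (3 * (x : ℝ) + 2) * (K * Q / ((x : ℝ) + 20)) * (x + 1 + 20) = K * Q * ((3 * x + 2) * (x + 1 + 20) / (x + 20)) := by
          field_simp
        rw [this]
        apply mul_le_mul_of_nonneg_left _ (by positivity)
        rw [div_le_iff₀ hy]
        nlinarith
      have t2 : ((k : ℝ) + 2) * |L| * (x + 1 + 20) ≤ 2 * Q * |L| * (10 / 3 * x) := by
        apply mul_le_mul _ (by linarith) (by positivity) (by positivity)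
        apply mul_le_mul_of_nonneg_right (by linarith) aL
      have t3 : 2 * Q * |L| * (10 / 3 * x) ≤ K * Q * (7 / 6 * x) := by
        have : 2 * |L| * (10 / 3) ≤ K * (7 / 6) := by linarith
        have := mul_le_mul_of_nonneg_right this (by positivity : 0 ≤ Q * x)
        linarith
      linarith

end Part21

section Part22

variable {C : List ℕ → ℚ}

open Filter Topology in
lemma yy_lim (hC : IsNormalizedWitten C) {L K0 : ℝ} (h0 : ∀ g m, 1 ≤ g → Red m → HasG g m → |cm C m - L| ≤ K0 / (g : ℝ)) :
    Tendsto (fun x : ℕ => yy C (x + 1) / ((x + 1).factorial : ℝ)) atTop (𝓝 (L / 2)) := by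
  obtain ⟨K, hK, hb⟩ := cm_all hC h0
  have e1 : ∀ x : ℕ, yy C (x + 1) / ((x + 1).factorial : ℝ) = EW (3 * (x + 1)) (cm C) / 4 := by
    intro x
    unfold yy
    rw [EW_congr (F := bm C) (G := fun m => ((x.factorial : ℝ) / 4) * cm C m), EW_smul, Nat.factorial_succ]
    · push_cast
      have : (x.factorial : ℝ) ≠ 0 := by positivity
      field_simp
    · intro m hm
      unfold bm
      rw [lv_of_wt hm, Nat.add_sub_cancel]; ring
  have pw : ∀ N n : ℕ, (3 / 2 : ℝ) ^ n ≤ (3 / 2) ^ N + (3 / 4) ^ N * 2 ^ n := by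
    intro N n
    rcases le_total n N with h | h
    · have : (3 / 2 : ℝ) ^ n ≤ (3 / 2) ^ N := pow_le_pow_right₀ (by norm_num) h
      have : (0 : ℝ) ≤ (3 / 4) ^ N * 2 ^ n := by positivity
      linarith
    · have h1 : (3 / 2 : ℝ) ^ n = (3 / 4) ^ n * 2 ^ n := by rw [← mul_pow]; norm_num
      have h2 : (3 / 4 : ℝ) ^ n ≤ (3 / 4) ^ N := pow_le_pow_of_le_one (by norm_num) (by norm_num) h
      have h3 : (0 : ℝ) ≤ (3 / 2) ^ N := by positivity
      have h4 := mul_le_mul_of_nonneg_right h2 (by positivity : (0 : ℝ) ≤ 2 ^ n)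
      linarith
  have e2 : ∀ N x : ℕ, |EW (3 * (x + 1)) (cm C) - 2 * L| ≤ 2 * K * (3 / 2) ^ N / ((x : ℝ) + 1) + 12 * K * (3 / 4) ^ N := by
    intro N x
    have hx : (0 : ℝ) < x + 1 := by positivity
    have a1 := EW_mono (3 * (x + 1)) (fun m => 1 * cm C m + (-L) * 1)
      (fun m => K * (3 / 2) ^ N / ((x : ℝ) + 1) * 1 + K * (3 / 4) ^ N / ((x : ℝ) + 1) * 2 ^ (Multiset.card m)) (by
        intro m hm
        have h1 := hb _ m hm
        rw [one_mul, mul_one, ← sub_eq_add_neg]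
        refine h1.trans ?_
        have h2 : K * (3 / 2) ^ (Multiset.card m) / (((x + 1 : ℕ) : ℝ) + 20) ≤ K * (3 / 2) ^ (Multiset.card m) / ((x : ℝ) + 1) := by
          apply div_le_div_of_nonneg_left (by positivity) hx
          push_cast; linarith
        refine h2.trans ?_
        have h3 := mul_le_mul_of_nonneg_left (pw N (Multiset.card m)) hK
        have h4 := div_le_div_of_nonneg_right h3 hx.le
        refine h4.trans (le_of_eq ?_)
        ring)
    rw [EW_lin, EW_lin, show 3 * (x + 1) = (3 * x + 2) + 1 by ring, EW_one, EW_two] at a1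
    rw [show 3 * (x + 1) = (3 * x + 2) + 1 by ring]
    have e : 1 * EW (3 * x + 2 + 1) (cm C) + -L * 2 = EW (3 * x + 2 + 1) (cm C) - 2 * L := by ring
    rw [e] at a1
    refine a1.trans (le_of_eq ?_)
    push_cast
    field_simp
    ring
  have e3 : Tendsto (fun x : ℕ => EW (3 * (x + 1)) (cm C)) atTop (𝓝 (2 * L)) := by
    rw [Metric.tendsto_atTop]
    intro ε hε
    have t1 : Tendsto (fun N : ℕ => 12 * K * (3 / 4 : ℝ) ^ N) atTop (𝓝 (12 * K * 0)) :=
      (tendsto_pow_atTop_nhds_zero_of_lt_one (by norm_num) (by norm_num)).const_mul _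
    rw [mul_zero] at t1
    obtain ⟨N, hN⟩ := ((tendsto_order.1 t1).2 (ε / 2) (by linarith)).exists
    have t2 : Tendsto (fun x : ℕ => 2 * K * (3 / 2 : ℝ) ^ N / ((x : ℝ) + 1)) atTop (𝓝 0) :=
      tendsto_const_nhds.div_atTop (tendsto_atTop_add_const_right _ _ tendsto_natCast_atTop_atTop)
    obtain ⟨n0, hn0⟩ := eventually_atTop.1 ((tendsto_order.1 t2).2 (ε / 2) (by linarith))
    refine ⟨n0, fun x hx => ?_⟩
    rw [Real.dist_eq]
    have := e2 N x
    have := hn0 x hx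
    linarith
  simp only [e1]
  have := e3.div_const 4
  rw [show 2 * L / 4 = L / 2 by ring] at this
  exact this

/-- the comparison sequence -/
def UU : ℕ → ℝ
  | 0 => 1
  | x + 1 => ((x : ℝ) + 5 / 6) * (x + 1 / 6) / (x + 1) * UU x

lemma UU_pos (n : ℕ) : 0 < UU n := by
  induction n with
  | zero => simp [UU]
  | succ n ih => rw [UU]; positivity

lemma UU_le (n : ℕ) : UU n ≤ (n.factorial : ℝ) := by
  induction n with
  | zero => simp [UU]
  | succ n ih =>
    rw [UU, Nat.factorial_succ]
    push_cast
    apply mul_le_mul _ ih (UU_pos n).le (by positivity)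
    rw [div_le_iff₀ (by positivity)]
    have : (0 : ℝ) ≤ n := by positivity
    nlinarith

open PowerSeries

def tht (f : PowerSeries ℝ) : PowerSeries ℝ := X * derivative ℝ f

lemma coeff_tht (n : ℕ) (f : PowerSeries ℝ) : coeff n (tht f) = (n : ℝ) * coeff n f := by
  unfold tht
  cases n with
  | zero => simp
  | succ n => rw [coeff_succ_X_mul, coeff_derivative]; push_cast; ring

lemma tht_mul (f g : PowerSeries ℝ) : tht (f * g) = tht f * g + f * tht g := by
  unfold tht
  rw [Derivation.leibniz]
  simp only [smul_eq_mul]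
  ring

lemma tht_add (f g : PowerSeries ℝ) : tht (f + g) = tht f + tht g := by
  unfold tht
  rw [map_add, mul_add]

lemma UU_conv (hC : IsNormalizedWitten C) (x : ℕ) : (x : ℝ) * UU x = ∑ p ∈ Finset.HasAntidiagonal.antidiagonal x, yy C p.1 * UU p.2 := by
  set Y : PowerSeries ℝ := PowerSeries.mk (yy C) with hY
  set U : PowerSeries ℝ := PowerSeries.mk UU with hU
  set c : PowerSeries ℝ := PowerSeries.C (5 / 36 : ℝ) with hc
  have eY : Y = X * (c + tht Y + Y * Y + Y) := by
    ext n
    cases n with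
    | zero => simp [hY, yy_zero]
    | succ n =>
      rw [coeff_succ_X_mul]
      simp only [map_add, coeff_tht, coeff_mul, hY, coeff_mk, hc]
      rcases Nat.eq_zero_or_pos n with h | h
      · subst h
        simp [yy_zero, yy_one hC]
      · rw [yy_rec hC n h, coeff_C, if_neg (by omega)]; ring
  have eU : tht U = X * (c * U + tht U + tht (tht U)) := by
    ext n
    cases n with
    | zero => simp [coeff_tht]
    | succ n =>
      rw [coeff_succ_X_mul]
      simp only [map_add, coeff_tht, hU, coeff_mk, hc, coeff_C_mul]
      rw [UU]
      push_cast
      field_simp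
      ring
  set W : PowerSeries ℝ := tht U - Y * U with hW
  have eT : tht U = W + Y * U := by rw [hW]; ring
  have eW : W = X * (W + tht W + Y * W) := by
    have h1 : tht (tht U) = tht W + (tht Y * U + Y * (W + Y * U)) := by
      conv_lhs => rw [eT]
      rw [tht_add, tht_mul, ← eT]
    have h2 : W + Y * U = X * (c * U + (W + Y * U) + (tht W + (tht Y * U + Y * (W + Y * U)))) := by
      rw [← h1, ← eT]; exact eU
    linear_combination h2 - U * eY
  have hz : ∀ n, coeff n W = 0 := by
    intro n
    induction n using Nat.strong_induction_on with
    | _ n ih =>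
      cases n with
      | zero => rw [eW]; simp
      | succ n =>
        rw [eW, coeff_succ_X_mul, map_add, map_add, coeff_tht, ih n (by omega), coeff_mul, Finset.sum_eq_zero]
        · simp
        · intro p hp
          rw [Finset.HasAntidiagonal.mem_antidiagonal] at hp
          rw [ih p.2 (by omega), mul_zero]
  have := hz x
  rw [hW, map_sub, coeff_tht, coeff_mul, sub_eq_zero] at this
  simpa [hU, hY] using this

lemma fact_two (k l : ℕ) : (k + 2).factorial * (l + 2).factorial ≤ 2 * (k + l + 2).factorial := by
  induction l with
  | zero => simp [Nat.factorial]; exact le_of_eq (by ring)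
  | succ l ih =>
    rw [show l + 1 + 2 = (l + 2) + 1 by ring, Nat.factorial_succ (l + 2), show k + (l + 1) + 2 = (k + l + 2) + 1 by ring, Nat.factorial_succ (k + l + 2)]
    calc (k + 2).factorial * ((l + 2 + 1) * (l + 2).factorial) = (l + 2 + 1) * ((k + 2).factorial * (l + 2).factorial) := by ring
      _ ≤ (k + l + 2 + 1) * (2 * (k + l + 2).factorial) := Nat.mul_le_mul (by omega) ih
      _ = _ := by ring

lemma yU_close (hC : IsNormalizedWitten C) {B : ℝ} (hB : ∀ n, |yy C n| ≤ B * (n.factorial : ℝ)) (x : ℕ) (hx : 2 ≤ x) :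
    |(x : ℝ) * UU x - yy C x| ≤ 8 * B * ((x - 1).factorial : ℝ) := by
  have hB0 : 0 ≤ B := by
    have := hB 0
    rw [yy_zero] at this; simpa using this
  rw [UU_conv hC x, Finset.Nat.sum_antidiagonal_eq_sum_range_succ (fun a b => yy C a * UU b), Finset.sum_range_succ, Nat.sub_self,
    show UU 0 = 1 by simp [UU], mul_one, add_sub_cancel_right]
  refine (Finset.abs_sum_le_sum_abs _ _).trans ?_
  have hterm : ∀ k ∈ Finset.range x, |yy C k * UU (x - k)| ≤ B * (2 * ((x - 2).factorial : ℝ) + (if k = 1 then ((x - 1).factorial : ℝ) else 0) +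
      (if k = x - 1 then ((x - 1).factorial : ℝ) else 0)) := by
    intro k hk
    rw [Finset.mem_range] at hk
    by_cases h0 : k = 0
    · subst h0
      rw [yy_zero]
      simp only [zero_mul, abs_zero]
      have : (0 : ℝ) ≤ (if 0 = x - 1 then ((x - 1).factorial : ℝ) else 0) := by split_ifs <;> positivity
      simp only [zero_ne_one, if_false]
      positivity
    rw [abs_mul, abs_of_pos (UU_pos _)]
    have h1 : |yy C k| * UU (x - k) ≤ (B * (k.factorial : ℝ)) * ((x - k).factorial : ℝ) :=
      mul_le_mul (hB k) (UU_le _) (UU_pos _).le (by positivity)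
    refine h1.trans ?_
    rw [mul_assoc]
    apply mul_le_mul_of_nonneg_left _ hB0
    have p1 : (0 : ℝ) ≤ ((x - 1).factorial : ℝ) := by positivity
    have p2 : (0 : ℝ) ≤ ((x - 2).factorial : ℝ) := by positivity
    by_cases h2 : k = 1
    · rw [if_pos h2, h2, Nat.factorial_one]
      have : (0 : ℝ) ≤ (if 1 = x - 1 then ((x - 1).factorial : ℝ) else 0) := by split_ifs <;> positivity
      push_cast; linarith
    by_cases h3 : k = x - 1
    · rw [if_pos h3, if_neg h2, h3, show x - (x - 1) = 1 by omega, Nat.factorial_one]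
      push_cast; linarith
    rw [if_neg h2, if_neg h3]
    have := fact_two (k - 2) (x - k - 2)
    rw [show k - 2 + 2 = k by omega, show x - k - 2 + 2 = x - k by omega, show k - 2 + (x - k - 2) + 2 = x - 2 by omega] at this
    have h4 : ((k.factorial : ℝ)) * ((x - k).factorial : ℝ) ≤ 2 * ((x - 2).factorial : ℝ) := by exact_mod_cast this
    linarith
  refine (Finset.sum_le_sum hterm).trans ?_
  rw [← Finset.mul_sum, Finset.sum_add_distrib, Finset.sum_add_distrib, Finset.sum_ite_eq' , Finset.sum_ite_eq', if_pos (by simp; omega), if_pos (by simp; omega),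
    Finset.sum_const, Finset.card_range, nsmul_eq_mul]
  have hf : ((x - 1).factorial : ℝ) = ((x : ℝ) - 1) * ((x - 2).factorial : ℝ) := by
    obtain ⟨k, rfl⟩ := Nat.exists_eq_add_of_le hx
    rw [show 2 + k - 1 = k + 1 by omega, show 2 + k - 2 = k by omega, Nat.factorial_succ]
    push_cast; ring
  have hxr : (2 : ℝ) ≤ x := by exact_mod_cast hx
  have p2 : (0 : ℝ) ≤ ((x - 2).factorial : ℝ) := by positivity
  rw [hf, mul_comm 8 B, mul_assoc]
  apply mul_le_mul_of_nonneg_left _ hB0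
  nlinarith

lemma UU_prod (n : ℕ) : ∏ j ∈ Finset.range n, ((1 / 6 + (j : ℝ)) * (5 / 6 + j)) = (n.factorial : ℝ) * UU n := by
  induction n with
  | zero => simp [UU]
  | succ n ih =>
    rw [Finset.prod_range_succ, ih, Nat.factorial_succ, UU]
    push_cast
    field_simp
    ring

open Filter Topology

lemma UU_lim : Tendsto (fun n : ℕ => UU (n + 1) / (n.factorial : ℝ)) atTop (𝓝 (1 / (2 * Real.pi))) := by
  have h1 := Real.GammaSeq_tendsto_Gamma (1 / 6)
  have h2 := Real.GammaSeq_tendsto_Gamma (5 / 6)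
  have h3 := h1.mul h2
  have hG : Real.Gamma (1 / 6) * Real.Gamma (5 / 6) = 2 * Real.pi := by
    have := Real.Gamma_mul_Gamma_one_sub (1 / 6)
    rw [show (1 : ℝ) - 1 / 6 = 5 / 6 by norm_num, show Real.pi * (1 / 6) = Real.pi / 6 by ring, Real.sin_pi_div_six] at this
    rw [this]; ring
  rw [hG] at h3
  have h4 : Tendsto (fun n : ℕ => (n : ℝ) / ((n : ℝ) + 1)) atTop (𝓝 1) := tendsto_natCast_div_add_atTop 1
  have h5 := h4.div h3 (by positivity)
  refine h5.congr' ?_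
  filter_upwards [eventually_ge_atTop 1] with n hn
  have hn' : (0 : ℝ) < n := by exact_mod_cast hn
  have hU := UU_pos (n + 1)
  simp only [Pi.div_apply]
  have e : Real.GammaSeq (1 / 6) n * Real.GammaSeq (5 / 6) n = (n : ℝ) * (n.factorial : ℝ) / (((n : ℝ) + 1) * UU (n + 1)) := by
    unfold Real.GammaSeq
    rw [div_mul_div_comm, ← Finset.prod_mul_distrib, UU_prod, Nat.factorial_succ]
    have : (n : ℝ) ^ (1 / 6 : ℝ) * (n : ℝ) ^ (5 / 6 : ℝ) = n := by
      rw [← Real.rpow_add hn']; norm_num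
    have hnf : (n.factorial : ℝ) ≠ 0 := by positivity
    push_cast
    rw [show (n : ℝ) ^ (1 / 6 : ℝ) * (n.factorial : ℝ) * ((n : ℝ) ^ (5 / 6 : ℝ) * (n.factorial : ℝ)) =
      ((n : ℝ) ^ (1 / 6 : ℝ) * (n : ℝ) ^ (5 / 6 : ℝ)) * ((n.factorial : ℝ) * (n.factorial : ℝ)) by ring, this]
    field_simp
  rw [e]
  have hnf : (n.factorial : ℝ) ≠ 0 := by positivity
  field_simp

theorem L_eq (hC : IsNormalizedWitten C) {L K0 : ℝ} (h0 : ∀ g m, 1 ≤ g → Red m → HasG g m → |cm C m - L| ≤ K0 / (g : ℝ)) : L = 1 / Real.pi := by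
  have hy := yy_lim hC h0
  obtain ⟨B, hB⟩ := hy.abs.bddAbove_range
  have hB' : ∀ n, |yy C n| ≤ B * (n.factorial : ℝ) := by
    intro n
    have hB1 : ∀ k : ℕ, |yy C (k + 1) / ((k + 1).factorial : ℝ)| ≤ B := fun k => hB ⟨k, rfl⟩
    cases n with
    | zero =>
      rw [yy_zero]
      have := (abs_nonneg _).trans (hB1 0)
      simpa using this
    | succ k =>
      have := hB1 k
      rw [abs_div, abs_of_pos (by positivity : (0 : ℝ) < ((k + 1).factorial : ℝ)), div_le_iff₀ (by positivity)] at this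
      exact this
  have hd : Tendsto (fun n : ℕ => UU (n + 1) / (n.factorial : ℝ) - yy C (n + 1) / ((n + 1).factorial : ℝ)) atTop (𝓝 0) := by
    have t2 : Tendsto (fun x : ℕ => 8 * B / ((x : ℝ) + 1)) atTop (𝓝 0) :=
      tendsto_const_nhds.div_atTop (tendsto_atTop_add_const_right _ _ tendsto_natCast_atTop_atTop)
    apply squeeze_zero_norm' _ t2
    filter_upwards [eventually_ge_atTop 1] with n hn
    have h := yU_close hC hB' (n + 1) (by omega)
    rw [Nat.add_sub_cancel] at h
    have hf : (0 : ℝ) < (n.factorial : ℝ) := by positivity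
    have e : UU (n + 1) / (n.factorial : ℝ) - yy C (n + 1) / ((n + 1).factorial : ℝ) =
        (((n + 1 : ℕ) : ℝ) * UU (n + 1) - yy C (n + 1)) / (((n : ℝ) + 1) * (n.factorial : ℝ)) := by
      rw [Nat.factorial_succ]
      push_cast
      field_simp
    rw [Real.norm_eq_abs, e, abs_div, abs_of_pos (by positivity : (0 : ℝ) < ((n : ℝ) + 1) * (n.factorial : ℝ)), div_le_div_iff₀ (by positivity) (by positivity)]
    calc _ ≤ 8 * B * (n.factorial : ℝ) * ((n : ℝ) + 1) := mul_le_mul_of_nonneg_right h (by positivity)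
      _ = _ := by ring
  have hy2 := UU_lim.sub hd
  have : (fun n : ℕ => UU (n + 1) / (n.factorial : ℝ) - (UU (n + 1) / (n.factorial : ℝ) - yy C (n + 1) / ((n + 1).factorial : ℝ))) = fun n : ℕ => yy C (n + 1) / ((n + 1).factorial : ℝ) := by
    funext n; ring
  rw [this] at hy2
  have hu := tendsto_nhds_unique hy hy2
  have hp := Real.pi_pos
  rw [sub_zero] at hu
  have : L = 2 * (1 / (2 * Real.pi)) := by linarith
  rw [this]
  field_simp

end Part22

section Part23

lemma R_twos (t : ℝ) (ht : 1 ≤ t) :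
    |Rv (5 * t) (fun i => if i = 2 then 3 * t else 0) - (1 - 2 / (9 * (t + 1)) - 238 / (2025 * (t + 1) ^ 2) - 198149 / (2733750 * (t + 1) ^ 3))| ≤ 2 / (t + 1) ^ 4 := by
  have ht0 : t ≠ 0 := by linarith
  have hg0 : t + 1 ≠ 0 := by linarith
  have e : Rv (5 * t) (fun i => if i = 2 then 3 * t else 0) - (1 - 2 / (9 * (t + 1)) - 238 / (2025 * (t + 1) ^ 2) - 198149 / (2733750 * (t + 1) ^ 3)) =
      -(163049 / 2733750 + 67649 / 911250 * t + 79349 / 911250 * t ^ 2) / (t ^ 3 * (t + 1) ^ 3) := by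
    have h2 : 3 * t / (5 * t) = 3 / 5 := by field_simp
    unfold Rv Rg
    norm_num [h2]
    field_simp
    ring
  have hp : 0 < t ^ 3 * (t + 1) ^ 3 := by positivity
  rw [e, abs_div, abs_of_pos hp, abs_neg, abs_of_pos (by positivity), div_le_div_iff₀ hp (by positivity)]
  have h1 : 163049 / 2733750 + 67649 / 911250 * t + 79349 / 911250 * t ^ 2 ≤ t ^ 2 := by nlinarith
  have h2 : t ^ 2 * (t + 1) ≤ 2 * t ^ 3 := by nlinarith [sq_nonneg t]
  have h3 : (163049 / 2733750 + 67649 / 911250 * t + 79349 / 911250 * t ^ 2) * (t + 1) ≤ 2 * t ^ 3 :=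
    (mul_le_mul_of_nonneg_right h1 (by linarith)).trans h2
  have := mul_le_mul_of_nonneg_right h3 (by positivity : 0 ≤ (t + 1) ^ 3)
  linarith

theorem two_tuple_asymptotics (C : List ℕ → ℚ) (hC : IsNormalizedWitten C) :
    ∃ K : ℝ, ∃ g₀ : ℕ, ∀ g : ℕ, g₀ ≤ g →
      |(C (List.replicate (3 * g - 3) 2) : ℝ) -
        1 / Real.pi *
          (1 - 2 / (9 * (g : ℝ)) - 238 / (2025 * (g : ℝ) ^ 2) -
            198149 / (2733750 * (g : ℝ) ^ 3))| ≤ K / (g : ℝ) ^ 4 := by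
  obtain ⟨L, K0, K, h0, h1⟩ := main_exp hC
  have hL := L_eq hC h0
  refine ⟨K + |L| * 2, 2, fun g hg => ?_⟩
  obtain ⟨k, rfl⟩ : ∃ k, g = k + 1 := ⟨g - 1, by omega⟩
  have hk : (1 : ℝ) ≤ k := by exact_mod_cast (by omega : 1 ≤ k)
  have e1 : 3 * (k + 1) - 3 = 3 * k := by omega
  rw [e1, ← cm_coe hC _ (by simp; omega)]
  set m : Multiset ℕ := ((List.replicate (3 * k) 2 : List ℕ) : Multiset ℕ) with hm
  have hm' : m = Multiset.replicate (3 * k) 2 := by rw [hm, Multiset.coe_replicate]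
  have hG : HasG (k + 1) m := by
    rw [hm']; simp [HasG]; ring
  have hr : Red m := by
    intro v hv
    rw [hm'] at hv
    rw [Multiset.eq_of_mem_replicate hv]
  have hlv : lv m = 5 * k := by
    rw [hm']; simp [lv]; omega
  have hR : R m = Rv (5 * (k : ℝ)) (fun i => if i = 2 then 3 * (k : ℝ) else 0) := by
    unfold R
    rw [hlv]
    push_cast
    apply Rv_congr
    intro i _ _
    rw [hm', Multiset.count_replicate]
    by_cases h : i = 2
    · simp [h]
    · simp [h, Ne.symm h]
  have a1 := h1 (k + 1) m (by omega) hr hG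
  have a2 := R_twos k hk
  rw [hR] at a1
  rw [← hL]
  push_cast at a1 ⊢
  set T : ℝ := 1 - 2 / (9 * ((k : ℝ) + 1)) - 238 / (2025 * ((k : ℝ) + 1) ^ 2) - 198149 / (2733750 * ((k : ℝ) + 1) ^ 3) with hT
  set V := Rv (5 * (k : ℝ)) (fun i => if i = 2 then 3 * (k : ℝ) else 0) with hV
  have e : cm C m - L * T = (cm C m - L * V) + L * (V - T) := by ring
  rw [e, add_div]
  refine (abs_add_le _ _).trans (add_le_add a1 ?_)
  rw [abs_mul, mul_div_assoc]
  exact mul_le_mul_of_nonneg_left a2 (abs_nonneg _)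

end Part23

end WittenAsym
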